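/- arXiv:1102.0362 — 3 statements merged into one kernel-verified Lean document; each statement's English description precedes it below -/
import Mathlib

section
/- Let K be a field and let α : [0,∞) → [0,∞) be a weakly increasing function tending to ∞. Then there exists a finitely generated connected ℕ-graded K-algebra B = ⊕_{n≥0} B(n) such that B is infinite-dimensional over K, every element of the homogeneous maximal ideal ⊕_{n≥1} B(n) is nilpotent, and dim_K B(n) ≤ n^{α(n)} for all sufficiently large n. -/
open Module

universe u

namespace Kur

variable {K : Type u} [Field K]

/-- The free algebra on two letters. -/
abbrev A (K : Type u) [Field K] := MonoidAlgebra K (FreeMonoid Bool)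

/-- Functions on words. -/
abbrev Fn (K : Type u) := List Bool → K

/-- A word as an element of the free algebra. -/
noncomputable def wd (l : List Bool) : A K := MonoidAlgebra.single (FreeMonoid.ofList l) 1

/-- The basis of words. -/
noncomputable def wb : Basis (List Bool) K (A K) :=
  (Basis.ofRepr (MonoidAlgebra.coeffLinearEquiv K)).reindex FreeMonoid.toList

theorem wb_apply (l : List Bool) : wb l = (wd l : A K) := by
  simp [wb, wd]

theorem wd_append (l m : List Bool) : (wd (l ++ m) : A K) = wd l * wd m := by
  simp [wd, MonoidAlgebra.single_mul_single]

theorem wd_nil : (wd [] : A K) = 1 := by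
  simp [wd, MonoidAlgebra.one_def]

theorem wext {M : Type*} [AddCommGroup M] [Module K M] {f g : A K →ₗ[K] M}
    (h : ∀ l, f (wd l) = g (wd l)) : f = g :=
  wb.ext fun l => by rw [wb_apply]; exact h l

theorem wspan : Submodule.span K (Set.range (wd : List Bool → A K)) = ⊤ := by
  rw [← wb.span_eq]
  congr 1
  ext x
  simp [wb_apply]

/-- The pairing. -/
noncomputable def pr : Fn K →ₗ[K] A K →ₗ[K] K := (wb.constr K).toLinearMap

@[simp] theorem pr_wd (f : Fn K) (l : List Bool) : pr f (wd l) = f l := by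
  rw [← wb_apply]; exact wb.constr_basis K f l

/-- The cut product. -/
def mk (k : ℕ) : Fn K →ₗ[K] Fn K →ₗ[K] Fn K :=
  LinearMap.mk₂ K (fun f g l => f (l.take k) * g (l.drop k))
    (by intros; ext; simp [add_mul]) (by intros; ext; simp [mul_assoc])
    (by intros; ext; simp [mul_add]) (by intros; ext; simp [mul_left_comm])

theorem mk_apply (k : ℕ) (f g : Fn K) (l : List Bool) :
    mk k f g l = f (l.take k) * g (l.drop k) := rfl

/-- Functions supported on words of length `k`. -/
def Hom (K : Type u) [Field K] (k : ℕ) : Submodule K (Fn K) where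
  carrier := {f | ∀ l, l.length ≠ k → f l = 0}
  add_mem' := by intro a b ha hb l hl; simp [ha l hl, hb l hl]
  zero_mem' := by intro l _; rfl
  smul_mem' := by intro c a ha l hl; simp [ha l hl]

theorem mem_Hom {k : ℕ} {f : Fn K} : f ∈ Hom K k ↔ ∀ l, l.length ≠ k → f l = 0 := Iff.rfl

theorem mk_mem_Hom {k j : ℕ} {f g : Fn K} (hf : f ∈ Hom K k) (hg : g ∈ Hom K j) :
    mk k f g ∈ Hom K (k + j) := by
  intro l hl
  rw [mk_apply]
  by_cases h : (l.take k).length = k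
  · rw [hg, mul_zero]
    simp at h ⊢; omega
  · rw [hf _ h, zero_mul]

theorem subkill {V ι : Type*} [AddCommGroup V] [Module K V] [Fintype ι] (P : Submodule K V)
    [FiniteDimensional K P] (ψ : ι → V →ₗ[K] K) {n : ℕ} (h : n + Fintype.card ι ≤ finrank K P) :
    ∃ T : Submodule K V, FiniteDimensional K T ∧ finrank K T = n ∧ T ≤ P ∧
      ∀ t ∈ T, ∀ i, ψ i t = 0 := by
  let φ : P →ₗ[K] (ι → K) := LinearMap.pi fun r => (ψ r).comp P.subtype
  have hφ : n ≤ finrank K (LinearMap.ker φ) := by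
    have h1 := LinearMap.finrank_range_add_finrank_ker φ
    have h2 : finrank K (LinearMap.range φ) ≤ Fintype.card ι := by
      refine (Submodule.finrank_le _).trans ?_
      simp
    omega
  obtain ⟨f, hf⟩ := exists_linearIndependent_of_le_finrank hφ
  let z : Fin n → V := fun i => ((f i : P) : V)
  have hz : LinearIndependent K z :=
    (hf.map' (LinearMap.ker φ).subtype (by simp)).map' P.subtype (by simp)
  refine ⟨Submodule.span K (Set.range z), FiniteDimensional.span_of_finite K (Set.finite_range z),
    ?_, ?_, ?_⟩
  · rw [finrank_span_eq_card hz]; simp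
  · rw [Submodule.span_le]
    rintro _ ⟨i, rfl⟩
    exact (f i : P).2
  · intro t ht i
    have : Submodule.span K (Set.range z) ≤ LinearMap.ker (ψ i) := by
      rw [Submodule.span_le]
      rintro _ ⟨j, rfl⟩
      have h1 : φ (f j : P) = 0 := (f j).2
      exact congrFun h1 i
    exact this ht

theorem step {k v n : ℕ} (T : Submodule K (Fn K)) (hT : T ≤ Hom K k) [FiniteDimensional K T]
    (hv : finrank K T = v) (F : Finset (A K)) (hF : n + F.card ≤ v ^ 2) :
    ∃ T' : Submodule K (Fn K), FiniteDimensional K T' ∧ finrank K T' = n ∧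
      T' ≤ Submodule.map₂ (mk k) T T ∧ T' ≤ Hom K (k + k) ∧ ∀ t ∈ T', ∀ r ∈ F, pr t r = 0 := by
  let b := finBasisOfFinrankEq K T hv
  have hbl : LinearIndependent K (fun i => (b i : Fn K)) :=
    b.linearIndependent.map' T.subtype (by simp)
  let y : Fin v × Fin v → Fn K := fun ij => mk k (b ij.1) (b ij.2)
  have hlen : ∀ (i : Fin v) (l : List Bool), l.length ≠ k → (b i : Fn K) l = 0 := fun i l hl =>
    hT (b i).2 l hl
  have hy : LinearIndependent K y := by
    rw [Fintype.linearIndependent_iff] at hbl ⊢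
    intro c hc ij
    have h1 : ∀ w : List Bool, ∀ i, ∑ j, c (i, j) * (b j : Fn K) w = 0 := by
      intro w
      apply hbl
      ext l
      by_cases hl : l.length = k
      · have := congrFun hc (l ++ w)
        rw [Fintype.sum_prod_type] at this
        simp [y, mk_apply, Finset.sum_apply, ← hl] at this ⊢
        rw [← this]
        refine Finset.sum_congr rfl fun i _ => ?_
        rw [Finset.sum_mul]
        refine Finset.sum_congr rfl fun j _ => ?_
        ring
      · simp [Finset.sum_apply, hlen _ l hl]
    have h2 : ∑ j, c (ij.1, j) • (b j : Fn K) = 0 := by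
      ext w
      simpa using h1 w ij.1
    exact hbl _ h2 ij.2
  let P := Submodule.span K (Set.range y)
  have hP : finrank K P = v ^ 2 := by
    rw [finrank_span_eq_card hy]; simp [sq]
  have : FiniteDimensional K P := FiniteDimensional.span_of_finite K (Set.finite_range y)
  obtain ⟨T', h1, h2, h3, h4⟩ := subkill P (fun r : F => pr.flip (r : A K)) (n := n)
    (by simpa [hP] using hF)
  have hle : T' ≤ Submodule.map₂ (mk k) T T := by
    refine h3.trans ?_
    rw [Submodule.span_le]
    rintro _ ⟨ij, rfl⟩
    exact Submodule.apply_mem_map₂ _ (b ij.1).2 (b ij.2).2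
  refine ⟨T', h1, h2, hle, hle.trans ?_, fun t ht r hr => h4 t ht ⟨r, hr⟩⟩
  rw [Submodule.map₂_le]
  intro f hf g hg
  exact mk_mem_Hom (hT hf) (hT hg)

/-- Existence of the tower. -/
theorem tower (v : ℕ → ℕ) (F : ℕ → Finset (A K)) (hv0 : v 0 = 2)
    (hv : ∀ m, v (m + 1) + (F (m + 1)).card ≤ v m ^ 2) :
    ∃ T : ℕ → Submodule K (Fn K), (∀ m, FiniteDimensional K (T m)) ∧
      (∀ m, finrank K (T m) = v m) ∧ (∀ m, T m ≤ Hom K (2 ^ m)) ∧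
      (∀ m, T (m + 1) ≤ Submodule.map₂ (mk (2 ^ m)) (T m) (T m)) ∧
      (∀ m, ∀ t ∈ T (m + 1), ∀ r ∈ F (m + 1), pr t r = 0) := by
  have base : ∃ T : Submodule K (Fn K), FiniteDimensional K T ∧ finrank K T = v 0 ∧
      T ≤ Hom K (2 ^ 0) := by
    let y : Bool → Fn K := fun b => Pi.single [b] 1
    have hy : LinearIndependent K y := by
      have := (Pi.linearIndependent_single_one (List Bool) K)
      exact this.comp (fun b : Bool => [b]) (fun a b h => by simpa using h)
    refine ⟨Submodule.span K (Set.range y), FiniteDimensional.span_of_finite K (Set.finite_range y),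
      ?_, ?_⟩
    · rw [finrank_span_eq_card hy, hv0]; simp
    · rw [Submodule.span_le]
      rintro _ ⟨b, rfl⟩ l hl
      refine Pi.single_eq_of_ne ?_ _
      rintro rfl
      simp at hl
  let S : ℕ → Type u := fun m => {T : Submodule K (Fn K) // FiniteDimensional K T ∧
    finrank K T = v m ∧ T ≤ Hom K (2 ^ m)}
  have hs : ∀ m (T : S m), ∃ T' : S (m + 1), T'.1 ≤ Submodule.map₂ (mk (2 ^ m)) T.1 T.1 ∧
      ∀ t ∈ T'.1, ∀ r ∈ F (m + 1), pr t r = 0 := by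
    rintro m ⟨T, h1, h2, h3⟩
    obtain ⟨T', a, b, c, d, e⟩ := step T h3 h2 (F (m + 1)) (hv m)
    refine ⟨⟨T', a, b, ?_⟩, c, e⟩
    rwa [pow_succ, mul_two]
  choose nx hnx using hs
  obtain ⟨T0, hT0⟩ := base
  let T : ∀ m, S m := fun m => Nat.rec (motive := S) ⟨T0, hT0⟩ (fun m t => nx m t) m
  exact ⟨fun m => (T m).1, fun m => (T m).2.1, fun m => (T m).2.2.1, fun m => (T m).2.2.2,
    fun m => (hnx m (T m)).1, fun m => (hnx m (T m)).2⟩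

/-! ### Cutting -/

/-- Sum over all cuts of the middle argument (the left piece being nonempty). -/
noncomputable def cut (f g : Fn K) (x y : A K) : A K →ₗ[K] K :=
  wb.constr K fun w => ∑ i ∈ Finset.range w.length,
    pr f (x * wd (w.take (i + 1))) * pr g (wd (w.drop (i + 1)) * y)

theorem cut_wd (f g : Fn K) (x y : A K) (w : List Bool) :
    cut f g x y (wd w) = ∑ i ∈ Finset.range w.length,
    pr f (x * wd (w.take (i + 1))) * pr g (wd (w.drop (i + 1)) * y) := by
  rw [← wb_apply]; exact wb.constr_basis K _ w

theorem wind {p : A K → Prop} (h : ∀ l, p (wd l)) (h0 : p 0) (ha : ∀ x y, p x → p y → p (x + y))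
    (hs : ∀ (c : K) x, p x → p (c • x)) (x : A K) : p x := by
  have hx : x ∈ Submodule.span K (Set.range (wd : List Bool → A K)) := by rw [wspan]; trivial
  induction hx using Submodule.span_induction with
  | mem x hx => obtain ⟨l, rfl⟩ := hx; exact h l
  | zero => exact h0
  | add x y _ _ hx hy => exact ha x y hx hy
  | smul c x _ hx => exact hs c x hx

theorem cut_add_y (f g : Fn K) (x y y' z : A K) :
    cut f g x (y + y') z = cut f g x y z + cut f g x y' z := by
  induction z using wind with
  | h l => simp [cut_wd, mul_add, Finset.sum_add_distrib]
  | h0 => simp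
  | ha a b ha hb => simp only [map_add, ha, hb]; ring
  | hs c a ha => simp only [map_smul, ha, smul_add]

theorem cut_smul_y (f g : Fn K) (x y z : A K) (c : K) :
    cut f g x (c • y) z = c * cut f g x y z := by
  induction z using wind with
  | h l => simp [cut_wd, Finset.mul_sum, mul_left_comm]
  | h0 => simp
  | ha a b ha hb => simp only [map_add, ha, hb]; ring
  | hs c a ha => simp only [map_smul, ha, smul_eq_mul]; ring

theorem cut_add_x (f g : Fn K) (x x' y z : A K) :
    cut f g (x + x') y z = cut f g x y z + cut f g x' y z := by
  induction z using wind with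
  | h l => simp [cut_wd, add_mul, Finset.sum_add_distrib]
  | h0 => simp
  | ha a b ha hb => simp only [map_add, ha, hb]; ring
  | hs c a ha => simp only [map_smul, ha, smul_add]

theorem cut_smul_x (f g : Fn K) (x y z : A K) (c : K) :
    cut f g (c • x) y z = c * cut f g x y z := by
  induction z using wind with
  | h l => simp [cut_wd, Finset.mul_sum, mul_assoc]
  | h0 => simp
  | ha a b ha hb => simp only [map_add, ha, hb]; ring
  | hs c a ha => simp only [map_smul, ha, smul_eq_mul]; ring

theorem cut_mul (f g : Fn K) (x y z z' : A K) :
    cut f g x y (z * z') = cut f g x (z' * y) z + cut f g (x * z) y z' := by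
  induction z using wind with
  | h l =>
    induction z' using wind with
    | h m =>
      rw [← wd_append, cut_wd, cut_wd, cut_wd, List.length_append, Finset.sum_range_add]
      congr 1
      · refine Finset.sum_congr rfl fun i hi => ?_
        rw [Finset.mem_range] at hi
        rw [List.take_append_of_le_length (by omega), List.drop_append_of_le_length (by omega),
          wd_append, mul_assoc]
      · refine Finset.sum_congr rfl fun i hi => ?_
        rw [add_assoc, List.take_length_add_append, List.drop_length_add_append,
          wd_append, mul_assoc]
    | h0 => simpa using (cut_smul_y f g x 0 (wd l) 0).symm
    | ha a b ha hb => simp only [mul_add, add_mul, map_add, ha, hb, cut_add_y]; ring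
    | hs c a ha =>
      simp only [mul_smul_comm, smul_mul_assoc, map_smul, ha, cut_smul_y, smul_eq_mul]; ring
  | h0 => simpa using (cut_smul_x f g 0 y z' 0).symm
  | ha a b ha hb => simp only [mul_add, add_mul, map_add, ha, hb, cut_add_x]; ring
  | hs c a ha =>
    simp only [mul_smul_comm, smul_mul_assoc, map_smul, ha, cut_smul_x, smul_eq_mul]; ring

theorem pr_mk {k : ℕ} (hk : 0 < k) {f : Fn K} (hf : f ∈ Hom K k) (g : Fn K) (z : A K) :
    pr (mk k f g) z = cut f g 1 1 z := by
  induction z using wind with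
  | h l =>
    rw [pr_wd, cut_wd, mk_apply]
    simp only [one_mul, mul_one, pr_wd]
    by_cases h : k ≤ l.length
    · rw [Finset.sum_eq_single (k - 1)]
      · rw [Nat.sub_add_cancel hk]
      · intro i hi hik
        rw [Finset.mem_range] at hi
        rw [hf, zero_mul]
        simp; omega
      · intro hi
        simp at hi; omega
    · rw [hf, zero_mul]
      · symm
        refine Finset.sum_eq_zero fun i hi => ?_
        rw [Finset.mem_range] at hi
        rw [hf, zero_mul]
        simp; omega
      · simp; omega
  | h0 => simp
  | ha a b ha hb => simp only [map_add, ha, hb]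
  | hs c a ha => simp only [map_smul, ha]

theorem cut_wd_zero {f g : Fn K} {x y : A K} {w : List Bool}
    (h : ∀ a b, a ++ b = w → pr f (x * wd a) * pr g (wd b * y) = 0) : cut f g x y (wd w) = 0 := by
  rw [cut_wd]
  exact Finset.sum_eq_zero fun i _ => h _ _ (List.take_append_drop _ _)

/-- The element with given coefficients. -/
noncomputable def el (W : Finset (List Bool)) (c : List Bool → K) : A K := ∑ w ∈ W, c w • wd w

theorem cut_el_zero {f g : Fn K} {x y : A K} {W : Finset (List Bool)} {c : List Bool → K}
    (h : ∀ a b, a ++ b ∈ W → pr f (x * wd a) * pr g (wd b * y) = 0) :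
    cut f g x y (el W c) = 0 := by
  rw [el, map_sum]
  refine Finset.sum_eq_zero fun w hw => ?_
  rw [map_smul, cut_wd_zero, smul_zero]
  rintro a b rfl
  exact h a b hw

theorem cut_pow_zero {f g : Fn K} {W : Finset (List Bool)} {c : List Bool → K} (N : ℕ) :
    ∀ {x y : A K},
    (∀ i j, i + j + 1 = N → ∀ a b, a ++ b ∈ W →
      pr f (x * el W c ^ i * wd a) * pr g (wd b * (el W c ^ j * y)) = 0) →
    cut f g x y (el W c ^ N) = 0 := by
  induction N with
  | zero => intro x y _; rw [pow_zero, ← wd_nil, cut_wd]; simp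
  | succ N ih =>
    intro x y h
    rw [pow_succ', cut_mul, cut_el_zero, zero_add]
    · apply ih
      intro i j hij a b hab
      have := h (i + 1) j (by omega) a b hab
      rwa [pow_succ', ← mul_assoc] at this
    · intro a b hab
      simpa using h 0 N (by omega) a b hab

theorem cut_main {k : ℕ} (hk : 0 < k) {f g : Fn K} (hf : f ∈ Hom K k) {W : Finset (List Bool)}
    {c : List Bool → K} {N : ℕ} {u v : List Bool}
    (h1 : ∀ a b, a ++ b = u → pr f (wd a) * pr g (wd b * el W c ^ N * wd v) = 0)
    (h2 : ∀ i j, i + j + 1 = N → ∀ a b, a ++ b ∈ W →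
      pr f (wd u * el W c ^ i * wd a) * pr g (wd b * el W c ^ j * wd v) = 0)
    (h3 : ∀ a b, a ++ b = v → pr f (wd u * el W c ^ N * wd a) * pr g (wd b) = 0) :
    pr (mk k f g) (wd u * el W c ^ N * wd v) = 0 := by
  rw [pr_mk hk hf, cut_mul, cut_mul, cut_wd_zero, cut_pow_zero, cut_wd_zero]
  · simp
  · intro a b hab; simpa using h3 a b hab
  · intro i j hij a b hab; simpa [mul_assoc] using h2 i j hij a b hab
  · intro a b hab; simpa [mul_assoc] using h1 a b hab

/-- Elements of order at least `a`. -/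
noncomputable def Ge (K : Type u) [Field K] (a : ℕ) : Submodule K (A K) :=
  Submodule.span K (wd '' {l | a ≤ l.length})

theorem wd_mem_Ge {a : ℕ} {l : List Bool} (h : a ≤ l.length) : wd l ∈ Ge K a :=
  Submodule.subset_span ⟨l, h, rfl⟩

theorem Ge_mul {a b : ℕ} {x y : A K} (hx : x ∈ Ge K a) (hy : y ∈ Ge K b) : x * y ∈ Ge K (a + b) := by
  have : Ge K a * Ge K b ≤ Ge K (a + b) := by
    rw [Ge, Ge, Submodule.span_mul_span, Submodule.span_le]
    rintro _ ⟨_, ⟨l, hl, rfl⟩, _, ⟨m, hm, rfl⟩, rfl⟩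
    simp only [← wd_append]
    apply wd_mem_Ge
    simp at hl hm ⊢; omega
  exact this (Submodule.mul_mem_mul hx hy)

theorem pr_Ge {k a : ℕ} (h : k < a) {f : Fn K} (hf : f ∈ Hom K k) {x : A K} (hx : x ∈ Ge K a) :
    pr f x = 0 := by
  have : Ge K a ≤ LinearMap.ker (pr f) := by
    rw [Ge, Submodule.span_le]
    rintro _ ⟨l, hl, rfl⟩
    simp only [Set.mem_ofPred_eq] at hl
    simp only [SetLike.mem_coe, LinearMap.mem_ker, pr_wd]
    exact hf l (by omega)
  exact this hx

theorem el_pow_mem_Ge {W : Finset (List Bool)} {c : List Bool → K} (hc : c [] = 0) (N : ℕ) :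
    el W c ^ N ∈ Ge K N := by
  have h1 : el W c ∈ Ge K 1 := by
    refine Submodule.sum_mem _ fun w _ => ?_
    by_cases hw : w = []
    · rw [hw, hc, zero_smul]; exact zero_mem _
    · exact Submodule.smul_mem _ _ (wd_mem_Ge (List.length_pos_of_ne_nil hw))
  induction N with
  | zero => rw [pow_zero, ← wd_nil]; exact wd_mem_Ge (by simp)
  | succ N ih => rw [pow_succ]; exact Ge_mul ih h1

theorem pr_deg {k N : ℕ} (h : k < N) {f : Fn K} (hf : f ∈ Hom K k) {W : Finset (List Bool)}
    {c : List Bool → K} (hc : c [] = 0) (u v : List Bool) :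
    pr f (wd u * el W c ^ N * wd v) = 0 := by
  refine pr_Ge (a := 0 + N + 0) (by omega) hf ?_
  exact Ge_mul (Ge_mul (wd_mem_Ge (by omega)) (el_pow_mem_Ge hc N)) (wd_mem_Ge (by omega))

section vanish

variable {T : ℕ → Submodule K (Fn K)} (hH : ∀ m, T m ≤ Hom K (2 ^ m))
    (hT : ∀ m, T (m + 1) ≤ Submodule.map₂ (mk (2 ^ m)) (T m) (T m))
    {d p : ℕ} (hdp : d < 2 ^ p) {W : Finset (List Bool)} (hW : ∀ w ∈ W, w.length ≤ d)
    {c : List Bool → K} (hc : c [] = 0)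
    (hkill : ∀ t ∈ T p, ∀ g h : List Bool, g.length ≤ d → h.length ≤ d → ∀ a ≤ 2 ^ p,
      pr t (wd g * el W c ^ a * wd h) = 0)

include hT in
theorem T_ind {m : ℕ} {z : A K} (h : ∀ f ∈ T m, ∀ g ∈ T m, pr (mk (2 ^ m) f g) z = 0) :
    ∀ t ∈ T (m + 1), pr t z = 0 := by
  intro t ht
  have : Submodule.map₂ (mk (2 ^ m)) (T m) (T m) ≤ LinearMap.ker (pr.flip z) := by
    rw [Submodule.map₂_le]
    intro f hf g hg
    exact h f hf g hg
  exact this (hT m ht)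

include hH hT hdp hW hc hkill

theorem vanP (m : ℕ) (hm : p ≤ m) : ∀ t ∈ T m, ∀ g h : List Bool, g.length ≤ d → h.length ≤ d →
    ∀ a, pr t (wd g * el W c ^ a * wd h) = 0 := by
  induction m, hm using Nat.le_induction with
  | base =>
    intro t ht g h hg hh a
    by_cases ha : a ≤ 2 ^ p
    · exact hkill t ht g h hg hh a ha
    · exact pr_deg (by omega) (hH p ht) hc _ _
  | succ m hm ih =>
    intro t ht g h hg hh a
    have hpm : 2 ^ p ≤ 2 ^ m := Nat.pow_le_pow_right (by norm_num) hm
    refine T_ind hT (fun f1 hf1 f2 hf2 => ?_) t ht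
    apply cut_main (by positivity) (hH m hf1)
    · rintro x y rfl
      simp at hg
      rw [pr_wd, hH m hf1 x (by omega), zero_mul]
    · intro i j hij x y hxy
      have := hW _ hxy
      simp at this
      rw [ih f1 hf1 g x hg (by omega), zero_mul]
    · rintro x y rfl
      simp at hh
      rw [pr_wd, hH m hf2 y (by omega), mul_zero]

theorem vanQ (m : ℕ) (hm : p ≤ m) : ∀ t ∈ T m, ∀ u h : List Bool, h.length ≤ d →
    ∀ a, 2 ^ p < a → pr t (wd u * el W c ^ a * wd h) = 0 := by
  induction m, hm using Nat.le_induction with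
  | base =>
    intro t ht u h hh a ha
    exact pr_deg (by omega) (hH p ht) hc _ _
  | succ m hm ih =>
    intro t ht u h hh a ha
    have hpm : 2 ^ p ≤ 2 ^ m := Nat.pow_le_pow_right (by norm_num) hm
    refine T_ind hT (fun f1 hf1 f2 hf2 => ?_) t ht
    apply cut_main (by positivity) (hH m hf1)
    · rintro x y rfl
      rw [ih f2 hf2 y h hh a ha, mul_zero]
    · intro i j hij x y hxy
      have := hW _ hxy
      simp at this
      rw [vanP hH hT hdp hW hc hkill m hm f2 hf2 y h (by omega) hh, mul_zero]
    · rintro x y rfl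
      simp at hh
      rw [pr_wd, hH m hf2 y (by omega), mul_zero]

theorem vanQ' (m : ℕ) (hm : p ≤ m) : ∀ t ∈ T m, ∀ g v : List Bool, g.length ≤ d →
    ∀ a, 2 ^ p < a → pr t (wd g * el W c ^ a * wd v) = 0 := by
  induction m, hm using Nat.le_induction with
  | base =>
    intro t ht g v hh a ha
    exact pr_deg (by omega) (hH p ht) hc _ _
  | succ m hm ih =>
    intro t ht g v hg a ha
    have hpm : 2 ^ p ≤ 2 ^ m := Nat.pow_le_pow_right (by norm_num) hm
    refine T_ind hT (fun f1 hf1 f2 hf2 => ?_) t ht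
    apply cut_main (by positivity) (hH m hf1)
    · rintro x y rfl
      simp at hg
      rw [pr_wd, hH m hf1 x (by omega), zero_mul]
    · intro i j hij x y hxy
      have := hW _ hxy
      simp at this
      rw [vanP hH hT hdp hW hc hkill m hm f1 hf1 g x hg (by omega), zero_mul]
    · rintro x y rfl
      rw [ih f1 hf1 g x hg a ha, zero_mul]

theorem vanR (N : ℕ) (hN : 2 * 2 ^ p + 3 ≤ N) (m : ℕ) : ∀ t ∈ T m, ∀ u v : List Bool,
    pr t (wd u * el W c ^ N * wd v) = 0 := by
  rcases lt_or_ge m p with hm | hm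
  · intro t ht u v
    have hpm : 2 ^ m ≤ 2 ^ p := Nat.pow_le_pow_right (by norm_num) hm.le
    exact pr_deg (by omega) (hH m ht) hc _ _
  induction m, hm using Nat.le_induction with
  | base =>
    intro t ht g v
    exact pr_deg (by omega) (hH p ht) hc _ _
  | succ m hm ih =>
    intro t ht u v
    refine T_ind hT (fun f1 hf1 f2 hf2 => ?_) t ht
    apply cut_main (by positivity) (hH m hf1)
    · rintro x y rfl
      rw [ih f2 hf2 y v, mul_zero]
    · intro i j hij x y hxy
      have := hW _ hxy
      simp at this
      by_cases hi : 2 ^ p < i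
      · rw [vanQ hH hT hdp hW hc hkill m hm f1 hf1 u x (by omega) i hi, zero_mul]
      · rw [vanQ' hH hT hdp hW hc hkill m hm f2 hf2 y v (by omega) j (by omega), mul_zero]
    · rintro x y rfl
      rw [ih f1 hf1 u x, zero_mul]

end vanish

/-! ### The killing family -/

theorem pow_expand {ι : Type*} [Fintype ι] [DecidableEq ι] (e : ι → A K) (N : ℕ) :
    ∃ S : (ι → Fin (N + 1)) → A K, ∀ c : ι → K,
      (∑ i, c i • e i) ^ N = ∑ ν, (∏ i, c i ^ (ν i : ℕ)) • S ν := by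
  suffices H : ∀ a, a ≤ N → ∃ (s : Finset (ι → ℕ)) (S : (ι → ℕ) → A K), (∀ ν ∈ s, ∀ i, ν i ≤ a) ∧
      ∀ c : ι → K, (∑ i, c i • e i) ^ a = ∑ ν ∈ s, (∏ i, c i ^ (ν i)) • S ν by
    obtain ⟨s, S, hs, hS⟩ := H N le_rfl
    refine ⟨fun ν => if (fun i => (ν i : ℕ)) ∈ s then S (fun i => (ν i : ℕ)) else 0, fun c => ?_⟩
    rw [hS]
    symm
    simp only [smul_ite, smul_zero]
    rw [← Finset.sum_filter]
    refine Finset.sum_bij (fun ν _ i => (ν i : ℕ)) ?_ ?_ ?_ ?_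
    · intro ν hν; simpa using hν
    · intro a _ b _ h
      funext i
      exact Fin.ext (congrFun h i)
    · intro ν hν
      exact ⟨fun i => ⟨ν i, Nat.lt_succ_of_le (hs ν hν i)⟩, by simpa using hν, rfl⟩
    · intro ν _; rfl
  intro a
  induction a with
  | zero => exact fun _ => ⟨{0}, fun _ => 1, by simp, by simp⟩
  | succ a ih =>
    intro ha
    obtain ⟨s, S, hs, hS⟩ := ih (by omega)
    let q : ι × (ι → ℕ) → (ι → ℕ) := fun x => x.2 + Pi.single x.1 1
    refine ⟨(Finset.univ ×ˢ s).image q,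
      fun ν => ∑ x ∈ (Finset.univ ×ˢ s) with q x = ν, e x.1 * S x.2, ?_, fun c => ?_⟩
    · intro ν hν i
      simp only [Finset.mem_image, Finset.mem_product, Finset.mem_univ, true_and] at hν
      obtain ⟨⟨j, μ⟩, hμ, rfl⟩ := hν
      have := hs μ hμ i
      simp only [q, Pi.add_apply, Pi.single_apply]
      split_ifs <;> omega
    · rw [pow_succ', hS, Finset.sum_mul_sum, ← Finset.sum_product',
        ← Finset.sum_fiberwise_of_maps_to (g := q) (fun x hx => Finset.mem_image_of_mem q hx)]
      refine Finset.sum_congr rfl fun ν _ => ?_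
      rw [Finset.smul_sum]
      refine Finset.sum_congr rfl fun x hx => ?_
      rw [Finset.mem_filter] at hx
      rw [smul_mul_smul_comm, ← hx.2]
      congr 1
      simp only [q, Pi.add_apply, pow_add, Finset.prod_mul_distrib]
      rw [mul_comm]
      congr 1
      rw [Finset.prod_eq_single x.1]
      · simp
      · intro b _ hb; simp [hb]
      · simp

/-- Words of length at most `d`. -/
noncomputable def Wd (d : ℕ) : Finset (List Bool) := (List.finite_length_le Bool d).toFinset

theorem mem_Wd {d : ℕ} {l : List Bool} : l ∈ Wd d ↔ l.length ≤ d := by simp [Wd]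

theorem kill_family (K : Type u) [Field K] (d p : ℕ) : ∃ F : Finset (A K),
    F.card ≤ (Wd d).card ^ 2 * (2 ^ p + 1) ^ ((Wd d).card + 1) ∧
    ∀ t : Fn K, (∀ r ∈ F, pr t r = 0) → ∀ (c : List Bool → K) (g h : List Bool), g.length ≤ d →
      h.length ≤ d → ∀ a ≤ 2 ^ p, pr t (wd g * el (Wd d) c ^ a * wd h) = 0 := by
  classical
  choose S hS using fun a => pow_expand (fun w : Wd d => (wd w : A K)) a
  let I := Wd d × Wd d × Fin (2 ^ p + 1) × (Wd d → Fin (2 ^ p + 1))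
  let S' : ∀ a : ℕ, (Wd d → Fin (2 ^ p + 1)) → A K := fun a ν =>
    if h : ∀ i, (ν i : ℕ) < a + 1 then S a (fun i => ⟨ν i, h i⟩) else 0
  let r : I → A K := fun x => wd x.1 * S' x.2.2.1 x.2.2.2 * wd x.2.1
  refine ⟨Finset.univ.image r, ?_, ?_⟩
  · refine Finset.card_image_le.trans (le_of_eq ?_)
    simp only [I, Finset.card_univ, Fintype.card_prod, Fintype.card_pi, Fintype.card_fin,
      Fintype.card_coe, Finset.prod_const]
    ring
  · intro t ht c g h hg hh a ha
    have h1 : el (Wd d) c = ∑ i : Wd d, c i • (wd i : A K) := by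
      rw [el, ← Finset.sum_coe_sort]
    rw [h1, hS a, Finset.mul_sum, Finset.sum_mul, map_sum]
    refine Finset.sum_eq_zero fun ν _ => ?_
    rw [mul_smul_comm, smul_mul_assoc, map_smul]
    have h2 := ht (r (⟨g, mem_Wd.2 hg⟩, ⟨h, mem_Wd.2 hh⟩, ⟨a, by omega⟩,
      fun i => ⟨ν i, by have := (ν i).2; omega⟩)) (Finset.mem_image_of_mem _ (Finset.mem_univ _))
    have h3 : ∀ i, (ν i : ℕ) < a + 1 := fun i => (ν i).2
    simp only [r, S', h3] at h2
    simp at h2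
    rw [h2, smul_zero]

/-! ### Dimension bounds -/

theorem finrank_map₂_le {V : Type*} [AddCommGroup V] [Module K V] (f : V →ₗ[K] V →ₗ[K] V)
    (p q : Submodule K V) [FiniteDimensional K p] [FiniteDimensional K q] :
    FiniteDimensional K (Submodule.map₂ f p q) ∧
      finrank K (Submodule.map₂ f p q) ≤ finrank K p * finrank K q := by
  let b := finBasis K p
  let c := finBasis K q
  have hb : Submodule.span K (Set.range fun i => (b i : V)) = p := by
    have := congrArg (Submodule.map p.subtype) b.span_eq
    rw [Submodule.map_span, ← Set.range_comp] at this
    simpa [Function.comp_def] using this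
  have hc : Submodule.span K (Set.range fun i => (c i : V)) = q := by
    have := congrArg (Submodule.map q.subtype) c.span_eq
    rw [Submodule.map_span, ← Set.range_comp] at this
    simpa [Function.comp_def] using this
  let y : Fin (finrank K p) × Fin (finrank K q) → V := fun x => f (b x.1) (c x.2)
  have key : Submodule.map₂ f p q = Submodule.span K (Set.range y) := by
    conv_lhs => rw [← hb, ← hc]
    rw [Submodule.map₂_span_span]
    congr 1
    ext z
    simp [y, Set.mem_image2]
  rw [key]
  refine ⟨FiniteDimensional.span_of_finite K (Set.finite_range y), ?_⟩
  refine (finrank_range_le_card (R := K) y).trans ?_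
  simp

/-- Contraction. -/
def con (u v : List Bool) : Fn K →ₗ[K] Fn K := LinearMap.funLeft K K (fun w => u ++ w ++ v)

theorem con_apply (u v w : List Bool) (f : Fn K) : con u v f w = f (u ++ w ++ v) := rfl

theorem con_nil (f : Fn K) : con [] [] f = f := by ext w; simp [con_apply]

theorem con_mem_Hom {k : ℕ} {u v : List Bool} {f : Fn K} (hf : f ∈ Hom K k) {n : ℕ}
    (h : u.length + n + v.length = k) : con u v f ∈ Hom K n := by
  intro l hl
  rw [con_apply]
  apply hf
  simp; omega

theorem con1 {k : ℕ} {u v : List Bool} {f g : Fn K} (h : k ≤ u.length) :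
    con u v (mk k f g) = f (u.take k) • con (u.drop k) v g := by
  ext w
  simp only [con_apply, mk_apply, Pi.smul_apply, smul_eq_mul, List.append_assoc]
  rw [List.take_append_of_le_length h, List.drop_append_of_le_length h]

theorem con2 {k l : ℕ} {u v : List Bool} {f g : Fn K} (hf : f ∈ Hom K k) (hg : g ∈ Hom K l)
    (h : l ≤ v.length) :
    con u v (mk k f g) = g (v.drop (v.length - l)) • con u (v.take (v.length - l)) f := by
  ext w
  by_cases hw : u.length + w.length + v.length = k + l
  · obtain ⟨a, b, rfl, hb⟩ : ∃ a b, v = a ++ b ∧ b.length = l :=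
      ⟨v.take (v.length - l), v.drop (v.length - l), by simp, by simp; omega⟩
    simp at hw
    have hk : k = (u ++ w ++ a).length := by simp; omega
    have h2 : (a ++ b).length - l = a.length := by simp; omega
    simp only [con_apply, mk_apply, Pi.smul_apply, smul_eq_mul, h2]
    rw [← List.append_assoc, hk, List.take_left, List.drop_left, List.drop_left, List.take_left,
      mul_comm]
  · rw [con_apply, mk_mem_Hom hf hg _ (by simp; omega)]
    simp only [con_apply, Pi.smul_apply, smul_eq_mul]
    rw [hf, mul_zero]
    simp; omega

theorem con3 {k l i j : ℕ} {u v : List Bool} {f g : Fn K} (hf : f ∈ Hom K k) (hg : g ∈ Hom K l)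
    (hu : u.length + i = k) (hv : v.length + j = l) :
    con u v (mk k f g) = mk i (con u [] f) (con [] v g) := by
  ext w
  by_cases hw : w.length = i + j
  · obtain ⟨a, b, rfl, ha, hb⟩ : ∃ a b, w = a ++ b ∧ a.length = i ∧ b.length = j :=
      ⟨w.take i, w.drop i, by simp, by simp; omega, by simp; omega⟩
    have hk : k = (u ++ a).length := by simp; omega
    have h1 : u ++ (a ++ b) ++ v = (u ++ a) ++ (b ++ v) := by simp
    simp only [con_apply, mk_apply]
    rw [h1, hk, ← ha, List.take_left, List.drop_left, List.drop_left, List.take_left]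
    simp
  · rw [mk_mem_Hom (k := i) (j := j) (con_mem_Hom hf (by simp; omega))
      (con_mem_Hom hg (by simp; omega)) w hw, con_apply, mk_mem_Hom hf hg]
    simp; omega

/-- Indicator of the empty word. -/
def dl : Fn K := fun l => if l = [] then 1 else 0

theorem mk_dl_left (f : Fn K) : mk 0 dl f = f := by
  ext l; simp [mk_apply, dl]

theorem mk_dl_right {n : ℕ} {f : Fn K} (hf : f ∈ Hom K n) : mk n f dl = f := by
  ext l
  rw [mk_apply]
  by_cases h : l.length = n
  · subst h; simp [dl]
  · rw [hf l h]
    by_cases h2 : l.length < n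
    · rw [hf _ (by simp; omega), zero_mul]
    · have : l.drop n ≠ [] := by intro h3; simp at h3; omega
      simp [dl, this]

theorem mem_Hom_zero {f : Fn K} (hf : f ∈ Hom K 0) : f ∈ Submodule.span K {(dl : Fn K)} := by
  rw [Submodule.mem_span_singleton]
  refine ⟨f [], ?_⟩
  ext l
  by_cases h : l = []
  · subst h; simp [dl]
  · simp [dl, h]; rw [hf]; simpa using h

section dims

variable {T : ℕ → Submodule K (Fn K)} (hH : ∀ m, T m ≤ Hom K (2 ^ m))
    (hT : ∀ m, T (m + 1) ≤ Submodule.map₂ (mk (2 ^ m)) (T m) (T m))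
    (hfd : ∀ m, FiniteDimensional K (T m)) (hpos : ∀ m, 1 ≤ finrank K (T m))

include hT in
theorem T_ind2 {m : ℕ} {P : Submodule K (Fn K)} (ψ : Fn K →ₗ[K] Fn K)
    (h : ∀ f ∈ T m, ∀ g ∈ T m, ψ (mk (2 ^ m) f g) ∈ P) :
    ∀ t ∈ T (m + 1), ψ t ∈ P := by
  intro t ht
  have : Submodule.map₂ (mk (2 ^ m)) (T m) (T m) ≤ P.comap ψ := by
    rw [Submodule.map₂_le]
    intro f hf g hg
    exact h f hf g hg
  exact this (hT m ht)

include hH hT hfd hpos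

theorem suff (i : ℕ) : ∃ G : Submodule K (Fn K), FiniteDimensional K G ∧
    (∀ s, i < 2 ^ s → finrank K G ≤ ∏ a ∈ Finset.range s, finrank K (T a)) ∧
    (i = 0 → dl ∈ G) ∧
    ∀ k, ∀ t ∈ T k, ∀ u : List Bool, u.length + i = 2 ^ k → con u [] t ∈ G := by
  induction i using Nat.strong_induction_on with
  | _ i IH =>
  rcases Nat.eq_zero_or_pos i with rfl | hi
  · refine ⟨Submodule.span K {dl}, FiniteDimensional.span_singleton K _, ?_,
      fun _ => Submodule.mem_span_singleton_self _, ?_⟩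
    · intro s _
      refine (finrank_span_le_card (R := K) ({dl} : Set (Fn K))).trans ?_
      simp only [Set.toFinset_singleton, Finset.card_singleton]
      exact Nat.succ_le_of_lt (Finset.prod_pos fun a _ => Nat.lt_of_succ_le (hpos a))
    · intro k t ht u hu
      exact mem_Hom_zero (con_mem_Hom (hH k ht) (by simpa using hu))
  · set a := Nat.log 2 i with ha
    have h1 : 2 ^ a ≤ i := Nat.pow_log_le_self 2 hi.ne'
    have h2 : i < 2 ^ (a + 1) := Nat.lt_pow_succ_log_self (by norm_num) i
    have h3 : 0 < 2 ^ a := by positivity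
    rw [pow_succ] at h2
    obtain ⟨G, g1, g2, g3, g4⟩ := IH (i - 2 ^ a) (by omega)
    have := hfd a
    obtain ⟨e1, e2⟩ := finrank_map₂_le (mk (i - 2 ^ a)) G (T a)
    refine ⟨Submodule.map₂ (mk (i - 2 ^ a)) G (T a), e1, ?_, by omega, ?_⟩
    · intro s hs
      refine e2.trans ?_
      have h4 : a + 1 ≤ s := by
        by_contra hcon
        have : 2 ^ s ≤ 2 ^ a := Nat.pow_le_pow_right (by norm_num) (by omega)
        omega
      calc _ ≤ (∏ a ∈ Finset.range a, finrank K (T a)) * finrank K (T a) :=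
            Nat.mul_le_mul_right _ (g2 a (by omega))
        _ = ∏ a ∈ Finset.range (a + 1), finrank K (T a) := by rw [Finset.prod_range_succ]
        _ ≤ _ := Finset.prod_le_prod_of_subset_of_one_le'
            (Finset.range_mono h4) (fun i _ _ => hpos i)
    · intro k
      have base : ∀ t ∈ T a, i = 2 ^ a → t ∈ Submodule.map₂ (mk (i - 2 ^ a)) G (T a) := by
        intro t ht hia
        have hd := g3 (by omega)
        have h0 : i - 2 ^ a = 0 := by omega
        rw [h0]
        have := Submodule.apply_mem_map₂ (mk 0) hd ht
        rwa [mk_dl_left] at this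
      induction k with
      | zero =>
        intro t ht u hu
        have hu0 : u.length = 0 := by simp at hu; omega
        have hi1 : i = 1 := by simp at hu; omega
        have ha0 : a = 0 := by rw [ha, hi1]; simp
        rw [List.length_eq_zero_iff] at hu0
        rw [hu0, con_nil]
        apply base
        · rwa [ha0]
        · rw [ha0, hi1]; simp
      | succ k ih =>
        intro t ht u hu
        by_cases huz : u = [] ∧ a = k + 1
        · obtain ⟨rfl, hak⟩ := huz
          rw [con_nil]
          apply base
          · rwa [hak]
          · rw [hak]; simpa using hu
        revert t
        apply T_ind2 hT
        intro f hf g hg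
        rw [pow_succ] at hu
        rcases le_or_gt (2 ^ k) u.length with hk | hk
        · rw [con1 hk]
          refine Submodule.smul_mem _ _ (ih g hg _ ?_)
          simp; omega
        · have hak : a = k := by
            apply le_antisymm
            · by_contra hcon
              have h5 : 2 ^ (k + 1) ≤ 2 ^ a := Nat.pow_le_pow_right (by norm_num) (by omega)
              rw [pow_succ] at h5
              have h6 : u.length = 0 := by omega
              rw [List.length_eq_zero_iff] at h6
              refine huz ⟨h6, ?_⟩
              by_contra h7
              have h5 : 2 ^ (k + 2) ≤ 2 ^ a := Nat.pow_le_pow_right (by norm_num) (by omega)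
              rw [pow_succ, pow_succ] at h5
              omega
            · by_contra hcon
              have h5 : 2 ^ (a + 1) ≤ 2 ^ k := Nat.pow_le_pow_right (by norm_num) (by omega)
              rw [pow_succ] at h5
              omega
          rw [hak] at h1 h2 h3 g4 ⊢
          rw [con3 (hH k hf) (hH k hg) (i := i - 2 ^ k) (j := 2 ^ k) (by omega) (by simp), con_nil]
          exact Submodule.apply_mem_map₂ _ (g4 k f hf u (by omega)) hg

theorem pref (i : ℕ) : ∃ G : Submodule K (Fn K), FiniteDimensional K G ∧
    (∀ s, i < 2 ^ s → finrank K G ≤ ∏ a ∈ Finset.range s, finrank K (T a)) ∧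
    (i = 0 → dl ∈ G) ∧
    ∀ k, ∀ t ∈ T k, ∀ u : List Bool, u.length + i = 2 ^ k → con [] u t ∈ G := by
  induction i using Nat.strong_induction_on with
  | _ i IH =>
  rcases Nat.eq_zero_or_pos i with rfl | hi
  · refine ⟨Submodule.span K {dl}, FiniteDimensional.span_singleton K _, ?_,
      fun _ => Submodule.mem_span_singleton_self _, ?_⟩
    · intro s _
      refine (finrank_span_le_card (R := K) ({dl} : Set (Fn K))).trans ?_
      simp only [Set.toFinset_singleton, Finset.card_singleton]
      exact Nat.succ_le_of_lt (Finset.prod_pos fun a _ => Nat.lt_of_succ_le (hpos a))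
    · intro k t ht u hu
      exact mem_Hom_zero (con_mem_Hom (hH k ht) (by simpa using hu))
  · set a := Nat.log 2 i with ha
    have h1 : 2 ^ a ≤ i := Nat.pow_log_le_self 2 hi.ne'
    have h2 : i < 2 ^ (a + 1) := Nat.lt_pow_succ_log_self (by norm_num) i
    have h3 : 0 < 2 ^ a := by positivity
    rw [pow_succ] at h2
    obtain ⟨G, g1, g2, g3, g4⟩ := IH (i - 2 ^ a) (by omega)
    have := hfd a
    obtain ⟨e1, e2⟩ := finrank_map₂_le (mk (2 ^ a)) (T a) G
    refine ⟨Submodule.map₂ (mk (2 ^ a)) (T a) G, e1, ?_, by omega, ?_⟩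
    · intro s hs
      refine e2.trans ?_
      have h4 : a + 1 ≤ s := by
        by_contra hcon
        have : 2 ^ s ≤ 2 ^ a := Nat.pow_le_pow_right (by norm_num) (by omega)
        omega
      calc _ ≤ finrank K (T a) * (∏ a ∈ Finset.range a, finrank K (T a)) :=
            Nat.mul_le_mul_left _ (g2 a (by omega))
        _ = ∏ a ∈ Finset.range (a + 1), finrank K (T a) := by
            rw [Finset.prod_range_succ, mul_comm]
        _ ≤ _ := Finset.prod_le_prod_of_subset_of_one_le'
            (Finset.range_mono h4) (fun i _ _ => hpos i)
    · intro k
      have base : ∀ t ∈ T a, i = 2 ^ a → t ∈ Submodule.map₂ (mk (2 ^ a)) (T a) G := by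
        intro t ht hia
        have hd := g3 (by omega)
        have := Submodule.apply_mem_map₂ (mk (2 ^ a)) ht hd
        rwa [mk_dl_right (hH a ht)] at this
      induction k with
      | zero =>
        intro t ht u hu
        have hu0 : u.length = 0 := by simp at hu; omega
        have hi1 : i = 1 := by simp at hu; omega
        have ha0 : a = 0 := by rw [ha, hi1]; simp
        rw [List.length_eq_zero_iff] at hu0
        rw [hu0, con_nil]
        apply base
        · rwa [ha0]
        · rw [ha0, hi1]; simp
      | succ k ih =>
        intro t ht u hu
        by_cases huz : u = [] ∧ a = k + 1
        · obtain ⟨rfl, hak⟩ := huz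
          rw [con_nil]
          apply base
          · rwa [hak]
          · rw [hak]; simpa using hu
        revert t
        apply T_ind2 hT
        intro f hf g hg
        rw [pow_succ] at hu
        rcases le_or_gt (2 ^ k) u.length with hk | hk
        · rw [con2 (hH k hf) (hH k hg) hk]
          refine Submodule.smul_mem _ _ (ih f hf _ ?_)
          simp; omega
        · have hak : a = k := by
            apply le_antisymm
            · by_contra hcon
              have h5 : 2 ^ (k + 1) ≤ 2 ^ a := Nat.pow_le_pow_right (by norm_num) (by omega)
              rw [pow_succ] at h5
              have h6 : u.length = 0 := by omega
              rw [List.length_eq_zero_iff] at h6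
              refine huz ⟨h6, ?_⟩
              by_contra h7
              have h5 : 2 ^ (k + 2) ≤ 2 ^ a := Nat.pow_le_pow_right (by norm_num) (by omega)
              rw [pow_succ, pow_succ] at h5
              omega
            · by_contra hcon
              have h5 : 2 ^ (a + 1) ≤ 2 ^ k := Nat.pow_le_pow_right (by norm_num) (by omega)
              rw [pow_succ] at h5
              omega
          rw [hak] at h1 h2 h3 g4 ⊢
          rw [con3 (hH k hf) (hH k hg) (i := 2 ^ k) (j := i - 2 ^ k) (by simp) (by omega), con_nil]
          exact Submodule.apply_mem_map₂ _ hf (g4 k g hg u (by omega))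

theorem mid (n s : ℕ) (hn : 1 ≤ n) (hs : n < 2 ^ s) : ∃ H : Submodule K (Fn K),
    FiniteDimensional K H ∧
    finrank K H ≤ (n + 1) * (∏ a ∈ Finset.range s, finrank K (T a)) ^ 2 ∧
    ∀ k, ∀ t ∈ T k, ∀ u v : List Bool, u.length + n + v.length = 2 ^ k → con u v t ∈ H := by
  choose G a1 a2 a3 a4 using suff hH hT hfd hpos
  choose G' b1 b2 b3 b4 using pref hH hT hfd hpos
  have hM := fun i => finrank_map₂_le (mk i) (G i) (G' (n - i))
  have hle : ∀ i ≤ n, finrank K (Submodule.map₂ (mk i) (G i) (G' (n - i))) ≤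
      (∏ a ∈ Finset.range s, finrank K (T a)) ^ 2 := by
    intro i hi
    refine (hM i).2.trans ?_
    rw [sq]
    exact Nat.mul_le_mul (a2 i s (by omega)) (b2 (n - i) s (by omega))
  have hsum : ∀ N ≤ n + 1, ∃ H : Submodule K (Fn K), FiniteDimensional K H ∧
      finrank K H ≤ N * (∏ a ∈ Finset.range s, finrank K (T a)) ^ 2 ∧
      ∀ i < N, Submodule.map₂ (mk i) (G i) (G' (n - i)) ≤ H := by
    intro N
    induction N with
    | zero => exact fun _ => ⟨⊥, inferInstance, by simp, by simp⟩
    | succ N ih =>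
      intro hN
      obtain ⟨H, c1, c2, c3⟩ := ih (by omega)
      have := (hM N).1
      refine ⟨H ⊔ Submodule.map₂ (mk N) (G N) (G' (n - N)), inferInstance, ?_, ?_⟩
      · refine (Submodule.finrank_add_le_finrank_add_finrank _ _).trans ?_
        rw [Nat.succ_mul]
        exact Nat.add_le_add c2 (hle N (by omega))
      · intro i hi
        rcases Nat.lt_succ_iff_lt_or_eq.1 hi with h | rfl
        · exact (c3 i h).trans le_sup_left
        · exact le_sup_right
  obtain ⟨H, c1, c2, c3⟩ := hsum (n + 1) le_rfl
  refine ⟨H, c1, c2, ?_⟩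
  intro k
  have base : ∀ k, ∀ t ∈ T k, n = 2 ^ k → con [] [] t ∈ H := by
    intro k t ht hnk
    apply c3 n (by omega)
    have h1 := a4 n k t ht [] (by simpa using hnk)
    have h2 := b3 (n - n) (by omega)
    have := Submodule.apply_mem_map₂ (mk n) h1 h2
    rw [con_nil] at this ⊢
    rwa [mk_dl_right (hnk ▸ hH k ht)] at this
  induction k with
  | zero =>
    intro t ht u v h
    simp at h
    have hu : u = [] := by rw [← List.length_eq_zero_iff]; omega
    have hv : v = [] := by rw [← List.length_eq_zero_iff]; omega
    rw [hu, hv]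
    exact base 0 t ht (by simp; omega)
  | succ k ih =>
    intro t ht u v h
    revert t
    apply T_ind2 hT
    intro f hf g hg
    rw [pow_succ] at h
    rcases le_or_gt (2 ^ k) u.length with hk | hk
    · rw [con1 hk]
      refine Submodule.smul_mem _ _ (ih g hg _ _ ?_)
      simp; omega
    rcases le_or_gt (2 ^ k) v.length with hk' | hk'
    · rw [con2 (hH k hf) (hH k hg) hk']
      refine Submodule.smul_mem _ _ (ih f hf _ _ ?_)
      simp; omega
    rw [con3 (hH k hf) (hH k hg) (i := 2 ^ k - u.length) (j := n - (2 ^ k - u.length))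
      (by omega) (by omega)]
    refine c3 (2 ^ k - u.length) (by omega) (Submodule.apply_mem_map₂ _ ?_ ?_)
    · exact a4 _ k f hf u (by omega)
    · exact b4 _ k g hg v (by omega)

end dims

/-! ### The quotient algebra -/

/-- The ideal of elements annihilated by all translates of the tower. -/
noncomputable def idl (T : ℕ → Submodule K (Fn K)) : Ideal (A K) where
  carrier := {r | ∀ m, ∀ t ∈ T m, ∀ u v, pr t (wd u * r * wd v) = 0}
  add_mem' := by
    intro a b ha hb m t ht u v
    rw [mul_add, add_mul, map_add, ha m t ht, hb m t ht, add_zero]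
  zero_mem' := by intro m t _ u v; simp
  smul_mem' := by
    intro x r hr m t ht u v
    rw [smul_eq_mul]
    induction x using wind with
    | h l => rw [← mul_assoc, ← wd_append]; exact hr m t ht _ _
    | h0 => simp
    | ha a b ha hb => rw [add_mul, mul_add, add_mul, map_add, ha, hb, add_zero]
    | hs c a ha => rw [smul_mul_assoc, mul_smul_comm, smul_mul_assoc, map_smul, ha, smul_zero]

theorem mem_idl {T : ℕ → Submodule K (Fn K)} {r : A K} :
    r ∈ idl T ↔ ∀ m, ∀ t ∈ T m, ∀ u v, pr t (wd u * r * wd v) = 0 := Iff.rfl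

instance idl_two (T : ℕ → Submodule K (Fn K)) : (idl T).IsTwoSided where
  mul_mem_of_left := by
    intro r x hr m t ht u v
    induction x using wind with
    | h l => rw [← mul_assoc, mul_assoc _ (wd l), ← wd_append]; exact hr m t ht _ _
    | h0 => simp
    | ha a b ha hb => rw [mul_add, mul_add, add_mul, map_add, ha, hb, add_zero]
    | hs c a ha => rw [mul_smul_comm, mul_smul_comm, smul_mul_assoc, map_smul, ha, smul_zero]

/-- Homogeneous elements of degree `n`. -/
noncomputable def gr (K : Type u) [Field K] (n : ℕ) : Submodule K (A K) :=
  Submodule.span K (wd '' {l | l.length = n})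

theorem wd_mem_gr (l : List Bool) : (wd l : A K) ∈ gr K l.length :=
  Submodule.subset_span ⟨l, rfl, rfl⟩

/-- Projection onto the degree `n` component. -/
noncomputable def proj (n : ℕ) : A K →ₗ[K] A K :=
  wb.constr K fun l => if l.length = n then wd l else 0

theorem proj_wd (n : ℕ) (l : List Bool) :
    (proj n (wd l) : A K) = if l.length = n then wd l else 0 := by
  conv_lhs => rw [← wb_apply]
  exact wb.constr_basis K _ l

theorem proj_self {n : ℕ} {x : A K} (hx : x ∈ gr K n) : proj n x = x := by
  have : gr K n ≤ LinearMap.eqLocus (proj n) LinearMap.id := by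
    rw [gr, Submodule.span_le]
    rintro _ ⟨l, hl, rfl⟩
    simp only [Set.mem_ofPred_eq] at hl
    simp [proj_wd, hl]
  exact this hx

theorem proj_ne {n j : ℕ} (h : j ≠ n) {x : A K} (hx : x ∈ gr K j) : proj n x = 0 := by
  have : gr K j ≤ LinearMap.ker (proj n) := by
    rw [gr, Submodule.span_le]
    rintro _ ⟨l, hl, rfl⟩
    simp only [Set.mem_ofPred_eq] at hl
    simp [proj_wd, hl, h]
  exact this hx

theorem pr_proj {k n : ℕ} {t : Fn K} (ht : t ∈ Hom K k) (u v : List Bool) (x : A K) :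
    pr t (wd u * proj n x * wd v) =
      if u.length + n + v.length = k then pr t (wd u * x * wd v) else 0 := by
  induction x using wind with
  | h l =>
    rw [proj_wd]
    by_cases hl : l.length = n
    · rw [if_pos hl]
      split_ifs with h
      · rfl
      · rw [← wd_append, ← wd_append, pr_wd]
        apply ht; simp; omega
    · rw [if_neg hl]
      split_ifs with h
      · rw [← wd_append, ← wd_append, pr_wd, ht]
        · simp
        · simp; omega
      · simp
  | h0 => simp
  | ha a b ha hb =>
    simp only [map_add, mul_add, add_mul, ha, hb]
    split_ifs <;> simp
  | hs c a ha =>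
    simp only [map_smul, mul_smul_comm, smul_mul_assoc, ha]
    split_ifs <;> simp

theorem pr_con (t : Fn K) (u v : List Bool) (x : A K) :
    pr t (wd u * x * wd v) = pr (con u v t) x := by
  induction x using wind with
  | h l => rw [← wd_append, ← wd_append, pr_wd, pr_wd, con_apply]
  | h0 => simp
  | ha a b ha hb => simp only [map_add, mul_add, add_mul, ha, hb]
  | hs c a ha => simp only [map_smul, mul_smul_comm, smul_mul_assoc, ha]

theorem gr_mul {a b : ℕ} {x y : A K} (hx : x ∈ gr K a) (hy : y ∈ gr K b) :
    x * y ∈ gr K (a + b) := by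
  have : gr K a * gr K b ≤ gr K (a + b) := by
    rw [gr, gr, Submodule.span_mul_span, Submodule.span_le]
    rintro _ ⟨_, ⟨l, hl, rfl⟩, _, ⟨m, hm, rfl⟩, rfl⟩
    simp only [Set.mem_ofPred_eq] at hl hm
    simp only [← wd_append, ← hl, ← hm]
    have := wd_mem_gr (K := K) (l ++ m)
    rwa [List.length_append] at this
  exact this (Submodule.mul_mem_mul hx hy)

theorem gr_zero : gr K 0 = 1 := by
  rw [gr, Submodule.one_eq_span]
  congr 1
  ext x
  simp [wd_nil, eq_comm]

theorem gr_sup : ⨆ n, gr K n = ⊤ := by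
  rw [eq_top_iff, ← wspan, Submodule.span_le]
  rintro _ ⟨l, rfl⟩
  exact Submodule.mem_iSup_of_mem l.length (wd_mem_gr l)

theorem exists_el {x : A K} (hx : x ∈ ⨆ n ≥ 1, gr K n) :
    ∃ d c, c [] = 0 ∧ x = el (Wd d) c := by
  have h1 : x ∈ Submodule.span K (wd '' {l : List Bool | l ≠ []}) := by
    revert x
    change (⨆ n ≥ 1, gr K n) ≤ _
    refine iSup₂_le fun n hn => ?_
    refine Submodule.span_mono (Set.image_mono ?_)
    rintro l hl rfl
    simp only [Set.mem_ofPred_eq] at hl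
    simp at hl; omega
  rw [Finsupp.mem_span_image_iff_linearCombination] at h1
  obtain ⟨c, hc, rfl⟩ := h1
  rw [Finsupp.mem_supported] at hc
  refine ⟨c.support.sup List.length, c, ?_, ?_⟩
  · by_contra h
    exact hc (Finsupp.mem_support_iff.2 h) rfl
  · rw [Finsupp.linearCombination_apply, el, Finsupp.sum]
    refine Finset.sum_subset ?_ ?_
    · intro l hl
      rw [mem_Wd]
      exact Finset.le_sup hl
    · intro l _ hl
      rw [Finsupp.notMem_support_iff.1 hl, zero_smul]

theorem alg (T : ℕ → Submodule K (Fn K)) (hH : ∀ m, T m ≤ Hom K (2 ^ m)) (hne : ∀ m, T m ≠ ⊥)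
    (hnil : ∀ d (c : List Bool → K), c [] = 0 → ∃ N, ∀ m, ∀ t ∈ T m, ∀ u v,
      pr t (wd u * el (Wd d) c ^ N * wd v) = 0)
    (D : ℕ → ℕ) (hdim : ∀ n, 1 ≤ n → ∃ H : Submodule K (Fn K), FiniteDimensional K H ∧
      finrank K H ≤ D n ∧
      ∀ k, ∀ t ∈ T k, ∀ u v : List Bool, u.length + n + v.length = 2 ^ k → con u v t ∈ H) :
    ∃ (B : Type u) (_ : Ring B) (_ : Algebra K B) (𝒜 : ℕ → Submodule K B)
      (_ : GradedAlgebra 𝒜),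
      Algebra.FiniteType K B ∧
      𝒜 0 = (1 : Submodule K B) ∧
      ¬ Module.Finite K B ∧
      (∀ x ∈ (⨆ n ≥ 1, 𝒜 n : Submodule K B), IsNilpotent x) ∧
      (∀ n, 1 ≤ n → FiniteDimensional K (𝒜 n) ∧ finrank K (𝒜 n) ≤ D n) := by
  let π : A K →ₐ[K] (A K ⧸ idl T) := Ideal.Quotient.mkₐ K (idl T)
  have hπ : Function.Surjective π := Ideal.Quotient.mkₐ_surjective K (idl T)
  have hπ0 : ∀ x, π x = 0 ↔ x ∈ idl T := fun x => Ideal.Quotient.eq_zero_iff_mem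
  let 𝒜 : ℕ → Submodule K (A K ⧸ idl T) := fun n => (gr K n).map π.toLinearMap
  have hproj : ∀ n x, x ∈ idl T → proj n x ∈ idl T := by
    intro n x hx m t ht u v
    rw [pr_proj (hH m ht), hx m t ht]
    simp
  have hzero : ∀ n x, x ∈ gr K n → ∀ z, z ∈ (⨆ j, ⨆ (_ : j ≠ n), gr K j) → π x = π z →
      π x = 0 := by
    intro n x hx z hz hxz
    rw [hπ0]
    have h1 : x - z ∈ idl T := by rw [← hπ0, map_sub, hxz, sub_self]
    have h2 := hproj n _ h1
    have h3 : proj n z = 0 := by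
      have : (⨆ j, ⨆ (_ : j ≠ n), gr K j) ≤ LinearMap.ker (proj n) :=
        iSup₂_le fun j hj x hx => proj_ne hj hx
      exact this hz
    rwa [map_sub, h3, sub_zero, proj_self hx] at h2
  have hind : iSupIndep 𝒜 := by
    intro n
    rw [Submodule.disjoint_def]
    intro y hy hy'
    have h1 : (⨆ j, ⨆ (_ : j ≠ n), 𝒜 j) = (⨆ j, ⨆ (_ : j ≠ n), gr K j).map π.toLinearMap := by
      simp only [Submodule.map_iSup, 𝒜]
    rw [h1] at hy'
    obtain ⟨x, hx, rfl⟩ := hy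
    obtain ⟨z, hz, hzx⟩ := hy'
    exact hzero n x hx z hz hzx.symm
  have htop : ⨆ n, 𝒜 n = ⊤ := by
    simp only [𝒜]
    rw [← Submodule.map_iSup, gr_sup, Submodule.map_top, LinearMap.range_eq_top]
    exact hπ
  have hinternal : DirectSum.IsInternal 𝒜 :=
    DirectSum.isInternal_submodule_of_iSupIndep_of_iSup_eq_top hind htop
  have h0 : 𝒜 0 = 1 := by
    simp only [𝒜]
    rw [gr_zero, Submodule.map_one]
  have hgm : SetLike.GradedMonoid 𝒜 :=
    { one_mem := by rw [h0]; exact Submodule.one_le.1 le_rfl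
      mul_mem := by
        rintro i j _ _ ⟨x, hx, rfl⟩ ⟨y, hy, rfl⟩
        exact ⟨x * y, gr_mul hx hy, map_mul π x y⟩ }
  letI hdec : DirectSum.Decomposition 𝒜 := hinternal.chooseDecomposition 𝒜
  refine ⟨A K ⧸ idl T, inferInstance, inferInstance, 𝒜, { hgm, hdec with }, ?_, h0, ?_, ?_, ?_⟩
  · exact Algebra.FiniteType.of_surjective π hπ
  · intro hfin
    have h1 : {n | 𝒜 n ≠ ⊥}.Finite := WellFoundedGT.finite_ne_bot_of_iSupIndep hind
    have h2 : Set.range (fun m : ℕ => 2 ^ m) ⊆ {n | 𝒜 n ≠ ⊥} := by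
      rintro _ ⟨m, rfl⟩ hbot
      obtain ⟨t, ht, ht0⟩ := Submodule.exists_mem_ne_zero_of_ne_bot (hne m)
      obtain ⟨l, hl⟩ := Function.ne_iff.1 ht0
      have hlen : l.length = 2 ^ m := by
        by_contra h
        exact hl (hH m ht l h)
      have h3 : π (wd l) ∈ 𝒜 (2 ^ m) := ⟨wd l, hlen ▸ wd_mem_gr l, rfl⟩
      simp only at hbot
      rw [hbot, Submodule.mem_bot, hπ0] at h3
      have := h3 m t ht [] []
      simp [wd_nil] at this
      exact hl this
    exact Set.infinite_range_of_injective (Nat.pow_right_injective le_rfl) (h1.subset h2)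
  · intro x hx
    have h1 : (⨆ n ≥ 1, 𝒜 n) = (⨆ n ≥ 1, gr K n).map π.toLinearMap := by
      simp only [Submodule.map_iSup, 𝒜]
    rw [h1] at hx
    obtain ⟨f, hf, rfl⟩ := hx
    obtain ⟨d, c, hc, rfl⟩ := exists_el hf
    obtain ⟨N, hN⟩ := hnil d c hc
    refine ⟨N, ?_⟩
    have : π (el (Wd d) c ^ N) = 0 := (hπ0 _).2 hN
    rw [map_pow] at this
    exact this
  · intro n hn
    obtain ⟨H, e1, e2, e3⟩ := hdim n hn
    have hfg : FiniteDimensional K (gr K n) := by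
      refine FiniteDimensional.span_of_finite K (Set.Finite.image _ ?_)
      exact List.finite_length_eq Bool n
    have hfg' : FiniteDimensional K (𝒜 n) := by
      simp only [𝒜]; infer_instance
    refine ⟨hfg', le_trans ?_ e2⟩
    let ρ : gr K n →ₗ[K] 𝒜 n := π.toLinearMap.submoduleMap (gr K n)
    let σ : gr K n →ₗ[K] Dual K H := (LinearMap.lcomp K K H.subtype) ∘ₗ pr.flip ∘ₗ (gr K n).subtype
    have hρ : LinearMap.range ρ = ⊤ :=
      LinearMap.range_eq_top.2 (LinearMap.submoduleMap_surjective _ _)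
    have hker : LinearMap.ker σ ≤ LinearMap.ker ρ := by
      intro x hx
      rw [LinearMap.mem_ker] at hx ⊢
      apply Subtype.ext
      change π x = 0
      rw [hπ0]
      intro m t ht u v
      rw [← proj_self x.2, pr_proj (hH m ht)]
      split_ifs with h
      · rw [pr_con]
        exact LinearMap.congr_fun hx ⟨_, e3 m t ht u v h⟩
      · rfl
    have r1 := LinearMap.finrank_range_add_finrank_ker ρ
    have r2 := LinearMap.finrank_range_add_finrank_ker σ
    have r3 := Submodule.finrank_mono hker
    have r4 : finrank K (LinearMap.range σ) ≤ finrank K H := by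
      rw [← Subspace.dual_finrank_eq (K := K) (V := H)]
      exact Submodule.finrank_le _
    rw [hρ, finrank_top] at r1
    omega

/-! ### Numerical choices -/

theorem numerics (D κ : ℕ → ℕ) : ∃ e p : ℕ → ℕ, e 0 = 1 ∧ (∀ m, 1 ≤ e m) ∧
    (∀ m, e (m + 1) ≤ 2 * e m) ∧ Function.Injective p ∧ (∀ d, d < 2 ^ p d) ∧ (∀ d, 1 ≤ p d) ∧
    (∀ d m, m + 1 = p d →
      2 ^ e (m + 1) + D d ^ 2 * (2 ^ p d + 1) ^ (D d + 1) ≤ (2 ^ e m) ^ 2) ∧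
    ∃ k0, ∀ k, k0 ≤ k → ∃ C, κ C ≤ k ∧ ∑ a ∈ Finset.range (k + 1), e a ≤ C * k := by
  let c : ℕ → ℕ := fun d => 2 ^ (D d + 3)
  let Cs : ℕ → ℕ := fun d => ∑ i ∈ Finset.range (d + 1), c i
  let R : ℕ → ℕ := fun d => κ (Cs d + 2) + D d + 4 + d
  let q : ℕ → ℕ := fun d => Nat.rec (R 0) (fun d x => R (d + 1) + 2 ^ x + x + D d + 3 + 1) d
  have q0 : q 0 = R 0 := rfl
  have qs : ∀ d, q (d + 1) = R (d + 1) + 2 ^ q d + q d + D d + 3 + 1 := fun d => rfl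
  have qR : ∀ d, R d ≤ q d := by
    intro d
    cases d with
    | zero => exact q0.ge
    | succ d => rw [qs]; generalize 2 ^ q d = x; omega
  obtain ⟨s, hs⟩ : ∃ s : ℕ → ℕ, ∀ d, s d = 2 ^ q d := ⟨_, fun _ => rfl⟩
  obtain ⟨p, hp⟩ : ∃ p : ℕ → ℕ, ∀ d, p d = s d + (q d + D d + 3) := ⟨_, fun _ => rfl⟩
  have sq' : ∀ d, q d < s d := fun d => by rw [hs]; exact Nat.lt_two_pow_self
  have ps : ∀ d, p d < s (d + 1) := by
    intro d
    refine lt_of_le_of_lt ?_ (sq' (d + 1))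
    rw [qs, hp, hs]; omega
  have smono : StrictMono s := strictMono_nat_of_lt_succ fun d =>
    lt_of_le_of_lt (by rw [hp]; omega) (ps d)
  have psl : ∀ i j, i < j → p i < s j := fun i j hij =>
    (ps i).trans_le (smono.monotone hij)
  have sp : ∀ d, s d < p d := fun d => by rw [hp]; omega
  have pmono : StrictMono p := fun i j hij => (psl i j hij).trans (sp j)
  have sR : ∀ d, κ (Cs d + 2) + D d + 4 + d < s d := fun d => (qR d).trans_lt (sq' d)
  let b : ℕ → ℕ → ℕ := fun d m => if s d ≤ m ∧ m < p d then 2 ^ (m - s d) else 0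
  obtain ⟨e, he⟩ : ∃ e : ℕ → ℕ, ∀ m, e m = max 1 ((Finset.range (m + 1)).sup fun d => b d m) :=
    ⟨_, fun _ => rfl⟩
  have e1 : ∀ m, 1 ≤ e m := fun m => by rw [he]; exact le_max_left _ _
  have eb : ∀ d m, b d m ≤ e m := by
    intro d m
    by_cases h : d ≤ m
    · rw [he]
      exact le_max_of_le_right
        (Finset.le_sup (f := fun d => b d m) (Finset.mem_range.2 (Nat.lt_succ_of_le h)))
    · have := sR d
      simp only [b]
      rw [if_neg (by omega)]
      omega
  have ele : ∀ m X, 1 ≤ X → (∀ d, b d m ≤ X) → e m ≤ X := by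
    intro m X hX h
    rw [he]
    exact max_le hX (Finset.sup_le fun d _ => h d)
  refine ⟨e, p, ?_, e1, ?_, pmono.injective, ?_, ?_, ?_, ?_⟩
  · refine le_antisymm (ele 0 1 le_rfl fun d => ?_) (e1 0)
    have := sR d
    simp only [b]
    rw [if_neg (by omega)]
    omega
  · intro m
    have := e1 m
    refine ele (m + 1) _ (by omega) fun d => ?_
    by_cases h : s d ≤ m + 1 ∧ m + 1 < p d
    · by_cases h2 : s d ≤ m
      · have h3 := eb d m
        simp only [b] at h3 ⊢
        rw [if_pos (by omega)] at h3 ⊢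
        rw [Nat.succ_sub h2, pow_succ]
        omega
      · have h4 : m + 1 - s d = 0 := by omega
        simp only [b]
        rw [if_pos h, h4, pow_zero]
        omega
    · simp only [b]
      rw [if_neg h]
      omega
  · intro d
    have h1 := sR d
    have h2 := sp d
    exact lt_of_lt_of_le (by omega) (Nat.lt_two_pow_self (n := p d)).le
  · intro d
    have h2 := sp d
    omega
  · intro d m hm
    have h1 : e (m + 1) = 1 := by
      refine le_antisymm (ele _ 1 le_rfl fun i => ?_) (e1 _)
      simp only [b]
      rw [if_neg]
      · omega
      · rw [hm]
        rintro ⟨h3, h4⟩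
        rcases lt_trichotomy i d with h | h | h
        · have := pmono h; omega
        · subst h; omega
        · have := psl d i h; omega
    have h2 : 2 ^ (q d + D d + 2) ≤ e m := by
      have h3 := eb d m
      have h4 := hp d
      simp only [b] at h3
      rw [if_pos (by omega)] at h3
      have h5 : m - s d = q d + D d + 2 := by omega
      rwa [h5] at h3
    have h3 : 2 * D d + (p d + 1) * (D d + 1) + 1 ≤ 2 * e m := by
      have h4 : s d * 2 ^ (D d + 3) ≤ 2 * e m := by
        rw [hs, ← pow_add]
        calc 2 ^ (q d + (D d + 3)) = 2 * 2 ^ (q d + D d + 2) := by ring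
          _ ≤ _ := by omega
      refine le_trans ?_ h4
      have h5 := sR d
      have h6 := sq' d
      have h7 : p d + 1 ≤ 3 * s d := by rw [hp]; omega
      have h8 : 3 * D d + 5 ≤ 2 ^ (D d + 3) := by
        have := Nat.lt_two_pow_self (n := D d)
        rw [pow_add]; omega
      calc 2 * D d + (p d + 1) * (D d + 1) + 1 ≤ 2 * s d + (3 * s d) * (D d + 1) := by
            have := Nat.mul_le_mul_right (D d + 1) h7
            omega
        _ = s d * (3 * D d + 5) := by ring
        _ ≤ _ := Nat.mul_le_mul_left _ h8
    rw [h1, ← pow_mul, mul_comm (e m)]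
    calc 2 ^ 1 + D d ^ 2 * (2 ^ p d + 1) ^ (D d + 1)
        ≤ 2 ^ 1 + (2 ^ D d) ^ 2 * (2 ^ (p d + 1)) ^ (D d + 1) := by
          gcongr
          · exact (Nat.lt_two_pow_self).le
          · rw [pow_succ]
            have : 1 ≤ 2 ^ p d := Nat.one_le_two_pow
            omega
      _ = 2 ^ 1 + 2 ^ (2 * D d + (p d + 1) * (D d + 1)) := by
          rw [← pow_mul, ← pow_mul, ← pow_add, mul_comm (D d) 2]
      _ ≤ 2 ^ (2 * D d + (p d + 1) * (D d + 1) + 1) := by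
          rw [pow_succ _ (2 * D d + (p d + 1) * (D d + 1))]
          have : 2 ^ 1 ≤ 2 ^ (2 * D d + (p d + 1) * (D d + 1)) := by
            apply Nat.pow_le_pow_right (by norm_num)
            have : 1 ≤ (p d + 1) * (D d + 1) := Nat.mul_pos (by omega) (by omega)
            omega
          omega
      _ ≤ _ := Nat.pow_le_pow_right (by norm_num) h3
  · refine ⟨s 0, fun k hk => ?_⟩
    have hsid : ∀ d, d ≤ s d := fun d => by have := sR d; omega
    let δ := Nat.findGreatest (fun d => s d ≤ k) k
    have hδ : s δ ≤ k := Nat.findGreatest_spec (P := fun d => s d ≤ k) (Nat.zero_le k) hk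
    have hδm : ∀ d, s d ≤ k → d ≤ δ := fun d hd =>
      Nat.le_findGreatest ((hsid d).trans hd) hd
    refine ⟨Cs δ + 2, by have := sR δ; omega, ?_⟩
    have hb : ∀ d, ∑ m ∈ Finset.range (k + 1), b d m ≤ if s d ≤ k then k * c d else 0 := by
      intro d
      split_ifs with h
      · calc ∑ m ∈ Finset.range (k + 1), b d m
            ≤ ∑ m ∈ Finset.Ico (s d) (p d), 2 ^ (m - s d) := by
              simp only [b]
              rw [← Finset.sum_filter]
              apply Finset.sum_le_sum_of_subset
              intro m hm
              simp only [Finset.mem_filter, Finset.mem_Ico] at hm ⊢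
              exact hm.2
          _ = ∑ i ∈ Finset.range (p d - s d), 2 ^ i := by
              rw [Finset.sum_Ico_eq_sum_range]
              simp
          _ ≤ 2 ^ (p d - s d) := by
              rw [Nat.geomSum_eq le_rfl]
              simp
          _ = s d * c d := by
              have : p d - s d = q d + (D d + 3) := by have := hp d; omega
              rw [this, pow_add, hs]
          _ ≤ _ := Nat.mul_le_mul_right _ h
      · refine le_of_eq (Finset.sum_eq_zero fun m hm => ?_)
        rw [Finset.mem_range] at hm
        simp only [b]
        rw [if_neg (by omega)]
    have hk1 : 1 ≤ k := by have := sR 0; omega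
    calc ∑ a ∈ Finset.range (k + 1), e a
        ≤ ∑ a ∈ Finset.range (k + 1), (1 + ∑ d ∈ Finset.range (δ + 1), b d a) := by
          refine Finset.sum_le_sum fun a ha => ?_
          refine ele a _ (by omega) fun d => ?_
          rw [Finset.mem_range] at ha
          by_cases hd : d ≤ δ
          · have : b d a ≤ ∑ d ∈ Finset.range (δ + 1), b d a :=
              Finset.single_le_sum (f := fun d => b d a) (fun _ _ => Nat.zero_le _)
              (Finset.mem_range.2 (Nat.lt_succ_of_le hd))
            omega
          · have h1 : ¬ s d ≤ k := fun h => hd (hδm d h)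
            simp only [b]
            rw [if_neg (by omega)]
            omega
      _ = (k + 1) + ∑ d ∈ Finset.range (δ + 1), ∑ a ∈ Finset.range (k + 1), b d a := by
          rw [Finset.sum_add_distrib, Finset.sum_comm]
          simp
      _ ≤ (k + 1) + ∑ d ∈ Finset.range (δ + 1), k * c d := by
          gcongr with d hd
          refine (hb d).trans ?_
          split_ifs <;> omega
      _ = (k + 1) + k * Cs δ := by rw [← Finset.mul_sum]
      _ ≤ (Cs δ + 2) * k := by
          rw [add_mul, mul_comm k]; omega

end Kur

/-- **Theorem 1.1.** Let `K` be a field and `α : [0,∞) → [0,∞)` a weakly increasing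
function tending to `∞`. Then there is a finitely generated connected graded `K`-algebra
`B = ⊕_{n≥0} B(n)`, infinite-dimensional over `K`, such that every element of the
homogeneous maximal ideal `⊕_{n≥1} B(n)` is nilpotent, and
`dim_K B(n) ≤ n^{α(n)}` for all sufficiently large `n`. -/
theorem kurosh_general_field {K : Type u} [Field K] (α : ℝ → ℝ)
    (hα_mono : MonotoneOn α (Set.Ici (0 : ℝ)))
    (hα_nonneg : ∀ x : ℝ, 0 ≤ x → 0 ≤ α x)
    (hα_tendsto : Filter.Tendsto α Filter.atTop Filter.atTop) :
    ∃ (B : Type u) (_ : Ring B) (_ : Algebra K B) (𝒜 : ℕ → Submodule K B)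
      (_ : GradedAlgebra 𝒜),
      Algebra.FiniteType K B ∧
      𝒜 0 = (1 : Submodule K B) ∧
      ¬ Module.Finite K B ∧
      (∀ x ∈ (⨆ n ≥ 1, 𝒜 n : Submodule K B), IsNilpotent x) ∧
      (∀ᶠ n : ℕ in Filter.atTop,
        FiniteDimensional K (𝒜 n) ∧ (finrank K (𝒜 n) : ℝ) ≤ (n : ℝ) ^ α n) := by
  classical
  have hκ : ∀ C : ℕ, ∃ k0 : ℕ, ∀ k : ℕ, k0 ≤ k → (2 * C + 2 : ℝ) ≤ α ((2 : ℝ) ^ k) := by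
    intro C
    have h1 : Filter.Tendsto (fun k : ℕ => α ((2 : ℝ) ^ k)) Filter.atTop Filter.atTop :=
      hα_tendsto.comp (tendsto_pow_atTop_atTop_of_one_lt (by norm_num))
    exact Filter.eventually_atTop.1 (h1.eventually_ge_atTop _)
  choose κ hκ using hκ
  obtain ⟨e, p, e0, e1, e2, pinj, pd, p1, hkill, k0, hgrow⟩ :=
    Kur.numerics (fun d => (Kur.Wd d).card) κ
  choose Fk hF1 hF2 using fun d => Kur.kill_family K d (p d)
  let F : ℕ → Finset (Kur.A K) := fun m => if h : ∃ d, p d = m then Fk h.choose else ∅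
  have hFp : ∀ d, F (p d) = Fk d := by
    intro d
    have h : ∃ d', p d' = p d := ⟨d, rfl⟩
    simp only [F]
    rw [dif_pos h, pinj h.choose_spec]
  obtain ⟨T, hfd, hrk, hH, hT, hTF⟩ := Kur.tower (fun m => 2 ^ e m) F (by simp [e0]) (by
    intro m
    by_cases h : ∃ d, p d = m + 1
    · obtain ⟨d, hd⟩ := h
      rw [← hd, hFp]
      have := hkill d m hd.symm
      rw [← hd] at this
      exact le_trans (Nat.add_le_add_left (hF1 d) _) this
    · simp only [F]
      rw [dif_neg h, Finset.card_empty, add_zero, ← pow_mul, mul_comm (e m)]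
      exact Nat.pow_le_pow_right (by norm_num) (e2 m))
  have hpos : ∀ m, 1 ≤ finrank K (T m) := fun m => by rw [hrk]; exact Nat.one_le_two_pow
  obtain ⟨B, i1, i2, 𝒜, i3, b1, b2, b3, b4, b5⟩ := Kur.alg T hH
    (by
      intro m hm
      have := hpos m
      rw [hm] at this
      simp at this)
    (by
      intro d c hc
      refine ⟨2 * 2 ^ p d + 3, fun m => ?_⟩
      refine Kur.vanR hH hT (pd d) (fun w hw => Kur.mem_Wd.1 hw) hc ?_ _ le_rfl m
      intro t ht g h hg hh a ha
      refine hF2 d t ?_ c g h hg hh a ha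
      obtain ⟨m', hm'⟩ : ∃ m', p d = m' + 1 := ⟨p d - 1, by have := p1 d; omega⟩
      rw [← hFp]
      rw [hm'] at ht ⊢
      exact hTF m' t ht)
    (fun n => (n + 1) * (∏ a ∈ Finset.range (Nat.log 2 n + 1), finrank K (T a)) ^ 2)
    (fun n hn => Kur.mid hH hT hfd hpos n (Nat.log 2 n + 1) hn
      (Nat.lt_pow_succ_log_self (by norm_num) n))
  refine ⟨B, i1, i2, 𝒜, i3, b1, b2, b3, b4, ?_⟩
  filter_upwards [Filter.eventually_ge_atTop (2 ^ k0 + 2)] with n hn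
  have hn2 : 2 ≤ n := le_trans (Nat.le_add_left 2 _) hn
  have hn1 : 1 ≤ n := le_trans (by norm_num) hn2
  refine ⟨(b5 n hn1).1, ?_⟩
  set k := Nat.log 2 n with hk
  have hkk : 2 ^ k ≤ n := Nat.pow_log_le_self 2 (by omega)
  obtain ⟨C, hC1, hC2⟩ := hgrow k (Nat.le_log_of_pow_le (by norm_num)
    (le_trans (Nat.le_add_right _ _) hn))
  have hb : finrank K (𝒜 n) ≤ n ^ (2 * C + 2) := by
    refine (b5 n hn1).2.trans ?_
    simp only [hrk, Finset.prod_pow_eq_pow_sum]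
    calc (n + 1) * (2 ^ ∑ a ∈ Finset.range (k + 1), e a) ^ 2
        ≤ n ^ 2 * (2 ^ (C * k)) ^ 2 := by
          refine Nat.mul_le_mul (by nlinarith [hn2]) (Nat.pow_le_pow_left ?_ 2)
          exact Nat.pow_le_pow_right (by norm_num) hC2
      _ = n ^ 2 * (2 ^ k) ^ (2 * C) := by rw [← pow_mul, ← pow_mul]; ring_nf
      _ ≤ n ^ 2 * n ^ (2 * C) := by gcongr
      _ = n ^ (2 * C + 2) := by ring
  have hα : (2 * C + 2 : ℝ) ≤ α n := by
    refine (hκ C k hC1).trans ?_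
    refine hα_mono (Set.mem_Ici.2 (by positivity)) (Set.mem_Ici.2 (by positivity)) ?_
    exact_mod_cast hkk
  calc (finrank K (𝒜 n) : ℝ) ≤ (n : ℝ) ^ (2 * C + 2) := by exact_mod_cast hb
    _ = (n : ℝ) ^ ((2 * C + 2 : ℕ) : ℝ) := (Real.rpow_natCast _ _).symm
    _ ≤ (n : ℝ) ^ α n := by
      refine Real.rpow_le_rpow_of_exponent_le (by exact_mod_cast hn1) ?_
      push_cast
      exact hα
end

section
/- Let K be a field and let β : ℕ → ℕ be a monotonically increasing function that grows superpolynomially (for every real α > 0, β(n) > n^α for all sufficiently large n) and subexponentially (for every real C > 1, β(n) < C^n for all sufficiently large n). Then there exists a finitely generated connected ℕ-graded K-algebra B = ⊕_{n≥0} B(n), infinite-dimensional over K, whose homogeneous maximal ideal ⊕_{n≥1} B(n) is nil and such that dim_K B(n) < β(n) for all sufficiently large n. -/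
open Module

universe u


namespace Kurosh

/-- The free algebra on two letters. -/
abbrev FA (K : Type u) [Field K] : Type u := MonoidAlgebra K (FreeMonoid Bool)

section Free

variable {K : Type u} [Field K]

/-- The basis of words. -/
noncomputable def wb (K : Type u) [Field K] : Basis (List Bool) K (FA K) :=
  (Basis.ofRepr (MonoidAlgebra.coeffLinearEquiv K)).reindex
    (FreeMonoid.toList : FreeMonoid Bool ≃ List Bool)

lemma wb_eq (w : List Bool) : wb K w = MonoidAlgebra.single (FreeMonoid.ofList w) 1 := by
  simp only [wb, Basis.reindex_apply]
  rfl

lemma wb_mul (u v : List Bool) : wb K u * wb K v = wb K (u ++ v) := by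
  simp [wb_eq, MonoidAlgebra.single_mul_single]

lemma wb_nil : wb K [] = 1 := by
  simp [wb_eq, MonoidAlgebra.one_def]

/-- left quotient by a word -/
noncomputable def LQ (p : List Bool) : FA K →ₗ[K] FA K :=
  (wb K).constr K (fun w => if p <+: w then wb K (w.drop p.length) else 0)

/-- right quotient by a word -/
noncomputable def RQ (s : List Bool) : FA K →ₗ[K] FA K :=
  (wb K).constr K (fun w => if s <:+ w then wb K (w.take (w.length - s.length)) else 0)

/-- the pairing for which words are orthonormal -/
noncomputable def pair : FA K →ₗ[K] FA K →ₗ[K] K :=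
  (wb K).constr K (fun w => (wb K).coord w)

/-- words of length n -/
noncomputable def H (K : Type u) [Field K] (n : ℕ) : Submodule K (FA K) :=
  Submodule.span K (wb K '' {w | w.length = n})

/-- words of length at least n -/
noncomputable def HG (K : Type u) [Field K] (n : ℕ) : Submodule K (FA K) :=
  Submodule.span K (wb K '' {w | n ≤ w.length})

/-- projection to degree n -/
noncomputable def prj (n : ℕ) : FA K →ₗ[K] FA K :=
  (wb K).constr K (fun w => if w.length = n then wb K w else 0)

lemma LQ_wb (p w : List Bool) :
    LQ p (wb K w) = if p <+: w then wb K (w.drop p.length) else 0 := by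
  simp [LQ]

lemma LQ_wb_append (p w : List Bool) : LQ p (wb K (p ++ w)) = wb K w := by
  simp [LQ]

lemma RQ_wb (s w : List Bool) :
    RQ s (wb K w) = if s <:+ w then wb K (w.take (w.length - s.length)) else 0 := by
  simp [RQ]

lemma RQ_wb_append (s w : List Bool) : RQ s (wb K (w ++ s)) = wb K w := by
  simp [RQ]

lemma pair_wb (u v : List Bool) : pair (wb K u) (wb K v) = if u = v then 1 else 0 := by
  simp [pair, Finsupp.single_apply, eq_comm]

lemma prj_wb (n : ℕ) (w : List Bool) :
    prj n (wb K w) = if w.length = n then wb K w else 0 := by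
  simp [prj]

lemma wb_mem_H {n : ℕ} {w : List Bool} (h : w.length = n) : wb K w ∈ H K n :=
  Submodule.subset_span ⟨w, h, rfl⟩

lemma wb_mem_HG {n : ℕ} {w : List Bool} (h : n ≤ w.length) : wb K w ∈ HG K n :=
  Submodule.subset_span ⟨w, h, rfl⟩

lemma H_le_HG {n d : ℕ} (h : n ≤ d) : H K d ≤ HG K n := by
  refine Submodule.span_mono (Set.image_mono ?_)
  rintro w rfl
  exact h

/-- induction on words -/
lemma wb_induction {P : FA K → Prop} (h0 : P 0) (hadd : ∀ x y, P x → P y → P (x + y))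
    (hs : ∀ (a : K) x, P x → P (a • x)) (hw : ∀ w, P (wb K w)) (x : FA K) : P x := by
  have hx : x ∈ Submodule.span K (Set.range (wb K)) := by
    rw [(wb K).span_eq]; trivial
  induction hx using Submodule.span_induction with
  | mem x h => obtain ⟨w, rfl⟩ := h; exact hw w
  | zero => exact h0
  | add x y _ _ hx hy => exact hadd _ _ hx hy
  | smul a x _ hx => exact hs _ _ hx

lemma pair_wb_left (u : List Bool) (x : FA K) : pair (wb K u) x = (wb K).repr x u := by
  simp [pair]

lemma pair_comm (x y : FA K) : pair x y = pair y x := by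
  induction x using wb_induction with
  | h0 => simp
  | hadd a b ha hb => simp [ha, hb]
  | hs a b ha => simp [ha]
  | hw w =>
    induction y using wb_induction with
    | h0 => simp
    | hadd a b ha hb => simp [ha, hb]
    | hs a b ha => simp [ha]
    | hw v => simp [pair_wb, eq_comm]

lemma pair_wb_mul (p : List Bool) (x y : FA K) :
    pair (wb K p * x) y = pair x (LQ p y) := by
  induction x using wb_induction with
  | h0 => simp
  | hadd a b ha hb => simp [ha, hb, mul_add]
  | hs a b ha => simp [ha]
  | hw w =>
    induction y using wb_induction with
    | h0 => simp
    | hadd a b ha hb => simp [ha, hb]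
    | hs a b ha => simp [ha]
    | hw v =>
      rw [wb_mul, LQ_wb, pair_wb]
      by_cases h : p <+: v
      · obtain ⟨t, rfl⟩ := h
        simp [pair_wb]
      · rw [if_neg h, if_neg, map_zero]
        rintro rfl
        exact h ⟨w, rfl⟩

lemma pair_mul_wb (p : List Bool) (x y : FA K) :
    pair (x * wb K p) y = pair x (RQ p y) := by
  induction x using wb_induction with
  | h0 => simp
  | hadd a b ha hb => simp [ha, hb, add_mul]
  | hs a b ha => simp [ha]
  | hw w =>
    induction y using wb_induction with
    | h0 => simp
    | hadd a b ha hb => simp [ha, hb]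
    | hs a b ha => simp [ha]
    | hw v =>
      rw [wb_mul, RQ_wb, pair_wb]
      by_cases h : p <:+ v
      · obtain ⟨t, rfl⟩ := h
        simp [pair_wb]
      · rw [if_neg h, if_neg, map_zero]
        rintro rfl
        exact h ⟨w, rfl⟩

lemma pair_eq_zero_of_forall (x : FA K) (h : ∀ w, pair (wb K w) x = 0) : x = 0 := by
  apply (wb K).repr.injective
  ext w
  simpa [pair_wb_left] using h w

/-- if all words in `r` have length at least `p.length` then left quotient by `p` only acts on
`r`. -/
lemma LQ_mul {p : List Bool} {r : FA K} (hr : r ∈ HG K p.length) (s : FA K) :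
    LQ p (r * s) = LQ p r * s := by
  induction hr using Submodule.span_induction with
  | zero => simp
  | add x y _ _ hx hy => simp [add_mul, hx, hy]
  | smul a x _ hx => simp [hx]
  | mem x h =>
    obtain ⟨w, hw, rfl⟩ := h
    simp only [Set.mem_ofPred_eq] at hw
    induction s using wb_induction with
    | h0 => simp
    | hadd a b ha hb => simp [ha, hb, mul_add]
    | hs a b ha => simp [ha]
    | hw v =>
      rw [wb_mul, LQ_wb, LQ_wb]
      by_cases h : p <+: w
      · rw [if_pos h, if_pos (h.trans (List.prefix_append _ _)), wb_mul, List.drop_append_of_le_length hw]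
      · rw [if_neg h, if_neg, zero_mul]
        intro h'
        exact h (List.prefix_of_prefix_length_le h' (List.prefix_append _ _) hw)

lemma RQ_mul {p : List Bool} {r : FA K} (hr : r ∈ HG K p.length) (s : FA K) :
    RQ p (s * r) = s * RQ p r := by
  induction hr using Submodule.span_induction with
  | zero => simp
  | add x y _ _ hx hy => simp [mul_add, hx, hy]
  | smul a x _ hx => simp [hx]
  | mem x h =>
    obtain ⟨w, hw, rfl⟩ := h
    simp only [Set.mem_ofPred_eq] at hw
    induction s using wb_induction with
    | h0 => simp
    | hadd a b ha hb => simp [ha, hb, add_mul]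
    | hs a b ha => simp [ha]
    | hw v =>
      by_cases h : p <:+ w
      · obtain ⟨t, rfl⟩ := h
        rw [wb_mul, ← List.append_assoc, RQ_wb_append, RQ_wb_append, wb_mul]
      · rw [wb_mul, RQ_wb, RQ_wb]
        rw [if_neg h, if_neg, mul_zero]
        intro h'
        exact h (List.suffix_of_suffix_length_le h' (List.suffix_append _ _) hw)

lemma LQ_append (p q : List Bool) (x : FA K) : LQ (p ++ q) x = LQ q (LQ p x) := by
  rw [← sub_eq_zero]
  apply pair_eq_zero_of_forall
  intro w
  rw [map_sub, ← pair_wb_mul, ← pair_wb_mul, ← pair_wb_mul]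
  simp [wb_mul]

lemma RQ_append (p q : List Bool) (x : FA K) : RQ (p ++ q) x = RQ p (RQ q x) := by
  rw [← sub_eq_zero]
  apply pair_eq_zero_of_forall
  intro w
  rw [map_sub, ← pair_mul_wb, ← pair_mul_wb, ← pair_mul_wb]
  simp [wb_mul]

lemma H_mul (a b : ℕ) : H K a * H K b ≤ H K (a + b) := by
  unfold H
  rw [Submodule.span_mul_span, Submodule.span_le]
  rintro _ ⟨_, ⟨u, hu, rfl⟩, _, ⟨v, hv, rfl⟩, rfl⟩
  simp only [Set.mem_ofPred_eq] at hu hv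
  simp only [wb_mul]
  exact wb_mem_H (by simp [hu, hv])

lemma one_mem_H : (1 : FA K) ∈ H K 0 := by
  rw [← wb_nil]; exact wb_mem_H rfl

lemma H_zero : H K 0 = 1 := by
  unfold H
  have : {w : List Bool | w.length = 0} = {[]} := by ext; simp
  rw [this, Set.image_singleton, wb_nil, Submodule.one_eq_span]

lemma H_pow {d : ℕ} {V : Submodule K (FA K)} (hV : V ≤ H K d) (m : ℕ) : V ^ m ≤ H K (m * d) := by
  induction m with
  | zero => simp [H_zero]
  | succ m ih =>
    rw [pow_succ, add_mul, one_mul]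
    exact (mul_le_mul' ih hV).trans (H_mul _ _)

lemma LQ_mem_H {p : List Bool} {d e : ℕ} (h : p.length + e = d) {x : FA K} (hx : x ∈ H K d) :
    LQ p x ∈ H K e := by
  induction hx using Submodule.span_induction with
  | zero => simp
  | add x y _ _ hx hy => simp only [map_add]; exact add_mem hx hy
  | smul a x _ hx => simp only [map_smul]; exact Submodule.smul_mem _ _ hx
  | mem x hh =>
    obtain ⟨w, hw, rfl⟩ := hh
    simp only [Set.mem_ofPred_eq] at hw
    rw [LQ_wb]
    split_ifs
    · exact wb_mem_H (by simp; omega)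
    · exact zero_mem _

lemma RQ_mem_H {p : List Bool} {d e : ℕ} (h : p.length + e = d) {x : FA K} (hx : x ∈ H K d) :
    RQ p x ∈ H K e := by
  induction hx using Submodule.span_induction with
  | zero => simp
  | add x y _ _ hx hy => simp only [map_add]; exact add_mem hx hy
  | smul a x _ hx => simp only [map_smul]; exact Submodule.smul_mem _ _ hx
  | mem x hh =>
    obtain ⟨w, hw, rfl⟩ := hh
    simp only [Set.mem_ofPred_eq] at hw
    rw [RQ_wb]
    split_ifs
    · exact wb_mem_H (by simp; omega)
    · exact zero_mem _

lemma pair_H_HG {d n : ℕ} (h : d < n) {x y : FA K} (hx : x ∈ HG K n) (hy : y ∈ H K d) :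
    pair x y = 0 := by
  induction hx using Submodule.span_induction with
  | zero => simp
  | add x y _ _ hx hy => simp [hx, hy]
  | smul a x _ hx => simp [hx]
  | mem x hh =>
    obtain ⟨w, hw, rfl⟩ := hh
    simp only [Set.mem_ofPred_eq] at hw
    induction hy using Submodule.span_induction with
    | zero => simp
    | add x y _ _ hx hy => simp [hx, hy]
    | smul a x _ hx => simp [hx]
    | mem x hh =>
      obtain ⟨v, hv, rfl⟩ := hh
      simp only [Set.mem_ofPred_eq] at hv
      rw [pair_wb, if_neg]
      rintro rfl
      omega

end Free
end Kurosh


namespace Kurosh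

section Win

variable {K : Type u} [Field K]

/-- `P` is contained in the span of at most `N` elements. -/
def HasGen {A : Type u} [Ring A] [Algebra K A] (P : Submodule K A) (N : ℕ) : Prop :=
  ∃ s : Finset A, s.card ≤ N ∧ P ≤ Submodule.span K (s : Set A)

section Gen
variable {A : Type u} [Ring A] [Algebra K A]

lemma HasGen.mono {P Q : Submodule K A} {N M : ℕ} (h : HasGen Q N) (hPQ : P ≤ Q) (hNM : N ≤ M) :
    HasGen P M := by
  obtain ⟨s, hs, hQ⟩ := h
  exact ⟨s, hs.trans hNM, hPQ.trans hQ⟩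

lemma HasGen.mul {P Q : Submodule K A} {N M : ℕ} (hP : HasGen P N) (hQ : HasGen Q M) :
    HasGen (P * Q) (N * M) := by
  classical
  obtain ⟨s, hs, hP⟩ := hP
  obtain ⟨t, ht, hQ⟩ := hQ
  refine ⟨Finset.image₂ (· * ·) s t, (Finset.card_image₂_le _ _ _).trans (Nat.mul_le_mul hs ht), ?_⟩
  refine (mul_le_mul' hP hQ).trans ?_
  rw [Submodule.span_mul_span, Finset.coe_image₂]
  rfl

lemma HasGen.one : HasGen (1 : Submodule K A) 1 :=
  ⟨{1}, by simp, by simp [Submodule.one_eq_span]⟩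

lemma HasGen.pow {P : Submodule K A} {N : ℕ} (hP : HasGen P N) (m : ℕ) :
    HasGen (P ^ m) (N ^ m) := by
  induction m with
  | zero => simpa using HasGen.one
  | succ m ih => rw [pow_succ, pow_succ]; exact ih.mul hP

lemma HasGen.biSup {ι : Type*} (I : Finset ι) (P : ι → Submodule K A) {N : ℕ}
    (hP : ∀ i ∈ I, HasGen (P i) N) : HasGen (⨆ i ∈ I, P i) (I.card * N) := by
  classical
  choose! s hs hP using hP
  refine ⟨I.biUnion s, Finset.card_biUnion_le_card_mul _ _ _ hs, ?_⟩
  refine iSup₂_le fun i hi => (hP i hi).trans (Submodule.span_mono ?_)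
  intro x hx
  simp only [Finset.coe_biUnion, Set.mem_iUnion]
  exact ⟨i, hi, hx⟩

lemma HasGen.finrank_le {P : Submodule K A} {N : ℕ} (hP : HasGen P N) :
    FiniteDimensional K P ∧ finrank K P ≤ N := by
  obtain ⟨s, hs, hP⟩ := hP
  have : FiniteDimensional K (Submodule.span K (s : Set A)) :=
    FiniteDimensional.span_finset K s
  refine ⟨Submodule.finiteDimensional_of_le hP, ?_⟩
  exact (Submodule.finrank_mono hP).trans ((finrank_span_finset_le_card s).trans hs)

lemma HasGen.of_finrank {P : Submodule K A} [FiniteDimensional K P] :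
    HasGen P (finrank K P) := by
  classical
  let b := finBasis K P
  refine ⟨Finset.univ.image (fun i => (b i : A)), Finset.card_image_le.trans (by simp), ?_⟩
  intro x hx
  have := b.sum_repr ⟨x, hx⟩
  have h2 : x = ∑ i, b.repr ⟨x, hx⟩ i • (b i : A) := by
    calc x = P.subtype (∑ i, b.repr ⟨x, hx⟩ i • b i) := by rw [this]; rfl
      _ = _ := by rw [map_sum]; rfl
  rw [h2]
  refine Submodule.sum_mem _ fun i _ => Submodule.smul_mem _ _ (Submodule.subset_span ?_)
  simp

end Gen

/-- span of the left quotients by words of length `i` -/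
noncomputable def DL (i : ℕ) (V : Submodule K (FA K)) : Submodule K (FA K) :=
  ⨆ (p : List Bool) (_ : p.length = i), V.map (LQ p)

/-- span of the right quotients by words of length `i` -/
noncomputable def DR (i : ℕ) (V : Submodule K (FA K)) : Submodule K (FA K) :=
  ⨆ (p : List Bool) (_ : p.length = i), V.map (RQ p)

lemma LQ_mem_DL {i : ℕ} {V : Submodule K (FA K)} {p : List Bool} (hp : p.length = i) {x : FA K}
    (hx : x ∈ V) : LQ p x ∈ DL i V :=
  (le_iSup₂_of_le (f := fun (p : List Bool) (_ : p.length = i) => V.map (LQ p)) p hp le_rfl)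
    (Submodule.mem_map_of_mem hx)

lemma RQ_mem_DR {i : ℕ} {V : Submodule K (FA K)} {p : List Bool} (hp : p.length = i) {x : FA K}
    (hx : x ∈ V) : RQ p x ∈ DR i V :=
  (le_iSup₂_of_le (f := fun (p : List Bool) (_ : p.length = i) => V.map (RQ p)) p hp le_rfl)
    (Submodule.mem_map_of_mem hx)

lemma DL_le {i : ℕ} {V W : Submodule K (FA K)}
    (h : ∀ p : List Bool, p.length = i → ∀ x ∈ V, LQ p x ∈ W) : DL i V ≤ W := by
  refine iSup₂_le fun p hp => ?_
  rw [Submodule.map_le_iff_le_comap]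
  exact fun x hx => h p hp x hx

lemma DR_le {i : ℕ} {V W : Submodule K (FA K)}
    (h : ∀ p : List Bool, p.length = i → ∀ x ∈ V, RQ p x ∈ W) : DR i V ≤ W := by
  refine iSup₂_le fun p hp => ?_
  rw [Submodule.map_le_iff_le_comap]
  exact fun x hx => h p hp x hx

lemma DL_mono (i : ℕ) {V W : Submodule K (FA K)} (h : V ≤ W) : DL i V ≤ DL i W :=
  DL_le fun _ hp _ hx => LQ_mem_DL hp (h hx)

lemma DR_mono (i : ℕ) {V W : Submodule K (FA K)} (h : V ≤ W) : DR i V ≤ DR i W :=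
  DR_le fun _ hp _ hx => RQ_mem_DR hp (h hx)

lemma DL_mul {i d : ℕ} (hi : i ≤ d) {V : Submodule K (FA K)} (hV : V ≤ H K d)
    (W : Submodule K (FA K)) : DL i (V * W) ≤ DL i V * W := by
  refine DL_le fun p hp x hx => ?_
  induction hx using Submodule.mul_induction_on' with
  | mem_mul_mem m hm n hn =>
    rw [LQ_mul (H_le_HG (hp.trans_le hi) (hV hm))]
    exact Submodule.mul_mem_mul (LQ_mem_DL hp hm) hn
  | add x _ y _ hx hy => rw [map_add]; exact add_mem hx hy

lemma DR_mul {i d : ℕ} (hi : i ≤ d) {V : Submodule K (FA K)} (hV : V ≤ H K d)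
    (W : Submodule K (FA K)) : DR i (W * V) ≤ W * DR i V := by
  refine DR_le fun p hp x hx => ?_
  induction hx using Submodule.mul_induction_on' with
  | mem_mul_mem m hm n hn =>
    rw [RQ_mul (H_le_HG (hp.trans_le hi) (hV hn))]
    exact Submodule.mul_mem_mul hm (RQ_mem_DR hp hn)
  | add x _ y _ hx hy => rw [map_add]; exact add_mem hx hy

lemma DL_full {d : ℕ} {V : Submodule K (FA K)} (hV : V ≤ H K d) : DL d V ≤ 1 := by
  rw [← H_zero]
  exact DL_le fun p hp x hx => LQ_mem_H (by simpa using hp) (hV hx)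

lemma DR_full {d : ℕ} {V : Submodule K (FA K)} (hV : V ≤ H K d) : DR d V ≤ 1 := by
  rw [← H_zero]
  exact DR_le fun p hp x hx => RQ_mem_H (by simpa using hp) (hV hx)

lemma DL_add (i j : ℕ) (V : Submodule K (FA K)) : DL (i + j) V ≤ DL j (DL i V) := by
  refine DL_le fun p hp x hx => ?_
  rw [← List.take_append_drop i p, LQ_append]
  exact LQ_mem_DL (by simp [hp]) (LQ_mem_DL (by simp [hp]) hx)

lemma DR_add (i j : ℕ) (V : Submodule K (FA K)) : DR (i + j) V ≤ DR j (DR i V) := by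
  refine DR_le fun p hp x hx => ?_
  rw [← List.take_append_drop j p, RQ_append]
  exact RQ_mem_DR (by simp [hp]) (RQ_mem_DR (by simp [hp]) hx)

lemma DL_window {d : ℕ} {V : Submodule K (FA K)} (hV : V ≤ H K d) :
    ∀ (Q i : ℕ), i < Q * d → ∃ i' q, i' < d ∧ (q + 1) * d + i = Q * d + i' ∧
      DL i (V ^ Q) ≤ DL i' V * V ^ q := by
  intro Q
  induction Q with
  | zero => intro i hi; omega
  | succ Q ih =>
    intro i hi
    rcases lt_or_ge i d with h | h
    · exact ⟨i, Q, h, rfl, by rw [pow_succ']; exact DL_mul h.le hV _⟩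
    · obtain ⟨i', q, h1, h2, h3⟩ := ih (i - d) (by rw [add_mul] at hi; omega)
      refine ⟨i', q, h1, by rw [add_mul Q]; omega, ?_⟩
      refine le_trans ?_ h3
      have : i = d + (i - d) := by omega
      rw [this, pow_succ']
      simp only [Nat.add_sub_cancel_left]
      refine (DL_add _ _ _).trans (DL_mono _ ?_)
      refine (DL_mul le_rfl hV _).trans ?_
      calc _ ≤ 1 * V ^ Q := mul_le_mul' (DL_full hV) le_rfl
        _ = _ := one_mul _

lemma DR_window {d : ℕ} {V : Submodule K (FA K)} (hV : V ≤ H K d) :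
    ∀ (Q i : ℕ), i < Q * d → ∃ i' q, i' < d ∧ (q + 1) * d + i = Q * d + i' ∧
      DR i (V ^ Q) ≤ V ^ q * DR i' V := by
  intro Q
  induction Q with
  | zero => intro i hi; omega
  | succ Q ih =>
    intro i hi
    rcases lt_or_ge i d with h | h
    · exact ⟨i, Q, h, rfl, by rw [pow_succ]; exact DR_mul h.le hV _⟩
    · obtain ⟨i', q, h1, h2, h3⟩ := ih (i - d) (by rw [add_mul] at hi; omega)
      refine ⟨i', q, h1, by rw [add_mul Q]; omega, ?_⟩
      refine le_trans ?_ h3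
      have : i = d + (i - d) := by omega
      rw [this, pow_succ]
      simp only [Nat.add_sub_cancel_left]
      refine (DR_add _ _ _).trans (DR_mono _ ?_)
      refine (DR_mul le_rfl hV _).trans ?_
      calc _ ≤ V ^ Q * 1 := mul_le_mul' le_rfl (DR_full hV)
        _ = _ := mul_one _

lemma window {d : ℕ} {V : Submodule K (FA K)} (hV : V ≤ H K d) {Q i j n : ℕ}
    (h : i + n + j = Q * d) (hn : d < n) :
    ∃ i' j' q, i' < d ∧ j' < d ∧ (q + 2) * d = n + i' + j' ∧
      DL i (DR j (V ^ Q)) ≤ DL i' V * V ^ q * DR j' V := by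
  obtain ⟨j', q, hj', hq, hle⟩ := DR_window hV Q j (by omega)
  have e1 : (q + 1) * d = q * d + d := by ring
  obtain ⟨i', q', hi', hq', hle'⟩ := DL_window hV q i (by omega)
  refine ⟨i', j', q', hi', hj', ?_, ?_⟩
  · have : (q' + 2) * d = (q' + 1) * d + d := by ring
    omega
  · refine (DL_mono _ hle).trans ?_
    refine (DL_mul (d := q * d) (by omega) (H_pow hV q) _).trans ?_
    exact mul_le_mul' hle' le_rfl

/-- A tower of subspaces -/
structure Tower (K : Type u) [Field K] (m : ℕ → ℕ) where
  V : ℕ → Submodule K (FA K)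
  V0 : V 0 = H K 1
  V_succ : ∀ k, V (k + 1) ≤ V k ^ m k
  V_rank : ∀ k, finrank K (V k) = 2

/-- degrees -/
def dg (m : ℕ → ℕ) (k : ℕ) : ℕ := ∏ i ∈ Finset.range k, m i

/-- sums -/
def sm (m : ℕ → ℕ) (k : ℕ) : ℕ := ∑ i ∈ Finset.range k, m i

variable {m : ℕ → ℕ}

lemma dg_succ (k : ℕ) : dg m (k + 1) = m k * dg m k := by
  simp [dg, Finset.prod_range_succ, mul_comm]

lemma sm_succ (k : ℕ) : sm m (k + 1) = sm m k + m k := by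
  simp [sm, Finset.sum_range_succ]

namespace Tower
variable (T : Tower K m)

lemma le_H (k : ℕ) : T.V k ≤ H K (dg m k) := by
  induction k with
  | zero => simp [T.V0, dg]
  | succ k ih => rw [dg_succ]; exact (T.V_succ k).trans (H_pow ih _)

lemma gen (k : ℕ) : HasGen (T.V k) 2 := by
  have : FiniteDimensional K (T.V k) := FiniteDimensional.of_finrank_pos (by rw [T.V_rank]; simp)
  have := HasGen.of_finrank (P := T.V k)
  rwa [T.V_rank] at this

lemma le_pow (k l : ℕ) : ∃ Q, Q * dg m k = dg m (k + l) ∧ T.V (k + l) ≤ T.V k ^ Q := by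
  induction l with
  | zero => exact ⟨1, by simp, by simp⟩
  | succ l ih =>
    obtain ⟨Q, h1, h2⟩ := ih
    refine ⟨Q * m (k + l), ?_, ?_⟩
    · rw [← add_assoc, dg_succ, ← h1]; ring
    · rw [← add_assoc, pow_mul]
      exact (T.V_succ _).trans (pow_le_pow_left' h2 _)

lemma DL_gen (k : ℕ) : ∀ i < dg m k, HasGen (DL i (T.V k)) (2 ^ (1 + sm m k)) := by
  induction k with
  | zero =>
    intro i hi
    have : i = 0 := by simpa [dg] using hi
    subst this
    refine (T.gen 0).mono (DL_le fun p hp x hx => ?_) (by simp [sm])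
    have : p = [] := List.length_eq_zero_iff.mp hp
    subst this
    have : LQ [] x = x := by
      have h := LQ_mul (K := K) (p := []) (r := 1) (H_le_HG le_rfl one_mem_H) x
      rw [← wb_nil, LQ_wb] at h
      simpa [wb_nil] using h
    rwa [this]
  | succ k ih =>
    intro i hi
    rw [dg_succ] at hi
    obtain ⟨i', q, h1, h2, h3⟩ := DL_window (T.le_H k) (m k) i hi
    have hq : q ≤ m k := by
      have : (q + 1) * dg m k < (m k + 1) * dg m k := by rw [add_mul (m k)]; omega
      have := lt_of_mul_lt_mul_right this (Nat.zero_le _)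
      omega
    refine (((ih i' h1).mul ((T.gen k).pow q))).mono ((DL_mono _ (T.V_succ k)).trans h3) ?_
    rw [← pow_add, sm_succ]
    exact Nat.pow_le_pow_right (by norm_num) (by omega)

lemma DR_gen (k : ℕ) : ∀ i < dg m k, HasGen (DR i (T.V k)) (2 ^ (1 + sm m k)) := by
  induction k with
  | zero =>
    intro i hi
    have : i = 0 := by simpa [dg] using hi
    subst this
    refine (T.gen 0).mono (DR_le fun p hp x hx => ?_) (by simp [sm])
    have : p = [] := List.length_eq_zero_iff.mp hp
    subst this
    have : RQ [] x = x := by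
      have h := RQ_mul (K := K) (p := []) (r := 1) (H_le_HG le_rfl one_mem_H) x
      rw [← wb_nil, RQ_wb] at h
      simpa [wb_nil] using h
    rwa [this]
  | succ k ih =>
    intro i hi
    rw [dg_succ] at hi
    obtain ⟨i', q, h1, h2, h3⟩ := DR_window (T.le_H k) (m k) i hi
    have hq : q ≤ m k := by
      have : (q + 1) * dg m k < (m k + 1) * dg m k := by rw [add_mul (m k)]; omega
      have := lt_of_mul_lt_mul_right this (Nat.zero_le _)
      omega
    refine (((T.gen k).pow q).mul (ih i' h1)).mono ((DR_mono _ (T.V_succ k)).trans h3) ?_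
    rw [← pow_add, sm_succ]
    exact Nat.pow_le_pow_right (by norm_num) (by omega)

/-- All degree `n` functionals. -/
noncomputable def M (n : ℕ) : Submodule K (FA K) :=
  ⨆ (k : ℕ) (i : ℕ) (j : ℕ) (_ : i + n + j = dg m k), DL i (DR j (T.V k))

/-- degrees are increasing -/
lemma dg_mono (hm : ∀ k, 2 ≤ m k) : StrictMono (dg m) := by
  have hpos : ∀ k, 0 < dg m k := fun k => Finset.prod_pos fun i _ => by have := hm i; omega
  refine strictMono_nat_of_lt_succ fun k => ?_
  rw [dg_succ]
  have := hm k
  have := hpos k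
  nlinarith

lemma window (hm : ∀ k, 2 ≤ m k) {k K' i j n : ℕ} (h : i + n + j = dg m K') (hn : dg m k < n) :
    ∃ i' j' q, i' < dg m k ∧ j' < dg m k ∧ (q + 2) * dg m k = n + i' + j' ∧
      DL i (DR j (T.V K')) ≤ DL i' (T.V k) * T.V k ^ q * DR j' (T.V k) := by
  have hk : k ≤ K' := by
    by_contra hc
    have := (dg_mono hm).monotone (not_le.mp hc).le
    omega
  obtain ⟨l, rfl⟩ := Nat.exists_eq_add_of_le hk
  obtain ⟨Q, h1, h2⟩ := T.le_pow k l
  obtain ⟨i', j', q, a, b, c, e⟩ := Kurosh.window (T.le_H k) (Q := Q) (h.trans h1.symm) hn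
  exact ⟨i', j', q, a, b, c, (DL_mono _ (DR_mono _ h2)).trans e⟩

lemma M_gen (hm : ∀ k, 2 ≤ m k) {k n : ℕ} (h1 : dg m k < n) (h2 : n ≤ dg m (k + 1)) :
    HasGen (T.M n) (n ^ 2 * 4 ^ (sm m (k + 1) + 1)) := by
  classical
  let I : Finset (ℕ × ℕ × ℕ) := Finset.range (dg m k) ×ˢ Finset.range (dg m k) ×ˢ Finset.range (m k)
  have hgen : HasGen (⨆ x ∈ I, DL x.1 (T.V k) * T.V k ^ x.2.2 * DR x.2.1 (T.V k))
      (I.card * (2 ^ (1 + sm m k) * 2 ^ m k * 2 ^ (1 + sm m k))) := by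
    refine HasGen.biSup _ _ fun x hx => ?_
    simp only [I, Finset.mem_product, Finset.mem_range] at hx
    refine HasGen.mul (HasGen.mul (T.DL_gen k _ hx.1) ?_) (T.DR_gen k _ hx.2.1)
    exact ((T.gen k).pow x.2.2).mono le_rfl (Nat.pow_le_pow_right (by norm_num) hx.2.2.le)
  refine hgen.mono ?_ ?_
  · refine iSup_le fun K' => iSup_le fun i => iSup_le fun j => iSup_le fun h => ?_
    obtain ⟨i', j', q, a, b, c, e⟩ := T.window hm h h1
    refine e.trans ?_
    refine le_iSup₂_of_le (f := fun (x : ℕ × ℕ × ℕ) (_ : x ∈ I) =>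
      DL x.1 (T.V k) * T.V k ^ x.2.2 * DR x.2.1 (T.V k)) (i', j', q) ?_ le_rfl
    simp only [I, Finset.mem_product, Finset.mem_range]
    refine ⟨a, b, ?_⟩
    rw [dg_succ] at h2
    have : (q + 2) * dg m k < (m k + 2) * dg m k := by
      rw [c, add_mul]; omega
    have := lt_of_mul_lt_mul_right this (Nat.zero_le _)
    omega
  · have hc : I.card = dg m k * (dg m k * m k) := by simp [I]
    rw [hc, sm_succ]
    have h3 : m k ≤ 2 ^ m k := Nat.lt_two_pow_self.le
    have h4 : dg m k * dg m k ≤ n ^ 2 := by nlinarith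
    calc dg m k * (dg m k * m k) * (2 ^ (1 + sm m k) * 2 ^ m k * 2 ^ (1 + sm m k))
        = (dg m k * dg m k) * m k * (2 ^ (1 + sm m k) * 2 ^ m k * 2 ^ (1 + sm m k)) := by ring
      _ ≤ n ^ 2 * 2 ^ m k * (2 ^ (1 + sm m k) * 2 ^ m k * 2 ^ (1 + sm m k)) := by gcongr
      _ = n ^ 2 * 4 ^ (sm m k + m k + 1) := by
        rw [show (4 : ℕ) = 2 ^ 2 by norm_num, ← pow_mul]
        rw [mul_assoc, ← pow_add, ← pow_add, ← pow_add]
        congr 2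
        ring

end Tower

end Win
end Kurosh


namespace Kurosh

section Step

variable {K : Type u} [Field K]

/-- words of length less than `t` -/
def wordsLT : ℕ → Finset (List Bool)
  | 0 => ∅
  | t + 1 => insert [] ((wordsLT t).image (List.cons true) ∪ (wordsLT t).image (List.cons false))

lemma mem_wordsLT (t : ℕ) : ∀ w : List Bool, w ∈ wordsLT t ↔ w.length < t := by
  induction t with
  | zero => intro w; simp [wordsLT]
  | succ t ih =>
    intro w
    rcases w with _ | ⟨a, w⟩
    · simp [wordsLT]
    · cases a <;> simp [wordsLT, ih]

lemma card_wordsLT (t : ℕ) : (wordsLT t).card + 1 ≤ 2 ^ t := by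
  induction t with
  | zero => simp [wordsLT]
  | succ t ih =>
    have h1 := Finset.card_insert_le ([] : List Bool)
      ((wordsLT t).image (List.cons true) ∪ (wordsLT t).image (List.cons false))
    have h2 := Finset.card_union_le ((wordsLT t).image (List.cons true))
      ((wordsLT t).image (List.cons false))
    have h3 := Finset.card_image_le (s := wordsLT t) (f := List.cons true)
    have h4 := Finset.card_image_le (s := wordsLT t) (f := List.cons false)
    rw [pow_succ]
    simp only [wordsLT]
    omega

/-- Generic powers: the powers of linear combinations lie in a small space. -/
lemma generic_pow {σ : Type} [Fintype σ] [DecidableEq σ] {A : Type u} [Ring A] [Algebra K A]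
    (a : σ → A) (j : ℕ) : ∃ c : (σ → ℕ) → A, ∀ l : σ → K,
      (∑ s, l s • a s) ^ j =
        ∑ μ ∈ Fintype.piFinset (fun _ : σ => Finset.range (j + 1)), (∏ s, l s ^ μ s) • c μ := by
  classical
  let Pol : ℕ → ((σ → K) → A) → Prop := fun j g => ∃ c : (σ → ℕ) → A, ∀ l : σ → K,
      g l = ∑ μ ∈ Fintype.piFinset (fun _ : σ => Finset.range (j + 1)), (∏ s, l s ^ μ s) • c μ
  have hadd : ∀ j g h, Pol j g → Pol j h → Pol j (fun l => g l + h l) := by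
    rintro j g h ⟨c, hc⟩ ⟨e, he⟩
    exact ⟨fun μ => c μ + e μ, fun l => by simp [hc, he, smul_add, Finset.sum_add_distrib]⟩
  have hzero : ∀ j, Pol j (fun _ => 0) := fun j => ⟨0, by simp⟩
  have hsum : ∀ {ι : Type} (j : ℕ) (I : Finset ι) (g : ι → (σ → K) → A),
      (∀ i ∈ I, Pol j (g i)) → Pol j (fun l => ∑ i ∈ I, g i l) := by
    intro ι j I g
    induction I using Finset.induction_on with
    | empty => intro _; simpa using hzero j
    | insert i I hi ih =>
      intro h
      simp only [Finset.sum_insert hi]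
      exact hadd _ _ _ (h i (by simp)) (ih fun i' hi' => h i' (by simp [hi']))
  have hmon : ∀ (j : ℕ) (μ : σ → ℕ) (x : A), (∀ s, μ s ≤ j) →
      Pol j (fun l => (∏ s, l s ^ μ s) • x) := by
    intro j μ x hμ
    refine ⟨fun ν => if ν = μ then x else 0, fun l => ?_⟩
    rw [Finset.sum_eq_single μ]
    · simp
    · intro b _ hb; simp [hb]
    · intro h; exact absurd (by simpa [Nat.lt_succ_iff] using hμ) h
  change Pol j _
  induction j with
  | zero =>
    simpa using hmon 0 0 (1 : A) (by simp)
  | succ j ih =>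
    obtain ⟨c, hc⟩ := ih
    beta_reduce at hc
    have : (fun l : σ → K => (∑ s, l s • a s) ^ (j + 1)) = fun l =>
        ∑ s, ∑ μ ∈ Fintype.piFinset (fun _ : σ => Finset.range (j + 1)),
          (∏ s', l s' ^ (μ + Pi.single s 1 : σ → ℕ) s') • (a s * c μ) := by
      funext l
      rw [pow_succ', hc, Finset.sum_mul]
      refine Finset.sum_congr rfl fun s _ => ?_
      rw [Finset.mul_sum]
      refine Finset.sum_congr rfl fun μ _ => ?_
      rw [smul_mul_smul_comm]
      congr 1
      simp only [Pi.add_apply, pow_add, Finset.prod_mul_distrib]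
      rw [mul_comm]
      congr 1
      rw [Finset.prod_eq_single s]
      · simp
      · intro b _ hb; simp [hb]
      · simp
    rw [this]
    refine hsum _ _ _ fun s _ => hsum _ _ _ fun μ hμ => hmon _ _ _ fun s' => ?_
    simp only [Fintype.mem_piFinset, Finset.mem_range] at hμ
    have := hμ s'
    have h2 : (Pi.single s 1 : σ → ℕ) s' ≤ 1 := by
      by_cases h : s' = s
      · subst h; simp
      · simp [h]
    simp only [Pi.add_apply]
    omega

/-- elements without constant term with words of length at most `t` -/
noncomputable def Aug (K : Type u) [Field K] (t : ℕ) : Submodule K (FA K) :=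
  Submodule.span K (wb K '' {w | 1 ≤ w.length ∧ w.length ≤ t})

lemma Aug_le_HG (t : ℕ) : Aug K t ≤ HG K 1 :=
  Submodule.span_mono (Set.image_mono fun _ h => h.1)

lemma HG_mul (a b : ℕ) : HG K a * HG K b ≤ HG K (a + b) := by
  unfold HG
  rw [Submodule.span_mul_span, Submodule.span_le]
  rintro _ ⟨_, ⟨u, hu, rfl⟩, _, ⟨v, hv, rfl⟩, rfl⟩
  simp only [Set.mem_ofPred_eq] at hu hv
  simp only [wb_mul]
  exact wb_mem_HG (by simp; omega)

lemma HG_zero (x : FA K) : x ∈ HG K 0 := by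
  induction x using wb_induction with
  | h0 => simp
  | hadd a b ha hb => exact add_mem ha hb
  | hs a b ha => exact Submodule.smul_mem _ _ ha
  | hw w => exact wb_mem_HG (Nat.zero_le _)

lemma pow_mem_HG {f : FA K} (hf : f ∈ HG K 1) (j : ℕ) : f ^ j ∈ HG K j := by
  induction j with
  | zero => exact HG_zero _
  | succ j ih => rw [pow_succ]; exact HG_mul _ _ (Submodule.mul_mem_mul ih hf)

lemma relations (K : Type u) [Field K] (t n : ℕ) : ∃ s : Finset (FA K),
    s.card ≤ 4 ^ t * (n + 1) ^ 2 ^ (t + 1) ∧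
    ∀ φ ∈ H K n, (∀ g ∈ s, pair g φ = 0) → ∀ f ∈ Aug K t, ∀ u v : List Bool, u.length < t →
      v.length < t → ∀ j, pair (wb K u * f ^ j * wb K v) φ = 0 := by
  classical
  obtain ⟨S, hS, hSmem⟩ : ∃ S : Finset (List Bool), S.card + 1 ≤ 2 ^ (t + 1) ∧
      ∀ w : List Bool, 1 ≤ w.length ∧ w.length ≤ t → w ∈ S := by
    refine ⟨(wordsLT (t + 1)).erase [], ?_, ?_⟩
    · have h1 := card_wordsLT (t + 1)
      have h2 : ((wordsLT (t + 1)).erase []).card + 1 = (wordsLT (t + 1)).card :=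
        Finset.card_erase_add_one (by simp [mem_wordsLT])
      omega
    · intro w hw
      simp only [Finset.mem_erase, mem_wordsLT]
      refine ⟨?_, by omega⟩
      rintro rfl
      simp at hw
  have key := fun j => generic_pow (K := K) (σ := S) (fun s => wb K s.1) j
  choose c hc using key
  let J : Finset (List Bool × List Bool × ℕ × (S → ℕ)) :=
    wordsLT t ×ˢ wordsLT t ×ˢ Finset.range (n + 1) ×ˢ
      Fintype.piFinset (fun _ : S => Finset.range (n + 1))
  refine ⟨J.image (fun x => wb K x.1 * c x.2.2.1 x.2.2.2 * wb K x.2.1), ?_, ?_⟩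
  · refine Finset.card_image_le.trans ?_
    have hJ : J.card = (wordsLT t).card * ((wordsLT t).card * ((n + 1) * (n + 1) ^ S.card)) := by
      rw [Finset.card_product, Finset.card_product, Finset.card_product, Finset.card_range,
        Fintype.card_piFinset, Finset.prod_const, Finset.card_range, Finset.card_univ,
        Fintype.card_coe]
    rw [hJ]
    have h1 := card_wordsLT t
    calc (wordsLT t).card * ((wordsLT t).card * ((n + 1) * (n + 1) ^ S.card))
        ≤ 2 ^ t * (2 ^ t * ((n + 1) * (n + 1) ^ S.card)) := by gcongr <;> omega
      _ = 4 ^ t * (n + 1) ^ (S.card + 1) := by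
        rw [show (4 : ℕ) = 2 * 2 by norm_num, mul_pow]; ring
      _ ≤ 4 ^ t * (n + 1) ^ 2 ^ (t + 1) := by
        gcongr
        · omega
  · intro φ hφ hg f hf u v hu hv j
    rcases lt_or_ge n j with hj | hj
    · refine pair_H_HG hj ?_ hφ
      have h1 := HG_mul _ _ (Submodule.mul_mem_mul (HG_mul _ _ (Submodule.mul_mem_mul
        (HG_zero (wb K u)) (pow_mem_HG (Aug_le_HG t hf) j))) (HG_zero (wb K v)))
      simpa using h1
    · have hl : ∃ l : S → K, f = ∑ s, l s • wb K s.1 := by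
        clear hg
        induction hf using Submodule.span_induction with
        | zero => exact ⟨0, by simp⟩
        | add x y _ _ hx hy =>
          obtain ⟨l, hl⟩ := hx
          obtain ⟨l', hl'⟩ := hy
          exact ⟨l + l', by simp [hl, hl', add_smul, Finset.sum_add_distrib]⟩
        | smul a x _ hx =>
          obtain ⟨l, hl⟩ := hx
          exact ⟨a • l, by simp [hl, Finset.smul_sum, smul_smul]⟩
        | mem x h =>
          obtain ⟨w, hw, rfl⟩ := h
          simp only [Set.mem_ofPred_eq] at hw
          have hwS : w ∈ S := hSmem w hw
          refine ⟨Pi.single ⟨w, hwS⟩ 1, ?_⟩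
          rw [Finset.sum_eq_single ⟨w, hwS⟩]
          · simp
          · intro b _ hb; simp [hb]
          · simp
      obtain ⟨l, rfl⟩ := hl
      rw [hc, Finset.mul_sum, Finset.sum_mul, map_sum, LinearMap.sum_apply]
      refine Finset.sum_eq_zero fun μ hμ => ?_
      rw [mul_smul_comm, smul_mul_assoc, map_smul, LinearMap.smul_apply, hg, smul_zero]
      refine Finset.mem_image.mpr ⟨(u, v, j, μ), ?_, rfl⟩
      simp only [Fintype.mem_piFinset, Finset.mem_range] at hμ
      simp only [J, Finset.mem_product, mem_wordsLT, Finset.mem_range, Fintype.mem_piFinset]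
      exact ⟨hu, hv, by omega, fun a => (hμ a).trans_le (by omega)⟩

lemma LQ_eq_pair {d : ℕ} {u : List Bool} (hu : u.length = d) {x : FA K} (hx : x ∈ H K d) :
    LQ u x = pair (wb K u) x • (1 : FA K) := by
  induction hx using Submodule.span_induction with
  | zero => simp
  | add x y _ _ hx hy => simp [hx, hy, add_smul]
  | smul a x _ hx => simp [hx, smul_smul]
  | mem x h =>
    obtain ⟨w, hw, rfl⟩ := h
    simp only [Set.mem_ofPred_eq] at hw
    rw [LQ_wb, pair_wb]
    by_cases h : u = w
    · subst h
      simp [wb_nil]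
    · rw [if_neg, if_neg h, zero_smul]
      intro h'
      exact h (h'.eq_of_length (by omega))

lemma finrank_mul_ge {d : ℕ} {P Q : Submodule K (FA K)} (hP : P ≤ H K d)
    [FiniteDimensional K P] [FiniteDimensional K Q] :
    finrank K P * finrank K Q ≤ finrank K (P * Q : Submodule K (FA K)) := by
  classical
  let bP := finBasis K P
  let bQ := finBasis K Q
  have hPQ : FiniteDimensional K (P * Q : Submodule K (FA K)) :=
    ((HasGen.of_finrank (P := P)).mul (HasGen.of_finrank (P := Q))).finrank_le.1
  have hli : LinearIndependent K
      (fun x : Fin (finrank K P) × Fin (finrank K Q) => (bP x.1 : FA K) * (bQ x.2 : FA K)) := by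
    rw [Fintype.linearIndependent_iff]
    intro c hc
    have hbP : LinearIndependent K (fun i => (bP i : FA K)) :=
      bP.linearIndependent.map' P.subtype (by simp)
    have hbQ : LinearIndependent K (fun i => (bQ i : FA K)) :=
      bQ.linearIndependent.map' Q.subtype (by simp)
    let y : Fin (finrank K P) → FA K := fun i => ∑ j, c (i, j) • (bQ j : FA K)
    have h1 : ∑ i, (bP i : FA K) * y i = 0 := by
      rw [← hc, Fintype.sum_prod_type]
      refine Finset.sum_congr rfl fun i _ => ?_
      simp [y, Finset.mul_sum]
    have h2 : ∀ i, y i = 0 := by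
      intro i
      apply pair_eq_zero_of_forall
      intro v
      rw [Fintype.linearIndependent_iff] at hbP
      refine hbP (fun i => pair (wb K v) (y i)) ?_ i
      apply pair_eq_zero_of_forall
      intro u
      by_cases hu : u.length = d
      · have := congrArg (fun z => pair (wb K v) (LQ u z)) h1
        simp only [map_sum, map_zero] at this
        rw [map_sum, ← this]
        refine Finset.sum_congr rfl fun i _ => ?_
        have hi := hP (bP i).2
        rw [LQ_mul (H_le_HG hu.le hi), LQ_eq_pair hu hi]
        simp [mul_comm]
      · rw [map_sum]
        refine Finset.sum_eq_zero fun i _ => ?_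
        have : ∀ x ∈ H K d, pair (wb K u) x = 0 := by
          intro x hx
          induction hx using Submodule.span_induction with
          | zero => simp
          | add x y _ _ hx hy => simp [hx, hy]
          | smul a x _ hx => simp [hx]
          | mem x h =>
            obtain ⟨w, hw, rfl⟩ := h
            rw [pair_wb, if_neg]
            rintro rfl
            exact hu hw
        simp [this _ (hP (bP i).2)]
    rintro ⟨i, j⟩
    rw [Fintype.linearIndependent_iff] at hbQ
    exact hbQ (fun j => c (i, j)) (h2 i) j
  have h3 := finrank_span_eq_card hli
  rw [Fintype.card_prod, Fintype.card_fin, Fintype.card_fin] at h3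
  rw [← h3]
  refine Submodule.finrank_mono ?_
  rw [Submodule.span_le]
  rintro _ ⟨x, rfl⟩
  exact Submodule.mul_mem_mul (bP x.1).2 (bQ x.2).2

lemma finrank_pow_ge {d : ℕ} {P : Submodule K (FA K)} (hP : P ≤ H K d)
    [FiniteDimensional K P] (m : ℕ) :
    FiniteDimensional K (P ^ m : Submodule K (FA K)) ∧
    finrank K P ^ m ≤ finrank K (P ^ m : Submodule K (FA K)) := by
  have hfd : ∀ m, FiniteDimensional K (P ^ m : Submodule K (FA K)) := fun m =>
    ((HasGen.of_finrank (P := P)).pow m).finrank_le.1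
  refine ⟨hfd m, ?_⟩
  induction m with
  | zero =>
    rw [pow_zero, pow_zero, Submodule.one_eq_span, finrank_span_singleton one_ne_zero]
  | succ m ih =>
    rw [pow_succ', pow_succ']
    have := hfd m
    exact (Nat.mul_le_mul_left _ ih).trans (finrank_mul_ge hP)

lemma common_kernel {E : Type u} [AddCommGroup E] [Module K E] (W : Submodule K E)
    [FiniteDimensional K W] {ι : Type u} [Fintype ι] (l : ι → (E →ₗ[K] K))
    (hs : Fintype.card ι + 2 ≤ finrank K W) :
    ∃ f : Fin 2 → E, LinearIndependent K f ∧ (∀ i, f i ∈ W) ∧ ∀ i j, l j (f i) = 0 := by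
  let L : W →ₗ[K] (ι → K) := LinearMap.pi fun g => (l g).comp W.subtype
  have hL : ∀ (w : W) (g : ι), L w g = l g w.1 := fun w g => rfl
  clear_value L
  have h3 := L.finrank_range_add_finrank_ker
  have h4 : finrank K (LinearMap.range L) ≤ Fintype.card ι := by
    have := Submodule.finrank_le (LinearMap.range L)
    rwa [Module.finrank_fintype_fun_eq_card] at this
  have h5 : 2 ≤ finrank K (LinearMap.ker L) := by omega
  obtain ⟨f, hf⟩ := exists_linearIndependent_of_le_finrank h5
  refine ⟨fun i => ((f i : W) : E),
    (hf.map' (LinearMap.ker L).subtype (by simp)).map' W.subtype (by simp), fun i => (f i).1.2, ?_⟩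
  intro i j
  rw [← hL, LinearMap.mem_ker.mp (f i).2]
  rfl

lemma step_aux (W : Submodule K (FA K)) [FiniteDimensional K W]
    (s : Finset (FA K)) (hs : s.card + 2 ≤ finrank K W) :
    ∃ V' : Submodule K (FA K), V' ≤ W ∧ finrank K V' = 2 ∧
      ∀ φ ∈ V', ∀ g ∈ s, pair g φ = 0 := by
  obtain ⟨f, hf2, hW, hl⟩ := common_kernel W (fun g : s => pair g.1) (by
    rw [Fintype.card_coe]; exact hs)
  refine ⟨Submodule.span K (Set.range f), ?_, ?_, ?_⟩
  · rw [Submodule.span_le]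
    rintro _ ⟨i, rfl⟩
    exact hW i
  · rw [finrank_span_eq_card hf2]; simp
  · intro φ hφ g hg
    have hle : Submodule.span K (Set.range f) ≤ LinearMap.ker (pair g) := by
      rw [Submodule.span_le]
      rintro _ ⟨i, rfl⟩
      exact hl i ⟨g, hg⟩
    exact hle hφ

lemma step {d : ℕ} {V : Submodule K (FA K)} (hV : V ≤ H K d) (h2 : finrank K V = 2) (m : ℕ)
    (s : Finset (FA K)) (hs : s.card + 2 ≤ 2 ^ m) :
    ∃ V' : Submodule K (FA K), V' ≤ V ^ m ∧ finrank K V' = 2 ∧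
      ∀ φ ∈ V', ∀ g ∈ s, pair g φ = 0 := by
  have hfd : FiniteDimensional K V := FiniteDimensional.of_finrank_pos (by rw [h2]; simp)
  obtain ⟨hfd', hle⟩ := finrank_pow_ge hV m
  rw [h2] at hle
  exact step_aux (V ^ m) s (hs.trans hle)

/-- `V` is orthogonal to all the elements `u f^j v`. -/
def Kills (V : Submodule K (FA K)) (t : ℕ) : Prop :=
  ∀ φ ∈ V, ∀ f ∈ Aug K t, ∀ u v : List Bool, u.length < t →
      v.length < t → ∀ j, pair (wb K u * f ^ j * wb K v) φ = 0

lemma finrank_H_one : finrank K (H K 1) = 2 := by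
  have : H K 1 = Submodule.span K (Set.range fun b : Bool => wb K [b]) := by
    unfold H
    congr 1
    ext x
    simp [List.length_eq_one_iff, eq_comm]
  rw [this, finrank_span_eq_card]
  · simp
  · exact (wb K).linearIndependent.comp (fun b : Bool => [b]) (fun a b h => by simpa using h)

lemma exists_tower (K : Type u) [Field K] (m θ : ℕ → ℕ) (hm : ∀ k, 2 ≤ m k) :
    ∃ T : Tower K m, ∀ k, 4 ^ θ k * (dg m (k + 1) + 1) ^ 2 ^ (θ k + 1) + 2 ≤ 2 ^ m k →
      Kills (T.V (k + 1)) (θ k) := by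
  have hstep : ∀ (k : ℕ) (V : {V : Submodule K (FA K) // V ≤ H K (dg m k) ∧ finrank K V = 2}),
      ∃ V' : {V : Submodule K (FA K) // V ≤ H K (dg m (k + 1)) ∧ finrank K V = 2},
        V'.1 ≤ V.1 ^ m k ∧ (4 ^ θ k * (dg m (k + 1) + 1) ^ 2 ^ (θ k + 1) + 2 ≤ 2 ^ m k →
          Kills V'.1 (θ k)) := by
    rintro k ⟨V, hV, h2⟩
    by_cases h : 4 ^ θ k * (dg m (k + 1) + 1) ^ 2 ^ (θ k + 1) + 2 ≤ 2 ^ m k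
    · obtain ⟨s, hs, hs'⟩ := relations K (θ k) (dg m (k + 1))
      obtain ⟨V', h1, h3, h4⟩ := step hV h2 (m k) s (by omega)
      have h5 : V' ≤ H K (dg m (k + 1)) := by rw [dg_succ]; exact h1.trans (H_pow hV _)
      exact ⟨⟨V', h5, h3⟩, h1, fun _ φ hφ => hs' φ (h5 hφ) (h4 φ hφ)⟩
    · have : 2 ^ 1 ≤ 2 ^ m k := Nat.pow_le_pow_right (by norm_num) (by have := hm k; omega)
      obtain ⟨V', h1, h3, h4⟩ := step hV h2 (m k) ∅ (by simpa using this)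
      have h5 : V' ≤ H K (dg m (k + 1)) := by rw [dg_succ]; exact h1.trans (H_pow hV _)
      exact ⟨⟨V', h5, h3⟩, h1, fun h' => absurd h' h⟩
  choose F hF1 hF2 using hstep
  let W : ∀ k, {V : Submodule K (FA K) // V ≤ H K (dg m k) ∧ finrank K V = 2} := fun k =>
    Nat.rec ⟨H K 1, by simp [dg], finrank_H_one⟩ (fun k V => F k V) k
  exact ⟨⟨fun k => (W k).1, rfl, fun k => hF1 k (W k), fun k => (W k).2.2⟩,
    fun k => hF2 k (W k)⟩

end Step
end Kurosh


namespace Kurosh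

section Nil

variable {K : Type u} [Field K]

/-- The span of the elements `u f^j v` with short words `u`, `v`. -/
noncomputable def RF (t : ℕ) (f : FA K) : Submodule K (FA K) :=
  Submodule.span K {x | ∃ (u v : List Bool) (j : ℕ), u.length < t ∧ v.length < t ∧
    x = wb K u * f ^ j * wb K v}

lemma mem_RF {t : ℕ} {f : FA K} {u v : List Bool} (hu : u.length < t) (hv : v.length < t) (j : ℕ) :
    wb K u * f ^ j * wb K v ∈ RF t f := Submodule.subset_span ⟨u, v, j, hu, hv, rfl⟩

/-- span of short words -/
noncomputable def SW (K : Type u) [Field K] (t : ℕ) : Submodule K (FA K) :=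
  Submodule.span K (wb K '' {w | w.length < t})

lemma LQ_Aug {t : ℕ} {f : FA K} (hf : f ∈ Aug K t) (b : Bool) : LQ [b] f ∈ SW K t := by
  induction hf using Submodule.span_induction with
  | zero => simp
  | add x y _ _ hx hy => rw [map_add]; exact add_mem hx hy
  | smul a x _ hx => rw [map_smul]; exact Submodule.smul_mem _ _ hx
  | mem x h =>
    obtain ⟨w, hw, rfl⟩ := h
    simp only [Set.mem_ofPred_eq] at hw
    rw [LQ_wb]
    split_ifs
    · refine Submodule.subset_span ⟨_, ?_, rfl⟩
      simp only [Set.mem_ofPred_eq, List.length_drop, List.length_singleton]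
      omega
    · exact zero_mem _

lemma RQ_Aug {t : ℕ} {f : FA K} (hf : f ∈ Aug K t) (b : Bool) : RQ [b] f ∈ SW K t := by
  induction hf using Submodule.span_induction with
  | zero => simp
  | add x y _ _ hx hy => rw [map_add]; exact add_mem hx hy
  | smul a x _ hx => rw [map_smul]; exact Submodule.smul_mem _ _ hx
  | mem x h =>
    obtain ⟨w, hw, rfl⟩ := h
    simp only [Set.mem_ofPred_eq] at hw
    rw [RQ_wb]
    split_ifs
    · refine Submodule.subset_span ⟨_, ?_, rfl⟩
      simp only [Set.mem_ofPred_eq, List.length_take, List.length_singleton]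
      omega
    · exact zero_mem _

lemma SW_mul {t : ℕ} {f g : FA K} (hg : g ∈ SW K t) {v : List Bool} (hv : v.length < t) (j : ℕ) :
    g * (f ^ j * wb K v) ∈ RF t f := by
  induction hg using Submodule.span_induction with
  | zero => simp
  | add x y _ _ hx hy => rw [add_mul]; exact add_mem hx hy
  | smul a x _ hx => rw [smul_mul_assoc]; exact Submodule.smul_mem _ _ hx
  | mem x h =>
    obtain ⟨w, hw, rfl⟩ := h
    rw [← mul_assoc]
    exact mem_RF hw hv j

lemma mul_SW {t : ℕ} {f g : FA K} (hg : g ∈ SW K t) {v : List Bool} (hv : v.length < t) (j : ℕ) :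
    wb K v * f ^ j * g ∈ RF t f := by
  induction hg using Submodule.span_induction with
  | zero => simp
  | add x y _ _ hx hy => rw [mul_add]; exact add_mem hx hy
  | smul a x _ hx => rw [mul_smul_comm]; exact Submodule.smul_mem _ _ hx
  | mem x h =>
    obtain ⟨w, hw, rfl⟩ := h
    exact mem_RF hv hw j

lemma wb_mem_RF {t : ℕ} {f : FA K} {w : List Bool} (hw : w.length < t) : wb K w ∈ RF t f := by
  have := mem_RF (K := K) (f := f) (u := []) (v := w) (t := t) (by simp; omega) hw 0
  simpa [wb_nil] using this

lemma LQ_RF_single {t : ℕ} {f : FA K} (hf : f ∈ Aug K t) (b : Bool) {x : FA K} (hx : x ∈ RF t f) :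
    LQ [b] x ∈ RF t f := by
  induction hx using Submodule.span_induction with
  | zero => simp
  | add x y _ _ hx hy => rw [map_add]; exact add_mem hx hy
  | smul a x _ hx => rw [map_smul]; exact Submodule.smul_mem _ _ hx
  | mem x h =>
    obtain ⟨u, v, j, hu, hv, rfl⟩ := h
    rcases u with _ | ⟨y, u⟩
    · rw [wb_nil, one_mul]
      rcases j with _ | j
      · rw [pow_zero, one_mul, LQ_wb]
        split_ifs
        · exact wb_mem_RF (by simp; omega)
        · exact zero_mem _
      · rw [pow_succ', mul_assoc, LQ_mul (by simpa using Aug_le_HG t hf)]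
        exact SW_mul (LQ_Aug hf b) hv j
    · have h1 : wb K (y :: u) = wb K [y] * wb K u := by rw [wb_mul]; rfl
      rw [h1, mul_assoc, mul_assoc, LQ_mul (wb_mem_HG (by simp)), LQ_wb]
      have hu' : u.length < t := by simp at hu; omega
      split_ifs
      · simpa [wb_nil, ← mul_assoc] using mem_RF hu' hv j
      · simp

lemma RQ_RF_single {t : ℕ} {f : FA K} (hf : f ∈ Aug K t) (b : Bool) {x : FA K} (hx : x ∈ RF t f) :
    RQ [b] x ∈ RF t f := by
  induction hx using Submodule.span_induction with
  | zero => simp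
  | add x y _ _ hx hy => rw [map_add]; exact add_mem hx hy
  | smul a x _ hx => rw [map_smul]; exact Submodule.smul_mem _ _ hx
  | mem x h =>
    obtain ⟨u, v, j, hu, hv, rfl⟩ := h
    rcases List.eq_nil_or_concat v with rfl | ⟨v, y, rfl⟩
    · rw [wb_nil, mul_one]
      rcases j with _ | j
      · rw [pow_zero, mul_one, RQ_wb]
        split_ifs
        · exact wb_mem_RF (by simp; omega)
        · exact zero_mem _
      · rw [pow_succ, ← mul_assoc, RQ_mul (by simpa using Aug_le_HG t hf)]
        exact mul_SW (RQ_Aug hf b) hu j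
    · have h1 : wb K (v ++ [y]) = wb K v * wb K [y] := by rw [wb_mul]
      rw [List.concat_eq_append, h1, ← mul_assoc, RQ_mul (wb_mem_HG (by simp)), RQ_wb]
      have hv' : v.length < t := by simp at hv; omega
      split_ifs
      · simpa [wb_nil] using mem_RF hu hv' j
      · simp

lemma LQ_nil (x : FA K) : LQ [] x = x := by
  induction x using wb_induction with
  | h0 => simp
  | hadd a b ha hb => rw [map_add, ha, hb]
  | hs a b ha => rw [map_smul, ha]
  | hw w => simp [LQ_wb]

lemma RQ_nil (x : FA K) : RQ [] x = x := by
  induction x using wb_induction with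
  | h0 => simp
  | hadd a b ha hb => rw [map_add, ha, hb]
  | hs a b ha => rw [map_smul, ha]
  | hw w => simp [RQ_wb]

lemma LQ_RF {t : ℕ} {f : FA K} (hf : f ∈ Aug K t) (p : List Bool) :
    ∀ {x : FA K}, x ∈ RF t f → LQ p x ∈ RF t f := by
  induction p with
  | nil => intro x hx; rwa [LQ_nil]
  | cons b p ih =>
    intro x hx
    rw [show b :: p = [b] ++ p from rfl, LQ_append]
    exact ih (LQ_RF_single hf b hx)

lemma RQ_RF {t : ℕ} {f : FA K} (hf : f ∈ Aug K t) (p : List Bool) :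
    ∀ {x : FA K}, x ∈ RF t f → RQ p x ∈ RF t f := by
  induction p with
  | nil => intro x hx; rwa [RQ_nil]
  | cons b p ih =>
    intro x hx
    rw [show b :: p = [b] ++ p from rfl, RQ_append]
    exact RQ_RF_single hf b (ih hx)

lemma Kills.pair_RF {V : Submodule K (FA K)} {t : ℕ} (hV : Kills V t) {f : FA K} (hf : f ∈ Aug K t)
    {x φ : FA K} (hx : x ∈ RF t f) (hφ : φ ∈ V) : pair x φ = 0 := by
  induction hx using Submodule.span_induction with
  | zero => simp
  | add x y _ _ hx hy => simp [hx, hy]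
  | smul a x _ hx => simp [hx]
  | mem x h =>
    obtain ⟨u, v, j, hu, hv, rfl⟩ := h
    exact hV φ hφ f hf u v hu hv j

/-- elements of `RF` are orthogonal to the ideal generated by `V` -/
lemma Kills.pair_ideal {V : Submodule K (FA K)} {t : ℕ} (hV : Kills V t) {f : FA K}
    (hf : f ∈ Aug K t) {x : FA K} (hx : x ∈ RF t f) (a b : FA K) {φ : FA K} (hφ : φ ∈ V) :
    pair x (a * φ * b) = 0 := by
  induction a using wb_induction with
  | h0 => simp
  | hadd a b ha hb => simp [ha, hb, add_mul]
  | hs a b ha => simp [ha]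
  | hw p =>
    induction b using wb_induction with
    | h0 => simp
    | hadd a b ha hb => simp [ha, hb, mul_add]
    | hs a b ha => simp [ha]
    | hw s =>
      rw [pair_comm, pair_mul_wb, pair_wb_mul, pair_comm]
      exact hV.pair_RF hf (LQ_RF hf p (RQ_RF hf s hx)) hφ

/-- all powers `f^N` with `N` large are orthogonal to the tower -/
lemma Tower.pow_orth {m : ℕ → ℕ} (T : Tower K m) (hm : ∀ k, 2 ≤ m k) {k t : ℕ} (ht : 1 ≤ t)
    (hk : Kills (T.V k) t) {f : FA K} (hf : f ∈ Aug K t) {N : ℕ} (hN : 2 * dg m k < N) (K' : ℕ)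
    {φ : FA K} (hφ : φ ∈ T.V K') (p s : List Bool) : pair (wb K p * f ^ N * wb K s) φ = 0 := by
  have hR : f ^ N ∈ RF t f := by
    simpa [wb_nil] using mem_RF (K := K) (f := f) (u := []) (v := []) (t := t) ht ht N
  rcases lt_or_ge (dg m K') (p.length + N + s.length) with h | h
  · refine pair_H_HG h ?_ (T.le_H K' hφ)
    exact HG_mul _ _ (Submodule.mul_mem_mul (HG_mul _ _ (Submodule.mul_mem_mul
        (wb_mem_HG le_rfl) (pow_mem_HG (Aug_le_HG t hf) N))) (wb_mem_HG le_rfl))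
  · rw [pair_mul_wb, pair_wb_mul]
    obtain ⟨n, hn⟩ : ∃ n, p.length + n + s.length = dg m K' :=
      ⟨dg m K' - p.length - s.length, by omega⟩
    obtain ⟨i', j', q, hi, hj, hq, hle⟩ := T.window hm hn (k := k) (by omega)
    have hmem := hle (LQ_mem_DL rfl (RQ_mem_DR rfl hφ))
    obtain ⟨q, rfl⟩ : ∃ q', q = q' + 1 := by
      rcases q with _ | q
      · exfalso
        omega
      · exact ⟨q, rfl⟩
    have hle2 : DL i' (T.V k) * T.V k ^ (q + 1) * DR j' (T.V k) ≤ LinearMap.ker (pair (f ^ N)) := by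
      rw [pow_succ, ← mul_assoc, mul_assoc, Submodule.mul_le]
      intro a _ c hc
      suffices hs : T.V k * DR j' (T.V k) ≤
          (LinearMap.ker (pair (f ^ N))).comap (LinearMap.mulLeft K a) from hs hc
      rw [Submodule.mul_le]
      intro v hv b _
      change pair (f ^ N) (a * (v * b)) = 0
      rw [← mul_assoc]
      exact hk.pair_ideal hf hR a b hv
    exact hle2 hmem

end Nil
end Kurosh


namespace Kurosh

section Quot

variable {K : Type u} [Field K]

lemma pair_wb_H {d : ℕ} {u : List Bool} (hu : u.length ≠ d) {x : FA K} (hx : x ∈ H K d) :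
    pair (wb K u) x = 0 := by
  induction hx using Submodule.span_induction with
  | zero => simp
  | add x y _ _ hx hy => simp [hx, hy]
  | smul a x _ hx => simp [hx]
  | mem x h =>
    obtain ⟨w, hw, rfl⟩ := h
    rw [pair_wb, if_neg]
    rintro rfl
    exact hu hw

namespace Tower

variable {m : ℕ → ℕ} (T : Tower K m)

/-- The defining ideal. -/
noncomputable def I : Ideal (FA K) where
  carrier := {r | ∀ k, ∀ φ ∈ T.V k, ∀ a b, pair (a * r * b) φ = 0}
  zero_mem' := by intro k φ _ a b; simp
  add_mem' := by
    intro x y hx hy k φ hφ a b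
    rw [mul_add, add_mul, map_add, LinearMap.add_apply, hx k φ hφ, hy k φ hφ, add_zero]
  smul_mem' := by
    intro c x hx k φ hφ a b
    rw [smul_eq_mul, ← mul_assoc]
    exact hx k φ hφ _ _

lemma mem_I {r : FA K} : r ∈ T.I ↔ ∀ k, ∀ φ ∈ T.V k, ∀ a b, pair (a * r * b) φ = 0 := Iff.rfl

instance : T.I.IsTwoSided := ⟨by
  intro x c hx k φ hφ a b
  rw [mul_assoc, mul_assoc, ← mul_assoc a]
  exact hx k φ hφ _ _⟩

lemma mem_I_of_words {r : FA K}
    (h : ∀ k, ∀ φ ∈ T.V k, ∀ p s, pair (wb K p * r * wb K s) φ = 0) : r ∈ T.I := by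
  intro k φ hφ a b
  induction a using wb_induction with
  | h0 => simp
  | hadd a b ha hb => simp [ha, hb, add_mul]
  | hs a b ha => simp [ha]
  | hw p =>
    induction b using wb_induction with
    | h0 => simp
    | hadd a b ha hb => simp [ha, hb, mul_add]
    | hs a b ha => simp [ha]
    | hw s => exact h k φ hφ p s

lemma pair_prj {d n : ℕ} (p s : List Bool) (r : FA K) {φ : FA K} (hφ : φ ∈ H K d) :
    pair (wb K p * prj n r * wb K s) φ =
      if p.length + n + s.length = d then pair (wb K p * r * wb K s) φ else 0 := by
  induction r using wb_induction with
  | h0 => simp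
  | hadd a b ha hb =>
    simp only [map_add, mul_add, add_mul, LinearMap.add_apply, ha, hb]
    split_ifs <;> simp
  | hs a b ha =>
    simp only [map_smul, mul_smul_comm, smul_mul_assoc, LinearMap.smul_apply, ha]
    split_ifs <;> simp
  | hw w =>
    rw [prj_wb]
    by_cases hw : w.length = n
    · rw [if_pos hw]
      split_ifs with h
      · rfl
      · rw [wb_mul, wb_mul]
        refine pair_wb_H ?_ hφ
        simp; omega
    · rw [if_neg hw]
      split_ifs with h
      · rw [wb_mul, wb_mul, pair_wb_H _ hφ]
        · simp
        · simp; omega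
      · simp

lemma prj_mem_I {r : FA K} (hr : r ∈ T.I) (n : ℕ) : prj n r ∈ T.I := by
  apply mem_I_of_words
  intro k φ hφ p s
  rw [pair_prj p s r (T.le_H k hφ)]
  split_ifs
  · exact hr k φ hφ _ _
  · rfl

lemma pow_mem_I (hm : ∀ k, 2 ≤ m k) {k t : ℕ} (ht : 1 ≤ t)
    (hk : Kills (T.V k) t) {f : FA K} (hf : f ∈ Aug K t) : f ^ (2 * dg m k + 1) ∈ T.I := by
  apply mem_I_of_words
  intro K' φ hφ p s
  exact T.pow_orth hm ht hk hf (by omega) K' hφ p s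

lemma pair_M {r : FA K} {n : ℕ} (hr : r ∈ H K n) (h : ∀ ψ ∈ T.M n, pair r ψ = 0) : r ∈ T.I := by
  apply mem_I_of_words
  intro k φ hφ p s
  by_cases hd : p.length + n + s.length = dg m k
  · rw [pair_mul_wb, pair_wb_mul]
    apply h
    have hle : DL p.length (DR s.length (T.V k)) ≤ T.M n :=
      le_iSup_of_le k (le_iSup_of_le p.length (le_iSup_of_le s.length (le_iSup_of_le hd le_rfl)))
    exact hle (LQ_mem_DL rfl (RQ_mem_DR rfl hφ))
  · have h1 := pair_prj (n := n) p s r (T.le_H k hφ)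
    have h2 : prj n r = r := by
      clear h h1
      induction hr using Submodule.span_induction with
      | zero => simp
      | add x y _ _ hx hy => rw [map_add, hx, hy]
      | smul a x _ hx => rw [map_smul, hx]
      | mem x h =>
        obtain ⟨w, hw, rfl⟩ := h
        simp only [Set.mem_ofPred_eq] at hw
        rw [prj_wb, if_pos hw]
    rw [h2, if_neg hd] at h1
    exact h1

end Tower

lemma prj_H {n j : ℕ} {x : FA K} (hx : x ∈ H K j) : prj n x = if j = n then x else 0 := by
  induction hx using Submodule.span_induction with
  | zero => simp
  | add x y _ _ hx hy => rw [map_add, hx, hy]; split_ifs <;> simp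
  | smul a x _ hx => rw [map_smul, hx]; split_ifs <;> simp
  | mem x h =>
    obtain ⟨w, hw, rfl⟩ := h
    simp only [Set.mem_ofPred_eq] at hw
    rw [prj_wb, hw]

lemma iSup_H : ⨆ n, H K n = ⊤ := by
  rw [eq_top_iff]
  intro x _
  induction x using wb_induction with
  | h0 => simp
  | hadd a b ha hb => exact add_mem (ha trivial) (hb trivial)
  | hs a b ha => exact Submodule.smul_mem _ _ (ha trivial)
  | hw w => exact le_iSup (H K) w.length (wb_mem_H rfl)

section B

variable {B : Type u} [Ring B] [Algebra K B] (π : FA K →ₐ[K] B)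

/-- the grading -/
noncomputable def gr (n : ℕ) : Submodule K B := (H K n).map π.toLinearMap

lemma iSup_gr (hπ : Function.Surjective π) : ⨆ n, gr π n = ⊤ := by
  unfold gr
  rw [← Submodule.map_iSup, iSup_H, Submodule.map_top, LinearMap.range_eq_top]
  exact hπ

lemma exists_prjB (hπ : Function.Surjective π)
    (hprj : ∀ r n, π r = 0 → π (prj n r) = 0) (n : ℕ) :
    ∃ q : B →ₗ[K] B, ∀ j, ∀ x ∈ gr π j, q x = if j = n then x else 0 := by
  have hker : LinearMap.ker π.toLinearMap ≤ LinearMap.ker (π.toLinearMap.comp (prj n)) := by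
    intro r hr
    exact hprj r n hr
  obtain ⟨g, hg⟩ := LinearMap.exists_rightInverse_of_surjective π.toLinearMap
    (LinearMap.range_eq_top.mpr hπ)
  refine ⟨(π.toLinearMap.comp (prj n)).comp g, ?_⟩
  rintro j _ ⟨x, hx, rfl⟩
  have h1 : g (π.toLinearMap x) - x ∈ LinearMap.ker π.toLinearMap := by
    rw [LinearMap.mem_ker, map_sub, sub_eq_zero]
    exact LinearMap.congr_fun hg (π.toLinearMap x)
  have h2 := hker h1
  rw [LinearMap.mem_ker, map_sub, sub_eq_zero] at h2
  rw [LinearMap.comp_apply, h2, LinearMap.comp_apply, prj_H hx]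
  split_ifs <;> simp

lemma indep_gr (hπ : Function.Surjective π)
    (hprj : ∀ r n, π r = 0 → π (prj n r) = 0) : iSupIndep (gr π) := by
  intro n
  rw [Submodule.disjoint_def]
  intro x hx hx'
  obtain ⟨q, hq⟩ := exists_prjB π hπ hprj n
  have h1 : q x = x := by rw [hq n x hx, if_pos rfl]
  have h2 : (⨆ j, ⨆ (_ : j ≠ n), gr π j) ≤ LinearMap.ker q := by
    refine iSup₂_le fun j hj y hy => ?_
    rw [LinearMap.mem_ker, hq j y hy, if_neg hj]
  rw [← h1]
  exact h2 hx'

lemma gr_gradedMonoid : SetLike.GradedMonoid (gr π) where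
  one_mem := ⟨1, one_mem_H, map_one π⟩
  mul_mem := by
    rintro i j _ _ ⟨x, hx, rfl⟩ ⟨y, hy, rfl⟩
    exact ⟨x * y, H_mul i j (Submodule.mul_mem_mul hx hy), map_mul π x y⟩

/-- graded structure -/
@[reducible]
noncomputable def gr_graded (hπ : Function.Surjective π)
    (hprj : ∀ r n, π r = 0 → π (prj n r) = 0) : GradedAlgebra (gr π) :=
  letI := gr_gradedMonoid π
  letI : DirectSum.Decomposition (gr π) :=
    DirectSum.IsInternal.chooseDecomposition (gr π)
      (DirectSum.isInternal_submodule_of_iSupIndep_of_iSup_eq_top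
        (indep_gr π hπ hprj) (iSup_gr π hπ))
  {}

lemma gr_zero : gr π 0 = 1 := by
  unfold gr
  rw [H_zero]
  exact Submodule.map_one π

lemma finiteType (hπ : Function.Surjective π) : Algebra.FiniteType K B := by
  have : Algebra.FiniteType K (FA K) := inferInstance
  exact this.of_surjective π hπ

lemma exists_Aug {x : B} (hx : x ∈ (⨆ n ≥ 1, gr π n : Submodule K B)) :
    ∃ t, ∃ f ∈ Aug K t, π f = x := by
  have hle : (⨆ n ≥ 1, gr π n : Submodule K B) ≤ (HG K 1).map π.toLinearMap := by
    refine iSup₂_le fun n hn => Submodule.map_mono (H_le_HG hn)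
  obtain ⟨f, hf, rfl⟩ := hle hx
  have : ∃ t, f ∈ Aug K t := by
    have hmono : ∀ s t, s ≤ t → Aug K s ≤ Aug K t := fun s t h =>
      Submodule.span_mono (Set.image_mono fun w hw => ⟨hw.1, hw.2.trans h⟩)
    clear hx
    induction hf using Submodule.span_induction with
    | zero => exact ⟨0, zero_mem _⟩
    | add x y _ _ hx hy =>
      obtain ⟨s, hs⟩ := hx
      obtain ⟨t, ht⟩ := hy
      exact ⟨max s t, add_mem (hmono _ _ (le_max_left _ _) hs) (hmono _ _ (le_max_right _ _) ht)⟩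
    | smul a x _ hx =>
      obtain ⟨s, hs⟩ := hx
      exact ⟨s, Submodule.smul_mem _ _ hs⟩
    | mem x h =>
      obtain ⟨w, hw, rfl⟩ := h
      exact ⟨w.length, Submodule.subset_span ⟨w, ⟨hw, le_rfl⟩, rfl⟩⟩
  obtain ⟨t, ht⟩ := this
  exact ⟨t, f, ht, rfl⟩

end B

lemma Aug_mono {s t : ℕ} (h : s ≤ t) : Aug K s ≤ Aug K t :=
  Submodule.span_mono (Set.image_mono fun _ hw => ⟨hw.1, hw.2.trans h⟩)

/-- abstract dimension bound by duality -/
lemma finrank_map_le {E F G : Type u} [AddCommGroup E] [Module K E] [AddCommGroup F] [Module K F]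
    [AddCommGroup G] [Module K G] (b : E →ₗ[K] G →ₗ[K] K) (p : E →ₗ[K] F) (P : Submodule K E)
    (M : Submodule K G) [FiniteDimensional K M]
    (h : ∀ x ∈ P, (∀ y ∈ M, b x y = 0) → p x = 0) :
    FiniteDimensional K (P.map p) ∧ finrank K (P.map p) ≤ finrank K M := by
  let L : P →ₗ[K] (M →ₗ[K] K) := (LinearMap.lcomp K K M.subtype).comp (b.comp P.subtype)
  have hL : ∀ (x : P) (y : M), L x y = b x y := fun x y => rfl
  clear_value L
  let q : P →ₗ[K] F := p.comp P.subtype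
  have hq : LinearMap.range q = P.map p := by
    rw [LinearMap.range_comp, Submodule.range_subtype]
  have hker : LinearMap.ker L ≤ LinearMap.ker q := by
    intro x hx
    refine h x x.2 fun y hy => ?_
    rw [← hL x ⟨y, hy⟩, LinearMap.mem_ker.mp hx]
    rfl
  obtain ⟨g, hg⟩ : ∃ g : (M →ₗ[K] K) →ₗ[K] F, g.comp L = q := by
    obtain ⟨r, hr⟩ := LinearMap.exists_leftInverse_of_injective
      ((LinearMap.ker L).liftQ L le_rfl) (Submodule.ker_liftQ_eq_bot _ _ _ le_rfl)
    refine ⟨((LinearMap.ker L).liftQ q hker).comp r, ?_⟩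
    ext x
    have h1 := LinearMap.congr_fun hr (Submodule.Quotient.mk x)
    simp only [LinearMap.comp_apply, Submodule.liftQ_apply, LinearMap.id_apply] at h1 ⊢
    rw [h1, Submodule.liftQ_apply]
  have hle : P.map p ≤ LinearMap.range g := by
    rw [← hq, ← hg]
    exact LinearMap.range_comp_le_range _ _
  have hd : finrank K (M →ₗ[K] K) = finrank K M := Subspace.dual_finrank_eq
  exact ⟨Submodule.finiteDimensional_of_le hle,
    (Submodule.finrank_mono hle).trans ((LinearMap.finrank_range_le g).trans hd.le)⟩

theorem main_alg {m : ℕ → ℕ} (T : Tower K m) (hm : ∀ k, 2 ≤ m k)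
    (hkill : ∀ t, ∃ k t', t ≤ t' ∧ Kills (T.V k) t') :
    ∃ (B : Type u) (_ : Ring B) (_ : Algebra K B) (𝒜 : ℕ → Submodule K B)
      (_ : GradedAlgebra 𝒜),
      Algebra.FiniteType K B ∧
      𝒜 0 = (1 : Submodule K B) ∧
      ¬ Module.Finite K B ∧
      (∀ x ∈ (⨆ n ≥ 1, 𝒜 n : Submodule K B), IsNilpotent x) ∧
      (∀ k n, dg m k < n → n ≤ dg m (k + 1) →
        FiniteDimensional K (𝒜 n) ∧ finrank K (𝒜 n) ≤ n ^ 2 * 4 ^ (sm m (k + 1) + 1)) := by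
  let π : FA K →ₐ[K] (FA K ⧸ T.I) := Ideal.Quotient.mkₐ K T.I
  have hπ : Function.Surjective π := Ideal.Quotient.mkₐ_surjective K T.I
  have hker : ∀ r, π r = 0 ↔ r ∈ T.I := fun r => Ideal.Quotient.eq_zero_iff_mem
  have hprj : ∀ r n, π r = 0 → π (prj n r) = 0 := fun r n h =>
    (hker _).mpr (T.prj_mem_I ((hker _).mp h) n)
  refine ⟨FA K ⧸ T.I, inferInstance, inferInstance, gr π, gr_graded π hπ hprj, finiteType π hπ,
    gr_zero π, ?_, ?_, ?_⟩
  · intro hfin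
    have h1 := (indep_gr π hπ hprj)
    have h2 := WellFoundedGT.finite_ne_bot_of_iSupIndep h1
    have h3 : Set.range (dg m) ⊆ {i | gr π i ≠ ⊥} := by
      rintro _ ⟨k, rfl⟩ hbot
      have hr := T.V_rank k
      have hne : T.V k ≠ ⊥ := by
        intro h
        rw [h] at hr
        simp at hr
      obtain ⟨φ, hφ, hφ0⟩ := Submodule.exists_mem_ne_zero_of_ne_bot hne
      apply hφ0
      apply pair_eq_zero_of_forall
      intro w
      by_cases hw : w.length = dg m k
      · have h4 : π (wb K w) ∈ gr π (dg m k) := ⟨wb K w, wb_mem_H hw, rfl⟩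
        rw [hbot, Submodule.mem_bot, hker] at h4
        simpa using h4 k φ hφ 1 1
      · exact pair_wb_H hw (T.le_H k hφ)
    exact Set.infinite_range_of_injective (Tower.dg_mono hm).injective (h2.subset h3)
  · intro x hx
    obtain ⟨t, f, hf, rfl⟩ := exists_Aug π hx
    obtain ⟨k, t', ht, hk⟩ := hkill (t + 1)
    refine ⟨2 * dg m k + 1, ?_⟩
    rw [← map_pow, hker]
    exact T.pow_mem_I hm (by omega) hk (Aug_mono (by omega) hf)
  · intro k n h1 h2
    obtain ⟨h3, h4⟩ := (T.M_gen hm h1 h2).finrank_le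
    obtain ⟨h5, h6⟩ := finrank_map_le pair π.toLinearMap (H K n) (T.M n)
      (fun x hx h => (hker x).mpr (T.pair_M hx h))
    exact ⟨h5, h6.trans h4⟩

end Quot
end Kurosh


namespace Kurosh

section Arith

open Classical in
/-- indicator of powers of two -/
noncomputable def s2 (i : ℕ) : ℕ := if ∃ j, i = 2 ^ j then i else 0

lemma s2_sum (k : ℕ) (hk : 1 ≤ k) : ∃ j, 2 ^ j ≤ k ∧ k < 2 ^ (j + 1) ∧
    ∑ i ∈ Finset.range (k + 1), s2 i + 1 = 2 ^ (j + 1) := by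
  induction k, hk using Nat.le_induction with
  | base =>
    refine ⟨0, by norm_num, by norm_num, ?_⟩
    have h0 : s2 0 = 0 := by simp [s2]
    have h1 : s2 1 = 1 := by
      rw [s2, if_pos ⟨0, rfl⟩]
    simp [Finset.sum_range_succ, h0, h1]
  | succ k hk ih =>
    obtain ⟨j, h1, h2, h3⟩ := ih
    rw [Finset.sum_range_succ]
    rcases (Nat.succ_le_of_lt h2).lt_or_eq with h | h
    · refine ⟨j, by omega, h, ?_⟩
      have : s2 (k + 1) = 0 := by
        rw [s2, if_neg]
        rintro ⟨i, hi⟩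
        rw [Nat.succ_eq_add_one, hi] at h
        have h4 : 2 ^ j < 2 ^ i := by omega
        have h5 := (Nat.pow_lt_pow_iff_right (by norm_num : 1 < 2)).mp h
        have h6 := (Nat.pow_lt_pow_iff_right (by norm_num : 1 < 2)).mp h4
        omega
      omega
    · rw [Nat.succ_eq_add_one] at h
      refine ⟨j + 1, by omega, ?_, ?_⟩
      · rw [h]; exact Nat.pow_lt_pow_right (by norm_num) (by omega)
      · have : s2 (k + 1) = k + 1 := by rw [s2, if_pos ⟨_, h⟩]
        rw [this, pow_succ 2 (j + 1)]
        omega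

lemma s2_sum_le (k : ℕ) : ∑ i ∈ Finset.range (k + 1), s2 i ≤ 2 * k := by
  rcases Nat.eq_zero_or_pos k with rfl | hk
  · simp [s2]
  · obtain ⟨j, h1, h2, h3⟩ := s2_sum k hk
    rw [pow_succ] at h3
    omega

open Classical in
/-- the multipliers -/
noncomputable def mm (θ : ℕ → ℕ) (k : ℕ) : ℕ := if ∃ j, k = 2 ^ j then 128 * 2 ^ θ k * k else 2

lemma mm_ge (θ : ℕ → ℕ) (k : ℕ) : 2 ≤ mm θ k := by
  unfold mm
  split_ifs with h
  · obtain ⟨j, rfl⟩ := h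
    have h1 : 1 ≤ 2 ^ θ (2 ^ j) * 2 ^ j := Nat.mul_pos (by positivity) (by positivity)
    rw [mul_assoc]
    omega
  · rfl

variable {θ : ℕ → ℕ}

lemma sm_le (hθ : Monotone θ) (k : ℕ) : sm (mm θ) (k + 1) ≤ 2 * (k + 1) + 128 * 2 ^ θ k * (2 * k) := by
  have h1 : ∀ i ∈ Finset.range (k + 1), mm θ i ≤ 2 + 128 * 2 ^ θ k * s2 i := by
    intro i hi
    have hi' : i ≤ k := by simpa [Nat.lt_succ_iff] using hi
    have := Nat.pow_le_pow_right (n := 2) (by norm_num) (hθ hi')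
    unfold mm s2
    split_ifs
    · have : 128 * 2 ^ θ i * i ≤ 128 * 2 ^ θ k * i := by gcongr
      omega
    · omega
  unfold sm
  refine (Finset.sum_le_sum h1).trans ?_
  rw [Finset.sum_add_distrib, ← Finset.mul_sum]
  have := s2_sum_le k
  have h3 : 128 * 2 ^ θ k * ∑ i ∈ Finset.range (k + 1), s2 i ≤ 128 * 2 ^ θ k * (2 * k) := by gcongr
  simp
  omega

lemma dg_le (hθ : ∀ k, θ k ≤ k) (k : ℕ) : dg (mm θ) (k + 1) ≤ 2 ^ (19 * k + 1) := by
  have h1 : ∀ i ∈ Finset.range (k + 1), mm θ i ≤ 2 ^ (1 + 9 * s2 i) := by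
    intro i hi
    unfold mm s2
    split_ifs with h
    · have hi1 : 1 ≤ i := by
        obtain ⟨j, rfl⟩ := h
        exact Nat.one_le_two_pow
      calc 128 * 2 ^ θ i * i ≤ 2 ^ 7 * 2 ^ i * 2 ^ i := by
            gcongr
            · norm_num
            · norm_num
            · exact hθ i
            · exact Nat.lt_two_pow_self.le
        _ = 2 ^ (7 + i + i) := by rw [pow_add, pow_add]
        _ ≤ _ := Nat.pow_le_pow_right (by norm_num) (by omega)
    · simp
  unfold dg
  refine (Finset.prod_le_prod' h1).trans ?_
  rw [Finset.prod_pow_eq_pow_sum]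
  refine Nat.pow_le_pow_right (by norm_num) ?_
  rw [Finset.sum_add_distrib, ← Finset.mul_sum]
  have := s2_sum_le k
  simp
  omega

lemma dg_ge (k : ℕ) : 2 ^ k ≤ dg (mm θ) k := by
  unfold dg
  have := Finset.prod_le_prod' (s := Finset.range k) (f := fun _ => 2) (g := mm θ)
    (fun i _ => mm_ge θ i)
  simpa using this

lemma cond (hθ : ∀ k, θ k ≤ k) (j : ℕ) :
    4 ^ θ (2 ^ j) * (dg (mm θ) (2 ^ j + 1) + 1) ^ 2 ^ (θ (2 ^ j) + 1) + 2 ≤ 2 ^ mm θ (2 ^ j) := by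
  have hm : mm θ (2 ^ j) = 128 * 2 ^ θ (2 ^ j) * 2 ^ j := by rw [mm, if_pos ⟨j, rfl⟩]
  have hk : 1 ≤ 2 ^ j := Nat.one_le_two_pow
  rw [hm]
  generalize 2 ^ j = k at hk
  have hd : dg (mm θ) (k + 1) + 1 ≤ 2 ^ (21 * k) := by
    have h1 := dg_le hθ k
    have h2 : 1 ≤ 2 ^ (19 * k + 1) := Nat.one_le_two_pow
    have h3 : 2 ^ (19 * k + 1 + 1) ≤ 2 ^ (21 * k) := Nat.pow_le_pow_right (by norm_num) (by omega)
    rw [pow_succ 2 (19 * k + 1)] at h3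
    omega
  generalize θ k = t at *
  have ht : t < 2 ^ t := Nat.lt_two_pow_self
  have htk : 2 ^ t ≤ 2 ^ t * k := Nat.le_mul_of_pos_right _ hk
  have h4 : 4 ^ t * (dg (mm θ) (k + 1) + 1) ^ 2 ^ (t + 1) ≤ 2 ^ (2 * t + 42 * (2 ^ t * k)) := by
    calc 4 ^ t * (dg (mm θ) (k + 1) + 1) ^ 2 ^ (t + 1)
        ≤ 4 ^ t * (2 ^ (21 * k)) ^ 2 ^ (t + 1) := by gcongr
      _ = 2 ^ (2 * t + 42 * (2 ^ t * k)) := by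
        rw [show (4 : ℕ) = 2 ^ 2 by norm_num, ← pow_mul, ← pow_mul, ← pow_add]
        congr 1
        rw [pow_succ]; ring
  have h5 : 2 ^ 1 ≤ 2 ^ (2 * t + 42 * (2 ^ t * k)) :=
    Nat.pow_le_pow_right (by norm_num) (by omega)
  have h6 : 2 ^ (2 * t + 42 * (2 ^ t * k) + 1) ≤ 2 ^ (128 * 2 ^ t * k) :=
    Nat.pow_le_pow_right (by norm_num) (by rw [mul_assoc]; omega)
  rw [pow_succ] at h6
  omega

lemma dim_le (hθ : Monotone θ) {k n : ℕ} (hn2 : 2 ≤ n) (hn : 2 ^ k ≤ n) :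
    n ^ 2 * 4 ^ (sm (mm θ) (k + 1) + 1) ≤ n ^ (12 + 512 * 2 ^ θ k) := by
  have h1 := sm_le hθ k
  have h2 : 4 ^ (sm (mm θ) (k + 1) + 1) ≤ (2 ^ k) ^ (4 + 512 * 2 ^ θ k) * 2 ^ 6 := by
    rw [show (4 : ℕ) = 2 ^ 2 by norm_num, ← pow_mul, ← pow_mul, ← pow_add]
    refine Nat.pow_le_pow_right (by norm_num) ?_
    have : k * (2 ^ 2 + 512 * 2 ^ θ k) + 6 = 2 * (2 * (k + 1) + 128 * 2 ^ θ k * (2 * k) + 1) := by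
      ring
    omega
  calc n ^ 2 * 4 ^ (sm (mm θ) (k + 1) + 1)
      ≤ n ^ 2 * ((2 ^ k) ^ (4 + 512 * 2 ^ θ k) * 2 ^ 6) := by gcongr
    _ ≤ n ^ 2 * (n ^ (4 + 512 * 2 ^ θ k) * n ^ 6) := by gcongr
    _ = _ := by rw [← pow_add, ← pow_add]; congr 1; ring

lemma exists_theta (β : ℕ → ℕ) (hβ : ∀ c : ℕ, ∃ N, ∀ n ≥ N, n ^ c < β n) :
    ∃ θ : ℕ → ℕ, Monotone θ ∧ (∀ k, θ k ≤ k) ∧ (∀ t, ∃ k0, ∀ k ≥ k0, t ≤ θ k) ∧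
      ∃ k0, ∀ k ≥ k0, ∀ n ≥ 2 ^ k, n ^ (12 + 512 * 2 ^ θ k) < β n := by
  classical
  let P : ℕ → ℕ → Prop := fun k a => ∀ n ≥ 2 ^ k, n ^ (12 + 512 * 2 ^ a) < β n
  have hP : ∀ k l a, k ≤ l → P k a → P l a := fun k l a h hk n hn =>
    hk n ((Nat.pow_le_pow_right (by norm_num) h).trans hn)
  have hex : ∀ a, ∃ k0, ∀ k ≥ k0, P k a ∧ a ≤ k := by
    intro a
    obtain ⟨N, hN⟩ := hβ (12 + 512 * 2 ^ a)
    refine ⟨max N a, fun k hk => ⟨fun n hn => hN n ?_, (le_max_right _ _).trans hk⟩⟩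
    have h1 : k < 2 ^ k := Nat.lt_two_pow_self
    have := (le_max_left N a).trans hk
    omega
  refine ⟨fun k => Nat.findGreatest (P k) k, ?_, fun k => Nat.findGreatest_le k, ?_, ?_⟩
  · intro k l h
    exact Nat.findGreatest_mono (fun a => hP k l a h) h
  · intro t
    obtain ⟨k0, h⟩ := hex t
    exact ⟨k0, fun k hk => Nat.le_findGreatest (h k hk).2 (h k hk).1⟩
  · obtain ⟨k0, h⟩ := hex 0
    refine ⟨k0, fun k hk => ?_⟩
    exact Nat.findGreatest_spec (P := P k) (h k hk).2 (h k hk).1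

end Arith
end Kurosh

theorem kurosh_subexponential {K : Type u} [Field K] (β : ℕ → ℕ)
    (hβ_mono : Monotone β)
    (hβ_superpoly : ∀ a : ℝ, 0 < a → ∀ᶠ n : ℕ in Filter.atTop, (n : ℝ) ^ a < (β n : ℝ))
    (hβ_subexp : ∀ C : ℝ, 1 < C → ∀ᶠ n : ℕ in Filter.atTop, (β n : ℝ) < C ^ n) :
    ∃ (B : Type u) (_ : Ring B) (_ : Algebra K B) (𝒜 : ℕ → Submodule K B)
      (_ : GradedAlgebra 𝒜),
      Algebra.FiniteType K B ∧
      𝒜 0 = (1 : Submodule K B) ∧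
      ¬ Module.Finite K B ∧
      (∀ x ∈ (⨆ n ≥ 1, 𝒜 n : Submodule K B), IsNilpotent x) ∧
      (∀ᶠ n : ℕ in Filter.atTop,
        FiniteDimensional K (𝒜 n) ∧ finrank K (𝒜 n) < β n) := by
  classical
  have hβ : ∀ c : ℕ, ∃ N, ∀ n ≥ N, n ^ c < β n := by
    intro c
    obtain ⟨N, hN⟩ := Filter.eventually_atTop.mp (hβ_superpoly (c + 1 : ℕ) (by positivity))
    refine ⟨max N 1, fun n hn => ?_⟩
    have h1 := hN n ((le_max_left _ _).trans hn)
    rw [Real.rpow_natCast] at h1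
    have h2 : n ^ (c + 1) < β n := by exact_mod_cast h1
    exact (Nat.pow_le_pow_right ((le_max_right _ _).trans hn) (Nat.le_succ c)).trans_lt h2
  obtain ⟨θ, hmono, hle, hunb, k0, hk0⟩ := Kurosh.exists_theta β hβ
  obtain ⟨T, hT⟩ := Kurosh.exists_tower K (Kurosh.mm θ) θ (Kurosh.mm_ge θ)
  obtain ⟨B, i1, i2, 𝒜, i3, h1, h2, h3, h4, h5⟩ := Kurosh.main_alg T (Kurosh.mm_ge θ) (by
    intro t
    obtain ⟨k1, hk1⟩ := hunb t
    refine ⟨2 ^ k1 + 1, θ (2 ^ k1), hk1 _ Nat.lt_two_pow_self.le, hT _ (Kurosh.cond hle k1)⟩)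
  refine ⟨B, i1, i2, 𝒜, i3, h1, h2, h3, h4, ?_⟩
  rw [Filter.eventually_atTop]
  refine ⟨Kurosh.dg (Kurosh.mm θ) (k0 + 1) + 1, fun n hn => ?_⟩
  have hdm := Kurosh.Tower.dg_mono (Kurosh.mm_ge θ)
  have hex : ∃ k, n ≤ Kurosh.dg (Kurosh.mm θ) k :=
    ⟨n, Nat.lt_two_pow_self.le.trans (Kurosh.dg_ge n)⟩
  obtain ⟨k, hk1, hk2⟩ : ∃ k, Kurosh.dg (Kurosh.mm θ) k < n ∧ n ≤ Kurosh.dg (Kurosh.mm θ) (k + 1) := by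
    have hs := Nat.find_spec hex
    have hmin := fun {i} => Nat.find_min hex (m := i)
    rcases hf : Nat.find hex with _ | k
    · rw [hf] at hs
      have := hdm.monotone (Nat.zero_le (k0 + 1))
      omega
    · rw [hf] at hs
      exact ⟨k, not_le.mp (hmin (by omega)), hs⟩
  have hkk : k0 ≤ k := by
    by_contra hc
    have := hdm.monotone (show k + 1 ≤ k0 + 1 by omega)
    omega
  obtain ⟨h6, h7⟩ := h5 k n hk1 hk2
  have hge : 2 ^ k ≤ n := (Kurosh.dg_ge k).trans hk1.le
  have hn2 : 2 ≤ n := by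
    have : 1 ≤ 2 ^ k := Nat.one_le_two_pow
    have := Kurosh.dg_ge (θ := θ) k
    omega
  exact ⟨h6, (h7.trans (Kurosh.dim_le hmono hn2 hge)).trans_lt (hk0 k hkk n hge)⟩
end

section
/- Let f, g : ℕ → ℕ satisfy: (i) f(i−1) < f(i) − g(i) − 1 for every natural number i ≥ 1, and (ii) for each natural number i there is given a subspace W_i ⊆ A(2^{f(i)}) of dimension at most 2^{2^{g(i)}} − 2. Let T = ∪_i {f(i)−g(i)−1, f(i)−g(i), …, f(i)−1}. Then for each natural number n there exist K-subspaces U(2^n) and V(2^n) of A(2^n) satisfying: (1) U(2^n) ⊕ V(2^n) = A(2^n) for every n; (2) dim V(2^n) = 2 whenever n ∉ T; (3) dim V(2^{n+j}) = 2^{2^j} whenever n = f(i)−g(i)−1 and 0 ≤ j ≤ g(i); (4) for each n, V(2^n) has a basis consisting of words in x and y; (5) W_i ⊆ U(2^{f(i)}) for each i; (6) A(2^n)U(2^n) + U(2^n)A(2^n) ⊆ U(2^{n+1}) for every n; (7) V(2^{n+1}) ⊆ V(2^n)V(2^n) for every n; (8) if n ∉ T then there is a word w ∈ V(2^n) such that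 wA(2^n) ⊆ U(2^{n+1}). -/
open Module

noncomputable section

/-- The free associative algebra `K⟨x,y⟩` on two generators. -/
abbrev FA (K : Type*) [Field K] := FreeAlgebra K (Fin 2)

/-- The element of `K⟨x,y⟩` given by a word (a list of letters). -/
def wordOf (K : Type*) [Field K] (l : List (Fin 2)) : FA K :=
  (l.map (FreeAlgebra.ι K)).prod

/-- `a` is a word of length `n` over the two generators. -/
def IsWord (K : Type*) [Field K] (n : ℕ) (a : FA K) : Prop :=
  ∃ l : List (Fin 2), l.length = n ∧ a = wordOf K l

/-- `A(n)`: the span of all words of length `n`. -/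
def Aspan (K : Type*) [Field K] (n : ℕ) : Submodule K (FA K) :=
  Submodule.span K {a | IsWord K n a}

/-- The set `T = ∪_{i ≥ 1} {f(i)-g(i)-1, …, f(i)-1}`. -/
def Tset (f g : ℕ → ℕ) : Set ℕ :=
  {n | ∃ i, 1 ≤ i ∧ f i ≤ n + g i + 1 ∧ n + 1 ≤ f i}

section helpers

variable {K : Type*} [Field K]

/-- Span of a finite set of words. -/
def Vs (K : Type*) [Field K] (S : Finset (List (Fin 2))) : Submodule K (FA K) :=
  Submodule.span K (wordOf K '' (S : Set (List (Fin 2))))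

/-- Concatenations of words of a finite set. -/
def cc (S S' : Finset (List (Fin 2))) : Finset (List (Fin 2)) :=
  Finset.image₂ (fun a b => a ++ b) S S'

theorem wordOf_append (l m : List (Fin 2)) :
    wordOf K (l ++ m) = wordOf K l * wordOf K m := by
  simp [wordOf]

theorem basis_apply (l : List (Fin 2)) :
    FreeAlgebra.basisFreeMonoid K (Fin 2) (FreeMonoid.ofList l) = wordOf K l := by
  simp [FreeAlgebra.basisFreeMonoid, wordOf, FreeAlgebra.equivMonoidAlgebraFreeMonoid,
    MonoidAlgebra.lift_apply, FreeMonoid.lift_apply]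

theorem wordOf_li : LinearIndependent K (wordOf K) := by
  have h := (FreeAlgebra.basisFreeMonoid K (Fin 2)).linearIndependent
  have h2 := h.comp FreeMonoid.ofList FreeMonoid.ofList.injective
  have : (FreeAlgebra.basisFreeMonoid K (Fin 2)) ∘ FreeMonoid.ofList = wordOf K := by
    funext l
    exact basis_apply l
  rwa [this] at h2

theorem exists_map (φ : List (Fin 2) → FA K) :
    ∃ P : FA K →ₗ[K] FA K, ∀ l, P (wordOf K l) = φ l := by
  refine ⟨(FreeAlgebra.basisFreeMonoid K (Fin 2)).constr K (fun m => φ (FreeMonoid.toList m)), ?_⟩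
  intro l
  rw [← basis_apply, Module.Basis.constr_basis]
  simp

theorem Aspan_eq (n : ℕ) : Aspan K n =
    Submodule.span K (wordOf K '' {l | l.length = n}) := by
  unfold Aspan
  congr 1
  ext a
  simp only [IsWord, Set.mem_ofPred_eq, Set.mem_image]
  constructor
  · rintro ⟨l, h, rfl⟩; exact ⟨l, h, rfl⟩
  · rintro ⟨l, h, rfl⟩; exact ⟨l, h, rfl⟩

theorem Aspan_fd (n : ℕ) : FiniteDimensional K (Aspan K n) := by
  rw [Aspan_eq]
  exact FiniteDimensional.span_of_finite K ((List.finite_length_eq (Fin 2) n).image _)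

theorem Vs_fd (S : Finset (List (Fin 2))) : FiniteDimensional K (Vs K S) :=
  FiniteDimensional.span_of_finite K (S.finite_toSet.image _)

theorem word_mem_Aspan (l : List (Fin 2)) : wordOf K l ∈ Aspan K l.length :=
  Submodule.subset_span ⟨l, rfl, rfl⟩

theorem word_mem_Vs {S : Finset (List (Fin 2))} {l : List (Fin 2)} (h : l ∈ S) :
    wordOf K l ∈ Vs K S :=
  Submodule.subset_span ⟨l, h, rfl⟩

theorem Vs_le {S : Finset (List (Fin 2))} {n : ℕ} (h : ∀ l ∈ S, l.length = n) :
    Vs K S ≤ Aspan K n := by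
  refine Submodule.span_le.2 ?_
  rintro _ ⟨l, hl, rfl⟩
  exact h l hl ▸ word_mem_Aspan l

theorem Vs_mono {S S' : Finset (List (Fin 2))} (h : S ⊆ S') : Vs K S ≤ Vs K S' :=
  Submodule.span_mono (Set.image_mono (by exact_mod_cast h))

theorem Vs_union (S S' : Finset (List (Fin 2))) : Vs K (S ∪ S') = Vs K S ⊔ Vs K S' := by
  simp [Vs, Set.image_union, Submodule.span_union]

theorem Vs_disjoint {S S' : Finset (List (Fin 2))} (h : Disjoint S S') :
    Disjoint (Vs K S) (Vs K S') :=
  wordOf_li.disjoint_span_image (by exact_mod_cast h)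

theorem Vs_finrank (S : Finset (List (Fin 2))) : finrank K (Vs K S) = S.card := by
  have h := (wordOf_li (K := K)).comp ((↑) : S → List (Fin 2)) Subtype.val_injective
  have := finrank_span_eq_card h
  rw [Fintype.card_coe] at this
  rw [← this, Vs, Set.range_comp, Subtype.range_coe_subtype]
  rfl

theorem Vs_mul (S S' : Finset (List (Fin 2))) : Vs K S * Vs K S' = Vs K (cc S S') := by
  unfold Vs cc
  rw [Submodule.span_mul_span]
  congr 1
  ext a
  simp only [Set.mem_mul, Set.mem_image, Finset.coe_image₂, Set.mem_image2]
  constructor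
  · rintro ⟨_, ⟨l, hl, rfl⟩, _, ⟨m, hm, rfl⟩, rfl⟩
    exact ⟨_, ⟨l, hl, m, hm, rfl⟩, wordOf_append _ _⟩
  · rintro ⟨_, ⟨l, hl, m, hm, rfl⟩, rfl⟩
    exact ⟨_, ⟨l, hl, rfl⟩, _, ⟨m, hm, rfl⟩, (wordOf_append _ _).symm⟩

theorem Aspan_mul (m n : ℕ) : Aspan K m * Aspan K n = Aspan K (m + n) := by
  simp only [Aspan_eq]
  rw [Submodule.span_mul_span]
  congr 1
  ext a
  simp only [Set.mem_mul, Set.mem_image, Set.mem_ofPred_eq]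
  constructor
  · rintro ⟨_, ⟨l, hl, rfl⟩, _, ⟨m, hm, rfl⟩, rfl⟩
    exact ⟨_, by simp [hl, hm], wordOf_append _ _⟩
  · rintro ⟨l, hl, rfl⟩
    refine ⟨_, ⟨l.take m, by simp [hl], rfl⟩, _, ⟨l.drop m, by simp [hl], rfl⟩, ?_⟩
    rw [← wordOf_append, List.take_append_drop]

theorem cc_length {S S' : Finset (List (Fin 2))} {m n : ℕ} (h : ∀ l ∈ S, l.length = m)
    (h' : ∀ l ∈ S', l.length = n) : ∀ l ∈ cc S S', l.length = m + n := by
  intro l hl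
  obtain ⟨a, ha, b, hb, rfl⟩ := Finset.mem_image₂.1 hl
  simp [h a ha, h' b hb]

theorem cc_card {S S' : Finset (List (Fin 2))} {m : ℕ} (h : ∀ l ∈ S, l.length = m) :
    (cc S S').card = S.card * S'.card := by
  refine Finset.card_image₂_iff.2 ?_
  rintro ⟨a, b⟩ ⟨ha, hb⟩ ⟨c, d⟩ ⟨hc, hd⟩ hab
  have := List.append_inj hab ((h a ha).trans (h c hc).symm)
  exact Prod.ext this.1 this.2

theorem exists_subset (N : Submodule K (FA K)) (Q : Finset (List (Fin 2))) :
    ∃ Q' ⊆ Q, Disjoint N (Vs K Q') ∧ N ⊔ Vs K Q' = N ⊔ Vs K Q := by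
  classical
  induction Q using Finset.induction_on with
  | empty => exact ⟨∅, subset_rfl, by simp [Vs], rfl⟩
  | insert q Q hq ih =>
    obtain ⟨Q', hQ', hd, hs⟩ := ih
    have e1 : Vs K (insert q Q) = Vs K Q ⊔ Vs K {q} := by
      rw [← Vs_union, Finset.union_comm]; rfl
    by_cases hmem : wordOf K q ∈ N ⊔ Vs K Q'
    · refine ⟨Q', hQ'.trans (Finset.subset_insert _ _), hd, ?_⟩
      rw [e1, ← sup_assoc, ← hs, eq_comm, sup_eq_left]
      simpa [Vs] using hmem
    · refine ⟨Q' ∪ {q}, ?_, ?_, ?_⟩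
      · intro x hx
        rcases Finset.mem_union.1 hx with hx | hx
        · exact Finset.mem_insert_of_mem (hQ' hx)
        · rw [Finset.mem_singleton.1 hx]; exact Finset.mem_insert_self _ _
      · rw [Vs_union]
        refine Disjoint.disjoint_sup_right_of_disjoint_sup_left hd ?_
        have : Vs K {q} = Submodule.span K {wordOf K q} := by simp [Vs]
        rw [this]
        rw [Submodule.disjoint_span_singleton]
        intro h
        exact absurd h hmem
      · rw [Vs_union, ← sup_assoc, hs, sup_assoc, ← e1]

theorem mul_disjoint {N : ℕ} {U V : Submodule K (FA K)} (hU : U ≤ Aspan K N)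
    (hV : V ≤ Aspan K N) (hd : Disjoint U V) :
    Disjoint (Aspan K N * U ⊔ U * Aspan K N) (V * V) := by
  obtain ⟨C, hVC, hC⟩ := hd.symm.exists_isCompl
  let p := Submodule.projection C U hC
  have pU : ∀ x ∈ U, p x = 0 := fun x hx => (Submodule.projection_apply_eq_zero_iff hC).2 hx
  have pV : ∀ x ∈ V, p x = x := fun x hx =>
    Submodule.projection_apply_of_mem_left hC (hVC hx)
  obtain ⟨P, hP⟩ := exists_map (K := K)
    (fun l => p (wordOf K (l.take N)) * p (wordOf K (l.drop N)))
  have hmul : ∀ a ∈ Aspan K N, ∀ b ∈ Aspan K N, P (a * b) = p a * p b := by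
    intro a ha b hb
    unfold Aspan at ha hb
    induction ha, hb using Submodule.span_induction₂ with
    | mem_mem x y hx hy =>
      obtain ⟨l, hl, rfl⟩ := hx
      obtain ⟨m, hm, rfl⟩ := hy
      rw [← wordOf_append, hP]
      simp [← hl]
    | zero_left y hy => simp
    | zero_right x hx => simp
    | add_left x y z _ _ _ h1 h2 => simp [add_mul, h1, h2]
    | add_right x y z _ _ _ h1 h2 => simp [mul_add, h1, h2]
    | smul_left r x y _ _ h => simp [h]
    | smul_right r x y _ _ h => simp [h]
  have hk : Aspan K N * U ⊔ U * Aspan K N ≤ LinearMap.ker P := by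
    refine sup_le (Submodule.mul_le.2 ?_) (Submodule.mul_le.2 ?_)
    · intro a ha b hb
      rw [LinearMap.mem_ker, hmul a ha b (hU hb), pU b hb, mul_zero]
    · intro a ha b hb
      rw [LinearMap.mem_ker, hmul a (hU ha) b hb, pU a ha, zero_mul]
  have hid : V * V ≤ LinearMap.ker (P - LinearMap.id) := by
    refine Submodule.mul_le.2 ?_
    intro a ha b hb
    simp [hmul a (hV ha) b (hV hb), pV a ha, pV b hb]
  rw [Submodule.disjoint_def]
  intro x h1 h2
  have h1 := hk h1
  have h2 := hid h2
  simp only [LinearMap.mem_ker, LinearMap.sub_apply, LinearMap.id_apply] at h1 h2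
  rw [h1] at h2
  simpa using h2

theorem word_mul_sup {N : ℕ} {U V : Submodule K (FA K)} (hs : U ⊔ V = Aspan K N) :
    (Aspan K N * U ⊔ U * Aspan K N) ⊔ V * V = Aspan K (N + N) := by
  have hU : U ≤ Aspan K N := hs ▸ le_sup_left
  have hV : V ≤ Aspan K N := hs ▸ le_sup_right
  rw [← Aspan_mul]
  apply le_antisymm
  · exact sup_le (sup_le (mul_le_mul' le_rfl hU) (mul_le_mul' hU le_rfl))
      (mul_le_mul' hV hV)
  · have : Aspan K N * Aspan K N = Aspan K N * U ⊔ Aspan K N * V := by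
      rw [← Submodule.mul_sup, hs]
    rw [this]
    refine sup_le (le_sup_left.trans le_sup_left) ?_
    have : Aspan K N * V = U * V ⊔ V * V := by
      rw [← Submodule.sup_mul, hs]
    rw [this]
    refine sup_le ?_ le_sup_right
    exact ((mul_le_mul' le_rfl hV).trans le_sup_right).trans le_sup_left

theorem core {N : ℕ} {U : Submodule K (FA K)} {S : Finset (List (Fin 2))}
    (hS : ∀ l ∈ S, l.length = N) (hd : Disjoint U (Vs K S)) (hs : U ⊔ Vs K S = Aspan K N)
    {Q : Finset (List (Fin 2))} (hQ : Q ⊆ cc S S) {W : Submodule K (FA K)}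
    (hW : W ≤ Aspan K (N + N)) {e : ℕ} (he : finrank K W + e ≤ Q.card) :
    ∃ (U' : Submodule K (FA K)) (S' : Finset (List (Fin 2))), S' ⊆ Q ∧ S'.card = e ∧
      Disjoint U' (Vs K S') ∧ U' ⊔ Vs K S' = Aspan K (N + N) ∧ W ≤ U' ∧
      Aspan K N * U ⊔ U * Aspan K N ≤ U' ∧ Vs K (cc S S \ Q) ≤ U' := by
  classical
  have hU : U ≤ Aspan K N := hs ▸ le_sup_left
  have hV : Vs K S ≤ Aspan K N := hs ▸ le_sup_right
  have hMd := mul_disjoint hU hV hd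
  have hMs := word_mul_sup hs
  rw [Vs_mul] at hMd hMs
  set M := Aspan K N * U ⊔ U * Aspan K N with hM
  have fdA : FiniteDimensional K (Aspan K (N + N)) := Aspan_fd _
  have fdM : FiniteDimensional K M :=
    Submodule.finiteDimensional_of_le (hMs ▸ le_sup_left : M ≤ Aspan K (N + N))
  have fdW : FiniteDimensional K W := Submodule.finiteDimensional_of_le hW
  have fdV : ∀ S, FiniteDimensional K (Vs K S) := Vs_fd
  have hunion : Vs K (cc S S) = Vs K (cc S S \ Q) ⊔ Vs K Q := by
    rw [← Vs_union, Finset.sdiff_union_of_subset hQ]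
  set X := (M ⊔ Vs K (cc S S \ Q)) ⊔ W with hX
  have hXA : X ⊔ Vs K Q = Aspan K (N + N) := by
    apply le_antisymm
    · rw [← hMs, hX]
      refine sup_le (sup_le (sup_le le_sup_left ?_) ?_) ?_
      · exact (Vs_mono Finset.sdiff_subset).trans le_sup_right
      · rw [hMs]; exact hW
      · exact (Vs_mono hQ).trans le_sup_right
    · rw [← hMs, hunion, ← sup_assoc]
      exact sup_le_sup_right le_sup_left _
  obtain ⟨Q', hQ', hd', hs'⟩ := exists_subset X Q
  rw [hXA] at hs'
  have c1 : finrank K (Aspan K (N + N)) = finrank K M + (cc S S).card := by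
    rw [← hMs, ← Vs_finrank (K := K), ← Submodule.finrank_sup_add_finrank_inf_eq,
      hMd.eq_bot, finrank_bot, add_zero]
  have c2 : finrank K (Aspan K (N + N)) ≤ finrank K X + Q'.card := by
    rw [← hs', ← Vs_finrank (K := K)]
    exact Submodule.finrank_add_le_finrank_add_finrank _ _
  have c3 : finrank K X ≤ finrank K M + (cc S S \ Q).card + finrank K W := by
    refine (Submodule.finrank_add_le_finrank_add_finrank _ _).trans ?_
    refine Nat.add_le_add_right ?_ _
    rw [← Vs_finrank (K := K)]
    exact Submodule.finrank_add_le_finrank_add_finrank _ _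
  have c4 := Finset.card_sdiff_add_card_eq_card hQ
  obtain ⟨S', hS', hcard⟩ := Finset.exists_subset_card_eq (show e ≤ Q'.card by omega)
  have hu : Vs K Q' = Vs K (Q' \ S') ⊔ Vs K S' := by
    rw [← Vs_union, Finset.sdiff_union_of_subset hS']
  refine ⟨X ⊔ Vs K (Q' \ S'), S', hS'.trans hQ', hcard, ?_, ?_, ?_, ?_, ?_⟩
  · refine Disjoint.disjoint_sup_left_of_disjoint_sup_right
      (Vs_disjoint Finset.sdiff_disjoint) ?_
    rw [← hu]; exact hd'
  · rw [sup_assoc, ← hu, hs']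
  · exact le_sup_right.trans le_sup_left
  · exact (le_sup_left.trans le_sup_left).trans le_sup_left
  · exact (le_sup_right.trans le_sup_left).trans le_sup_left


/-- Admissible cardinality of the word basis at level `n`. -/
def CardOK (f g : ℕ → ℕ) (n c : ℕ) : Prop :=
  (n ∉ Tset f g → c = 2) ∧
    ∀ i j m, 1 ≤ i → m + g i + 1 = f i → j ≤ g i → n = m + j → c = 2 ^ 2 ^ j

/-- The invariant kept along the construction. -/
def Good (K : Type*) [Field K] (f g : ℕ → ℕ) (n : ℕ)
    (x : Submodule K (FA K) × Finset (List (Fin 2))) : Prop :=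
  (∀ l ∈ x.2, l.length = 2 ^ n) ∧ Disjoint x.1 (Vs K x.2) ∧
    x.1 ⊔ Vs K x.2 = Aspan K (2 ^ n) ∧ CardOK f g n x.2.card

/-- The relation between two consecutive levels. -/
def StepRel (f g : ℕ → ℕ) (W : ℕ → Submodule K (FA K)) (n : ℕ)
    (x y : Submodule K (FA K) × Finset (List (Fin 2))) : Prop :=
  (∀ i, 1 ≤ i → f i = n + 1 → W i ≤ y.1) ∧
    Aspan K (2 ^ n) * x.1 ⊔ x.1 * Aspan K (2 ^ n) ≤ y.1 ∧ y.2 ⊆ cc x.2 x.2 ∧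
    (n ∉ Tset f g → ∃ l ∈ x.2, ∀ a ∈ Aspan K (2 ^ n), wordOf K l * a ∈ y.1)

theorem f_lt {f g : ℕ → ℕ} (hf : ∀ i, 1 ≤ i → f (i - 1) + g i + 1 < f i) {i j : ℕ}
    (h : i < j) : f i + g j + 1 < f j := by
  have hm : StrictMono f := strictMono_nat_of_lt_succ (fun n => by
    have := hf (n + 1) (by omega)
    simp only [Nat.add_sub_cancel] at this
    omega)
  have h1 := hf j (by omega)
  have h2 : f i ≤ f (j - 1) := hm.monotone (by omega)
  omega

theorem idx_unique {f g : ℕ → ℕ} (hf : ∀ i, 1 ≤ i → f (i - 1) + g i + 1 < f i) {i j n : ℕ}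
    (h1 : f i ≤ n + g i + 1) (h2 : n ≤ f i) (h3 : f j ≤ n + g j + 1) (h4 : n ≤ f j) :
    i = j := by
  rcases lt_trichotomy i j with h | h | h
  · have := f_lt hf h; omega
  · exact h
  · have := f_lt hf h; omega

theorem step {f g : ℕ → ℕ} (hf : ∀ i, 1 ≤ i → f (i - 1) + g i + 1 < f i)
    {W : ℕ → Submodule K (FA K)}
    (hW_le : ∀ i, 1 ≤ i → W i ≤ Aspan K (2 ^ f i))
    (hW_dim : ∀ i, 1 ≤ i → finrank K (W i) ≤ 2 ^ 2 ^ g i - 2) (n : ℕ)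
    (x : Submodule K (FA K) × Finset (List (Fin 2))) (hx : Good K f g n x) :
    ∃ y, Good K f g (n + 1) y ∧ StepRel f g W n x y := by
  classical
  obtain ⟨U, S⟩ := x
  obtain ⟨hS, hd, hs, hc1, hc2⟩ := hx
  simp only at hS hd hs hc1 hc2
  have hpow : 2 ^ n + 2 ^ n = 2 ^ (n + 1) := by ring
  have hlen : ∀ l ∈ cc S S, l.length = 2 ^ (n + 1) := hpow ▸ cc_length hS hS
  by_cases hn : n ∈ Tset f g
  · obtain ⟨i, hi, hi1, hi2⟩ := hn
    obtain ⟨m, hm⟩ : ∃ m, m + g i + 1 = f i := ⟨f i - g i - 1, by have := hf i hi; omega⟩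
    obtain ⟨j, hj⟩ : ∃ j, n = m + j := ⟨n - m, by omega⟩
    have hjg : j ≤ g i := by omega
    have hcard : S.card = 2 ^ 2 ^ j := hc2 i j m hi hm hjg hj
    have hSS := cc_card (S' := S) hS
    rcases Nat.lt_or_ge j (g i) with hlt | hge
    · obtain ⟨U', S', h1, h2, h3, h4, h5, h6, h7⟩ := core hS hd hs (Finset.Subset.refl (cc S S))
        (W := ⊥) bot_le (e := 2 ^ 2 ^ (j + 1)) (by
          rw [hSS, hcard, finrank_bot, zero_add, pow_succ 2 j, pow_mul, sq])
      refine ⟨(U', S'), ⟨fun l hl => hlen l (h1 hl), h3, hpow ▸ h4, ?_, ?_⟩, ?_, h6, h1, ?_⟩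
      · intro hn1
        exact absurd ⟨i, hi, by omega, by omega⟩ hn1
      · intro i' j' m' hi' hm' hj' hn'
        have : i' = i := idx_unique hf (n := n + 1) (by omega) (by omega) (by omega) (by omega)
        subst this
        have : j' = j + 1 := by omega
        rw [this]; exact h2
      · intro i' hi' hfi
        have : i' = i := idx_unique hf (n := n + 1) (by omega) (by omega) (by omega) (by omega)
        subst this
        omega
      · intro hn
        exact absurd ⟨i, hi, hi1, hi2⟩ hn
    · have hfi : f i = n + 1 := by omega
      have hj : j = g i := by omega
      obtain ⟨U', S', h1, h2, h3, h4, h5, h6, h7⟩ := core hS hd hs (Finset.Subset.refl (cc S S))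
        (W := W i) (by rw [hpow, ← hfi]; exact hW_le i hi) (e := 2) (by
          have h := hW_dim i hi
          rw [hSS, hcard, hj]
          have h2 : 2 ≤ 2 ^ 2 ^ g i := by
            calc 2 = 2 ^ 1 := rfl
              _ ≤ 2 ^ 2 ^ g i := Nat.pow_le_pow_right (by norm_num) Nat.one_le_two_pow
          have h3 := Nat.le_mul_self (2 ^ 2 ^ g i)
          omega)
      refine ⟨(U', S'), ⟨fun l hl => hlen l (h1 hl), h3, hpow ▸ h4, fun _ => h2, ?_⟩,
        ?_, h6, h1, ?_⟩
      · intro i' j' m' hi' hm' hj' hn'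
        have : i' = i := idx_unique hf (n := n + 1) (by omega) (by omega) (by omega) (by omega)
        subst this
        omega
      · intro i' hi' hfi
        have : i' = i := idx_unique hf (n := n + 1) (by omega) (by omega) (by omega) (by omega)
        subst this
        exact h5
      · intro hn
        exact absurd ⟨i, hi, hi1, hi2⟩ hn
  · have hcard := hc1 hn
    obtain ⟨l1, l2, hne, hSeq⟩ := Finset.card_eq_two.1 hcard
    have hl1 : l1 ∈ S := by simp [hSeq]
    have hl2 : l2 ∈ S := by simp [hSeq]
    have hQ : cc {l2} S ⊆ cc S S := Finset.image₂_subset_right (by simpa using hl2)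
    have hQc : (cc {l2} S).card = 2 := by
      rw [cc_card (m := 2 ^ n) (by simpa using hS l2 hl2), hcard]; rfl
    obtain ⟨U', S', h1, h2, h3, h4, h5, h6, h7⟩ := core hS hd hs hQ
        (W := ⊥) bot_le (e := 2) (by rw [finrank_bot, hQc])
    have h1' := h1.trans hQ
    refine ⟨(U', S'), ⟨fun l hl => hlen l (h1' hl), h3, hpow ▸ h4, fun _ => h2, ?_⟩,
        ?_, h6, h1', ?_⟩
    · intro i' j' m' hi' hm' hj' hn'
      rcases Nat.eq_zero_or_pos j' with h0 | h0
      · subst h0; simpa using h2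
      · exact absurd ⟨i', hi', by omega, by omega⟩ hn
    · intro i' hi' hfi
      exact absurd ⟨i', hi', by omega, by omega⟩ hn
    · intro _
      refine ⟨l1, hl1, ?_⟩
      intro a ha
      rw [← hs] at ha
      obtain ⟨u, hu, v, hv, rfl⟩ := Submodule.mem_sup.1 ha
      rw [mul_add]
      refine U'.add_mem (h6 (Submodule.mem_sup_left (Submodule.mul_mem_mul ?_ hu))) (h7 ?_)
      · exact hS l1 hl1 ▸ word_mem_Aspan l1
      · have hsub : cc {l1} S ⊆ cc S S \ cc {l2} S := by
          intro l hl
          obtain ⟨a, ha, b, hb, rfl⟩ := Finset.mem_image₂.1 hl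
          rw [Finset.mem_singleton] at ha
          subst ha
          refine Finset.mem_sdiff.2 ⟨Finset.mem_image₂_of_mem hl1 hb, ?_⟩
          intro hl'
          obtain ⟨c, hc, d, hd, hcd⟩ := Finset.mem_image₂.1 hl'
          rw [Finset.mem_singleton] at hc
          subst hc
          exact hne (List.append_inj hcd ((hS _ hl2).trans (hS _ hl1).symm)).1.symm
        refine Vs_mono hsub ?_
        rw [← Vs_mul]
        exact Submodule.mul_mem_mul (word_mem_Vs (Finset.mem_singleton_self _)) hv

theorem base {f g : ℕ → ℕ} (hf : ∀ i, 1 ≤ i → f (i - 1) + g i + 1 < f i) :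
    Good K f g 0 (⊥, {[0], [1]}) := by
  refine ⟨by simp, disjoint_bot_left, ?_, fun _ => rfl, ?_⟩
  · simp only [bot_sup_eq, pow_zero]
    apply le_antisymm
    · exact Vs_le (by simp)
    · refine Submodule.span_le.2 ?_
      rintro _ ⟨l, hl, rfl⟩
      obtain ⟨a, rfl⟩ := List.length_eq_one_iff.1 hl
      refine word_mem_Vs ?_
      fin_cases a <;> simp
  · intro i j m hi hm hj h0
    have := hf i hi
    omega

end helpers

/-- **Proposition 3.1.** Given `f, g : ℕ → ℕ` with `f(i-1) < f(i) - g(i) - 1` for all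
`i ≥ 1`, and subspaces `W_i ⊆ A(2^{f(i)})` of dimension at most `2^{2^{g(i)}} - 2`,
there exist subspaces `U(2^n), V(2^n)` of `A(2^n)` satisfying conditions (1)–(8). -/
theorem proposition_3_1 {K : Type*} [Field K] (f g : ℕ → ℕ)
    (hf : ∀ i, 1 ≤ i → f (i - 1) + g i + 1 < f i)
    (W : ℕ → Submodule K (FA K))
    (hW_le : ∀ i, 1 ≤ i → W i ≤ Aspan K (2 ^ f i))
    (hW_dim : ∀ i, 1 ≤ i → finrank K (W i) ≤ 2 ^ 2 ^ g i - 2) :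
    ∃ U V : ℕ → Submodule K (FA K),
      (∀ n, U n ≤ Aspan K (2 ^ n)) ∧ (∀ n, V n ≤ Aspan K (2 ^ n)) ∧
      -- (1) `U(2^n) ⊕ V(2^n) = A(2^n)`
      (∀ n, Disjoint (U n) (V n)) ∧ (∀ n, U n ⊔ V n = Aspan K (2 ^ n)) ∧
      -- (2) `dim V(2^n) = 2` whenever `n ∉ T`
      (∀ n, n ∉ Tset f g → finrank K (V n) = 2) ∧
      -- (3) `dim V(2^{n+j}) = 2^{2^j}` whenever `n = f(i) - g(i) - 1` and `0 ≤ j ≤ g(i)`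
      (∀ i j n, 1 ≤ i → n + g i + 1 = f i → j ≤ g i →
        finrank K (V (n + j)) = 2 ^ 2 ^ j) ∧
      -- (4) `V(2^n)` has a basis consisting of words
      (∀ n, ∃ s : Set (FA K), (∀ w ∈ s, IsWord K (2 ^ n) w) ∧
        LinearIndependent K ((↑) : s → FA K) ∧ Submodule.span K s = V n) ∧
      -- (5) `W_i ⊆ U(2^{f(i)})`
      (∀ i, 1 ≤ i → W i ≤ U (f i)) ∧
      -- (6) `A(2^n)U(2^n) + U(2^n)A(2^n) ⊆ U(2^{n+1})`
      (∀ n, Aspan K (2 ^ n) * U n ⊔ U n * Aspan K (2 ^ n) ≤ U (n + 1)) ∧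
      -- (7) `V(2^{n+1}) ⊆ V(2^n)V(2^n)`
      (∀ n, V (n + 1) ≤ V n * V n) ∧
      -- (8) if `n ∉ T` then some word `w ∈ V(2^n)` satisfies `w·A(2^n) ⊆ U(2^{n+1})`
      (∀ n, n ∉ Tset f g → ∃ w, IsWord K (2 ^ n) w ∧ w ∈ V n ∧
        ∀ a ∈ Aspan K (2 ^ n), w * a ∈ U (n + 1)) := by
  obtain ⟨t, hgood, hstep⟩ : ∃ t : ℕ → Submodule K (FA K) × Finset (List (Fin 2)),
      (∀ n, Good K f g n (t n)) ∧ ∀ n, StepRel f g W n (t n) (t (n + 1)) := by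
    choose F hF hR using step hf hW_le hW_dim
    let s : (n : ℕ) → {x // Good K f g n x} := fun n =>
      Nat.rec ⟨_, base hf⟩ (fun n x => ⟨F n x.1 x.2, hF n x.1 x.2⟩) n
    exact ⟨fun n => (s n).1, fun n => (s n).2, fun n => hR n (s n).1 (s n).2⟩
  refine ⟨fun n => (t n).1, fun n => Vs K (t n).2, ?_, ?_, ?_, ?_, ?_, ?_, ?_, ?_, ?_, ?_, ?_⟩
  · intro n
    exact (hgood n).2.2.1 ▸ le_sup_left
  · intro n
    exact Vs_le (hgood n).1
  · intro n
    exact (hgood n).2.1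
  · intro n
    exact (hgood n).2.2.1
  · intro n hn
    simp only [Vs_finrank]
    exact (hgood n).2.2.2.1 hn
  · intro i j n hi hm hj
    simp only [Vs_finrank]
    exact (hgood (n + j)).2.2.2.2 i j n hi hm hj rfl
  · intro n
    refine ⟨wordOf K '' ((t n).2 : Set (List (Fin 2))), ?_, ?_, rfl⟩
    · rintro _ ⟨l, hl, rfl⟩
      exact ⟨l, (hgood n).1 l hl, rfl⟩
    · exact (wordOf_li.linearIndepOn _).id_image
  · intro i hi
    have := hf i hi
    obtain ⟨n, hn⟩ : ∃ n, f i = n + 1 := ⟨f i - 1, by omega⟩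
    have h := (hstep n).1 i hi hn
    rw [hn]
    exact h
  · intro n
    exact (hstep n).2.1
  · intro n
    simp only [Vs_mul]
    exact Vs_mono (hstep n).2.2.1
  · intro n hn
    obtain ⟨l, hl, h⟩ := (hstep n).2.2.2 hn
    exact ⟨wordOf K l, ⟨l, (hgood n).1 l hl, rfl⟩, word_mem_Vs hl, h⟩

end
end
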